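/- There exists ρ* > 0 such that for every ρ ∈ (0,ρ*) there exist a positive continuous function Φ_ρ : (0,∞) → (0,∞), constants c1 > 0, c2 > 0, ξ0 ∈ (0,1), and a constant k_ρ > 0 with the following properties: (i) ξ²·Φ_ρ(ξ) = ∫_0^ξ ∫_{ξ−η}^∞ K(η,ζ)·η·Φ_ρ(η)·Φ_ρ(ζ) dζ dη for every ξ > 0; (ii) ∫_0^∞ ξ·Φ_ρ(ξ) dξ = 1 and ∫_0^∞ ξ^γ·Φ_ρ(ξ) dξ = ρ/(1+ρ); (iii) c1·ρ·ξ^{−2}·e^{−(2/a)·ξ^{−a}} ≤ Φ_ρ(ξ) ≤ c2·ρ·ξ^{−2}·e^{−(1/(2a))·ξ^{−a}} for all ξ ∈ (0,ξ0); (iv) lim_{ξ→∞} ξ^{2+ρ}·Φ_ρ(ξ) = k_ρ·ρ; and (v) k_ρ → 1 as ρ → 0+. -/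

import Mathlib

open Set MeasureTheory Filter

/-- The weight exponent ω. -/
noncomputable def omegaFn (m L ρ x : ℝ) : ℝ :=
  if x ≤ -(L*ρ) then m/ρ*(x+L*ρ) else if x < L*ρ then 0 else -(1/2)*(x - L*ρ)

/-- The norm on the space X_{L,ρ}. -/
noncomputable def normX (m L ρ : ℝ) (h : ℝ → ℝ) : ℝ :=
  ⨆ x : ℝ, |h x| * Real.exp (-(omegaFn m L ρ x))

/-- Membership in the space X_{L,ρ}. -/
def memX (a m L ρ : ℝ) (h : ℝ → ℝ) : Prop :=
  ContinuousOn h {x : ℝ | x ≠ L*ρ} ∧ (∫ x : ℝ, h x) = 1 ∧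
  (1/ρ) * (∫ x : ℝ, Real.exp (-(a/ρ)*x) * h x) = 1/(1+ρ) ∧
  ∀ x : ℝ, |h x| ≤ 2 * Real.exp (omegaFn m L ρ x)

/-- The hypotheses on the coagulation kernel K. -/
def KernelHyp (K : ℝ → ℝ → ℝ) (γ a K0 δ : ℝ) : Prop :=
  γ < 1 ∧ a = 1 - γ ∧
  ContinuousOn (fun p : ℝ × ℝ => K p.1 p.2) (Ioi 0 ×ˢ Ioi 0) ∧
  (∀ x y : ℝ, 0 < x → 0 < y → 0 ≤ K x y) ∧
  (∀ x y : ℝ, 0 < x → 0 < y → K x y = K y x) ∧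
  (∀ x y α : ℝ, 0 < x → 0 < y → 0 < α → K (α*x) (α*y) = α ^ γ * K x y) ∧
  0 < K0 ∧ δ ∈ Ioo 0 (min 1 a) ∧
  ∀ x ∈ Ioo (0:ℝ) 2, |x ^ a * K x 1 - 1| ≤ K0 * x ^ δ

/-- The hypotheses on the fixed parameters m, L0, ρ0. -/
def ParamHyp (a m L0 ρ0 : ℝ) : Prop :=
  max (a+1) (3*a) < m ∧ (1/a) * Real.log (4*m) < L0 ∧ ρ0 ∈ Ioo (0:ℝ) 1

/-- The function Q[h]. -/
noncomputable def Qfun (K : ℝ → ℝ → ℝ) (a ρ : ℝ) (h : ℝ → ℝ) (y : ℝ) : ℝ :=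
  ∫ z : ℝ, Real.exp (a/ρ*(y-z)) * K (Real.exp ((y-z)/ρ)) 1 * h z

/-- The function ψ_ρ[h]. -/
noncomputable def psiFn (K : ℝ → ℝ → ℝ) (a L ρ : ℝ) (h : ℝ → ℝ) (x : ℝ) : ℝ :=
  (1/ρ) * ∫ y in Ioo x (L*ρ), Real.exp (-(a/ρ)*y) * Qfun K a ρ h y

/-- The remainder R[h]. -/
noncomputable def Rfun (K : ℝ → ℝ → ℝ) (a L ρ : ℝ) (h : ℝ → ℝ) (x : ℝ) : ℝ :=
  if x < L*ρ then
    -(1/ρ) * ∫ y in Iio x, ∫ z in Iio (x + ρ * Real.log (1 - Real.exp ((y-x)/ρ))),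
      Real.exp (-(a/ρ)*z) * K (Real.exp ((y-z)/ρ)) 1 * h y * h z
  else
    -(1/ρ) * (∫ y in Ioi x, Real.exp (-(a/ρ)*y) * h y) * (∫ z in Ioi x, h z)
    + (1/ρ) * (∫ y in Iio x, ∫ z in Ioi x,
        (Real.exp (-(a/ρ)*z) * K (Real.exp ((y-z)/ρ)) 1 - Real.exp (-(a/ρ)*y)) * h y * h z)
    + (1/ρ) * (∫ y in Iio x, ∫ z in Ioo (x + ρ * Real.log (1 - Real.exp ((y-x)/ρ))) x,
        Real.exp (-(a/ρ)*z) * K (Real.exp ((y-z)/ρ)) 1 * h y * h z)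

/-- The remainder R̃[h]. -/
noncomputable def Rtil (K : ℝ → ℝ → ℝ) (a L ρ : ℝ) (h : ℝ → ℝ) (x : ℝ) : ℝ :=
  if x < L*ρ then
    Rfun K a L ρ h x - (1/ρ) * ∫ y in Ioo x (L*ρ),
      Real.exp (-(psiFn K a L ρ h x - psiFn K a L ρ h y)) * Real.exp (-(a/ρ)*y) *
        Qfun K a ρ h y * Rfun K a L ρ h y
  else
    Rfun K a L ρ h x - (1/(1+ρ)) * ∫ y in Ioo (L*ρ) x,
      Real.exp ((y-x)/(1+ρ)) * Rfun K a L ρ h y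

/-- Equation (E) in exponential variables. -/
def solvesE (K : ℝ → ℝ → ℝ) (a ρ : ℝ) (h : ℝ → ℝ) : Prop :=
  ∀ x : ℝ, h x = (1/ρ) * ∫ y in Iio x,
    ∫ z in Ioi (x + ρ * Real.log (1 - Real.exp ((y-x)/ρ))),
      Real.exp (-(a/ρ)*z) * K (Real.exp ((y-z)/ρ)) 1 * h y * h z

/-- The decay exponent λ. -/
noncomputable def lamFn (K : ℝ → ℝ → ℝ) (a L ρ : ℝ) (h : ℝ → ℝ) (x : ℝ) : ℝ :=
  if x < L*ρ then -psiFn K a L ρ h x else -(1/2)*(x - L*ρ)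

/-- The remainder H. -/
noncomputable def Hfun (K : ℝ → ℝ → ℝ) (a ρ : ℝ) (h : ℝ → ℝ) (x : ℝ) : ℝ :=
  (1/ρ) * (∫ y in Iio x, ∫ z in Ioi (x + ρ * Real.log (1 - Real.exp ((y-x)/ρ))),
      Real.exp (-(a/ρ)*z) * K (Real.exp ((y-z)/ρ)) 1 * h y * h z)
    - (ρ/(1+ρ)) * h x - (1/(1+ρ)) * ∫ z in Ioi x, h z

section
noncomputable def mm (s t : ℝ) : ℝ := (max 1 t) ^ (-s)

lemma mx_pos (t : ℝ) : (0:ℝ) < max 1 t := lt_of_lt_of_le one_pos (le_max_left _ _)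

lemma mm_pos (s t : ℝ) : 0 < mm s t := Real.rpow_pos_of_pos (mx_pos t) _

lemma mm_nonneg (s t : ℝ) : 0 ≤ mm s t := (mm_pos s t).le

lemma mm_le_one {s : ℝ} (hs : 0 ≤ s) (t : ℝ) : mm s t ≤ 1 :=
  Real.rpow_le_one_of_one_le_of_nonpos (le_max_left _ _) (by linarith)

lemma one_le_mm {s : ℝ} (hs : s ≤ 0) (t : ℝ) : 1 ≤ mm s t :=
  Real.one_le_rpow (le_max_left _ _) (by linarith)

lemma mm_mul (s r t : ℝ) : mm s t * mm r t = mm (s + r) t := by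
  unfold mm
  rw [← Real.rpow_add (mx_pos t)]
  congr 1; ring

lemma mm_zero (t : ℝ) : mm 0 t = 1 := by simp [mm]

lemma mm_of_le {s t : ℝ} (h : t ≤ 1) : mm s t = 1 := by
  unfold mm; rw [max_eq_left h, Real.one_rpow]

lemma mm_of_ge {s t : ℝ} (h : 1 ≤ t) : mm s t = t ^ (-s) := by
  unfold mm; rw [max_eq_right h]

lemma mm_anti {s t t' : ℝ} (hs : 0 ≤ s) (h : t ≤ t') : mm s t' ≤ mm s t :=
  Real.rpow_le_rpow_of_nonpos (mx_pos t) (max_le_max le_rfl h) (by linarith)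

lemma mm_exp {s r : ℝ} (h : s ≤ r) (t : ℝ) : mm r t ≤ mm s t :=
  Real.rpow_le_rpow_of_exponent_le (le_max_left _ _) (by linarith)

lemma mm_comp {s ξ η : ℝ} (hs : 0 ≤ s) (h : ξ ≤ 2 * η) : mm s η ≤ 2 ^ s * mm s ξ := by
  have h1 : max 1 ξ ≤ 2 * max 1 η := by
    apply max_le
    · have := le_max_left 1 η; linarith
    · have := le_max_right 1 η; linarith
  have h2 : (2 * max 1 η) ^ (-s) ≤ (max 1 ξ) ^ (-s) :=
    Real.rpow_le_rpow_of_nonpos (mx_pos ξ) h1 (by linarith)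
  rw [Real.mul_rpow (by norm_num) (mx_pos η).le] at h2
  unfold mm
  have h3 : (2:ℝ) ^ s * (2:ℝ) ^ (-s) = 1 := by
    rw [← Real.rpow_add (by norm_num)]; simp
  calc (max 1 η) ^ (-s) = 2 ^ s * (2 ^ (-s) * (max 1 η) ^ (-s)) := by
        rw [← mul_assoc, h3, one_mul]
    _ ≤ _ := by gcongr

lemma mm_cont (s : ℝ) : Continuous (mm s) := by
  unfold mm
  exact (continuous_const.max continuous_id).rpow_const (fun t => Or.inl (mx_pos t).ne')

lemma ratio_le {δ ζ ξ : ℝ} (hδ : 0 ≤ δ) (h0 : 0 < ζ) (h : ζ ≤ ξ) :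
    (ζ / ξ) ^ δ ≤ mm (-δ) ζ * mm δ ξ := by
  have hξ : 0 < ξ := h0.trans_le h
  rcases le_total ξ 1 with h1 | h1
  · rw [mm_of_le h1, mm_of_le (h.trans h1), mul_one]
    exact Real.rpow_le_one (by positivity) ((div_le_one hξ).2 h) hδ
  · rw [mm_of_ge h1, Real.div_rpow h0.le hξ.le, Real.rpow_neg hξ.le, div_eq_mul_inv]
    gcongr
    unfold mm
    rw [neg_neg]
    gcongr
    exact le_max_right _ _

lemma ratio_le1 {δ ζ ξ : ℝ} (hδ : 0 ≤ δ) (hδ1 : δ ≤ 1) (h0 : 0 < ζ) (h : ζ ≤ ξ) :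
    ζ / ξ ≤ mm (-δ) ζ * mm δ ξ := by
  refine le_trans ?_ (ratio_le hδ h0 h)
  have hξ : 0 < ξ := h0.trans_le h
  conv_lhs => rw [← Real.rpow_one (ζ / ξ)]
  exact Real.rpow_le_rpow_of_exponent_ge (by positivity) ((div_le_one hξ).2 h) hδ1

lemma mm_int_one {s : ℝ} (hs : 1 < s) : IntegrableOn (mm s) (Ioi 1) := by
  refine (integrableOn_Ioi_rpow_of_lt (show -s < -1 by linarith) one_pos).congr_fun ?_ measurableSet_Ioi
  intro t ht
  exact (mm_of_ge (le_of_lt ht)).symm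

lemma mm_int {s : ℝ} (hs : 1 < s) {t : ℝ} (ht : 0 ≤ t) : IntegrableOn (mm s) (Ioi t) := by
  have h1 : IntegrableOn (mm s) (Ioc 0 1) :=
    ((mm_cont s).integrableOn_Icc (a := 0) (b := 1)).mono_set Ioc_subset_Icc_self
  have h2 := h1.union (mm_int_one hs)
  rw [Ioc_union_Ioi_eq_Ioi zero_le_one] at h2
  exact h2.mono_set (Ioi_subset_Ioi ht)

lemma mm_integral_ge {s : ℝ} (hs : 1 < s) {t : ℝ} (ht : 1 ≤ t) :
    ∫ x in Ioi t, mm s x = 1 / (s - 1) * mm (s - 1) t := by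
  have h0 : (0:ℝ) < t := by linarith
  rw [setIntegral_congr_fun (g := fun x => x ^ (-s)) measurableSet_Ioi, integral_Ioi_rpow_of_lt (by linarith) h0, mm_of_ge ht]
  · have : s - 1 ≠ 0 := by linarith
    have h3 : -s + 1 = -(s-1) := by ring
    rw [h3]; field_simp
  · intro x hx
    exact mm_of_ge (ht.trans (le_of_lt hx))

lemma mm_integral {s : ℝ} (hs : 1 < s) {t : ℝ} (ht : 0 ≤ t) :
    ∫ x in Ioi t, mm s x ≤ s / (s - 1) * mm (s - 1) t := by
  have hs1 : 0 < s - 1 := by linarith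
  rcases le_total 1 t with h | h
  · rw [mm_integral_ge hs h]
    gcongr
    · exact mm_nonneg _ _
  · rw [mm_of_le h]
    have e : Ioi t = Ioc t 1 ∪ Ioi 1 := (Ioc_union_Ioi_eq_Ioi h).symm
    rw [e, setIntegral_union (Ioc_disjoint_Ioi le_rfl) measurableSet_Ioi
      ((mm_int hs ht).mono_set Ioc_subset_Ioi_self) (mm_int_one hs), mm_integral_ge hs le_rfl, mm_of_le le_rfl]
    have : ∫ x in Ioc t 1, mm s x = 1 - t := by
      rw [setIntegral_congr_fun (g := fun x => (1:ℝ)) measurableSet_Ioc]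
      · simp [h]
      · intro x hx
        exact mm_of_le hx.2
    rw [this]
    have : s / (s-1) = 1 + 1/(s-1) := by field_simp; ring
    rw [this]; linarith

lemma mm_integral_all {s : ℝ} (hs : 1 < s) {t : ℝ} (ht : 0 ≤ t) :
    ∫ x in Ioi t, mm s x ≤ s / (s - 1) := by
  refine (mm_integral hs ht).trans ?_
  have hs1 : 0 < s - 1 := by linarith
  have := mm_le_one hs1.le t
  have h2 : 0 < s / (s-1) := by positivity
  nlinarith

/-- the superexponential factor -/
noncomputable def gg (a t : ℝ) : ℝ := Real.exp (-(t ^ (-a) / (4 * a)))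

lemma gg_pos (a t : ℝ) : 0 < gg a t := Real.exp_pos _

lemma gg_le_one {a t : ℝ} (ha : 0 < a) (ht : 0 < t) : gg a t ≤ 1 := by
  unfold gg
  rw [Real.exp_le_one_iff]
  have := Real.rpow_pos_of_pos ht (-a)
  have : 0 < t ^ (-a) / (4 * a) := by positivity
  linarith

lemma gg_le {a : ℝ} (ha : 0 < a) : ∃ C : ℝ, 1 ≤ C ∧ ∀ t : ℝ, 0 < t →
    gg a t ≤ C * (t ^ (2 + a) * mm (2 + a) t) := by
  set n : ℝ := (2 + a) / a with hn
  have hn0 : 0 < n := by positivity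
  set B : ℝ := (4 * a * n) ^ n with hB
  have hB0 : 0 < B := by positivity
  refine ⟨B + 1, by linarith, fun t ht => ?_⟩
  rcases le_total t 1 with h | h
  · rw [mm_of_le h, mul_one]
    set y := t ^ (-a) / (4 * a) with hy
    have hy0 : 0 < y := by positivity
    have h1 : (y / n) ^ n ≤ Real.exp y := by
      have h2 : y / n ≤ Real.exp (y / n) := by
        have := Real.add_one_le_exp (y / n); linarith
      calc (y / n) ^ n ≤ (Real.exp (y / n)) ^ n := by gcongr
        _ = Real.exp y := by rw [← Real.exp_mul]; congr 1; field_simp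
    have h3 : (y / n) ^ n = t ^ (-(2 + a)) / B := by
      have : y / n = t ^ (-a) / (4 * a * n) := by rw [hy]; field_simp
      rw [this, Real.div_rpow (by positivity) (by positivity), ← Real.rpow_mul ht.le]
      congr 2
      rw [hn]; field_simp
    have h4 : gg a t * Real.exp y = 1 := by
      unfold gg; rw [← Real.exp_add]; simp [hy]
    rw [h3, Real.rpow_neg ht.le, ] at h1
    have h5 : 0 < t ^ (2 + a) := by positivity
    have h6 : 1 ≤ B * t ^ (2+a) * Real.exp y := by
      have : B * t ^ (2+a) * ((t ^ (2 + a))⁻¹ / B) = 1 := by field_simp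
      rw [← this]; gcongr
    calc gg a t = gg a t * 1 := by ring
      _ ≤ gg a t * (B * t ^ (2+a) * Real.exp y) := by
        gcongr; exact (gg_pos a t).le
      _ = B * t ^ (2+a) * (gg a t * Real.exp y) := by ring
      _ = B * t ^ (2+a) := by rw [h4, mul_one]
      _ ≤ _ := by nlinarith
  · rw [mm_of_ge h, ← Real.rpow_add ht]
    have := gg_le_one ha ht
    simp; linarith
end

section
structure InS (δ ρ : ℝ) (q : ℝ → ℝ) : Prop where
  cont : ContinuousOn q (Ioi 0)
  bd : ∀ ξ : ℝ, 0 < ξ → |q ξ - mm ρ ξ| ≤ 1 / 2 * mm δ ξ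

/-- standing parameter assumptions -/
structure Par (a δ ρ : ℝ) : Prop where
  ha : 0 < a
  hδ : 0 < δ
  hδ1 : δ < 1
  hδa : δ < a
  hρ : 0 < ρ
  hρδ : ρ ≤ δ

namespace InS
variable {a δ ρ : ℝ} {q : ℝ → ℝ}

lemma lower (hp : Par a δ ρ) (h : InS δ ρ q) {ξ : ℝ} (hξ : 0 < ξ) : 1 / 2 * mm ρ ξ ≤ q ξ := by
  have h1 := (abs_le.1 (h.bd ξ hξ)).1
  have h2 := mm_exp hp.hρδ ξ
  linarith

lemma pos (hp : Par a δ ρ) (h : InS δ ρ q) {ξ : ℝ} (hξ : 0 < ξ) : 0 < q ξ := by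
  have := h.lower hp hξ
  have := mm_pos ρ ξ
  linarith

lemma upper (hp : Par a δ ρ) (h : InS δ ρ q) {ξ : ℝ} (hξ : 0 < ξ) : q ξ ≤ 2 * mm ρ ξ := by
  have h1 := (abs_le.1 (h.bd ξ hξ)).2
  have h2 := mm_exp hp.hρδ ξ
  have := mm_pos ρ ξ
  linarith

lemma le_two (hp : Par a δ ρ) (h : InS δ ρ q) {ξ : ℝ} (hξ : 0 < ξ) : q ξ ≤ 2 := by
  have := h.upper hp hξ
  have := mm_le_one hp.hρ.le ξ
  linarith

end InS

lemma pow_int {a η : ℝ} (ha : 0 < a) (hη : 0 < η) :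
    IntegrableOn (fun s : ℝ => s ^ (-1 - a)) (Ioi η) :=
  integrableOn_Ioi_rpow_of_lt (by linarith) hη

lemma pow_integral {a η : ℝ} (ha : 0 < a) (hη : 0 < η) :
    ∫ s in Ioi η, s ^ (-1 - a) = η ^ (-a) / a := by
  rw [integral_Ioi_rpow_of_lt (by linarith) hη]
  have : -1 - a + 1 = -a := by ring
  rw [this]; field_simp

lemma w_int {a η B : ℝ} {f : ℝ → ℝ} (ha : 0 < a) (hη : 0 < η) (hf : ContinuousOn f (Ioi 0))
    (hb : ∀ s, 0 < s → |f s| ≤ B) :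
    IntegrableOn (fun s : ℝ => s ^ (-1 - a) * f s) (Ioi η) := by
  have hsub : Ioi η ⊆ Ioi (0:ℝ) := Ioi_subset_Ioi hη.le
  refine Integrable.mono' ((pow_int ha hη).const_mul B) ?_ ?_
  · apply ContinuousOn.aestronglyMeasurable _ measurableSet_Ioi
    apply ContinuousOn.mul _ (hf.mono hsub)
    intro s hs
    exact (Real.continuousAt_rpow_const _ _ (Or.inl (hη.trans hs).ne')).continuousWithinAt
  · rw [ae_restrict_iff' measurableSet_Ioi]
    refine Eventually.of_forall fun s hs => ?_
    have hs0 : 0 < s := hη.trans hs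
    have h1 : 0 < s ^ (-1 - a) := by positivity
    rw [Real.norm_eq_abs, abs_mul, abs_of_pos h1, mul_comm B]
    exact mul_le_mul_of_nonneg_left (hb s hs0) h1.le

noncomputable def II (a : ℝ) (q : ℝ → ℝ) (η : ℝ) : ℝ := ∫ s in Ioi η, s ^ (-1 - a) * q s

lemma InS.w_int {a δ ρ η : ℝ} {q : ℝ → ℝ} (hp : Par a δ ρ) (h : InS δ ρ q) (hη : 0 < η) :
    IntegrableOn (fun s : ℝ => s ^ (-1 - a) * q s) (Ioi η) :=
  _root_.w_int hp.ha hη h.cont (B := 2) fun s hs => by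
    rw [abs_of_pos (h.pos hp hs)]; exact h.le_two hp hs

/-- generic: lower bound of the exponent over a set -/
lemma expo_lower {a δ ρ η : ℝ} {q : ℝ → ℝ} (hp : Par a δ ρ) (h : InS δ ρ q) (hη : 0 < η)
    {A : Set ℝ} (hA : MeasurableSet A) (hAη : A ⊆ Ioi η) :
    1 / 2 * (∫ s in A, s ^ (-1 - a)) - 1 / (2 * a) ≤ ∫ s in A, s ^ (-1 - a) * q s := by
  have i1 : IntegrableOn (fun s : ℝ => s ^ (-1 - a)) A := (pow_int hp.ha hη).mono_set hAη
  have i2 := (h.w_int hp hη).mono_set hAη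
  have i3 : IntegrableOn ((Ioi (1:ℝ)).indicator (fun s : ℝ => s ^ (-1 - a))) A :=
    i1.indicator measurableSet_Ioi
  have h1 : ∫ s in A, (Ioi (1:ℝ)).indicator (fun s : ℝ => s ^ (-1 - a)) s ≤ 1 / a := by
    rw [setIntegral_indicator measurableSet_Ioi]
    calc ∫ s in A ∩ Ioi 1, s ^ (-1 - a) ≤ ∫ s in Ioi (1:ℝ), s ^ (-1 - a) := by
          apply setIntegral_mono_set (pow_int hp.ha one_pos)
          · rw [EventuallyLE, ae_restrict_iff' measurableSet_Ioi]
            refine Eventually.of_forall fun s hs => ?_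
            have : (0:ℝ) < s := one_pos.trans hs
            simp; positivity
          · exact (inter_subset_right).eventuallyLE
      _ = 1 / a := by rw [pow_integral hp.ha one_pos]; simp
  have h2 : ∫ s in A, (1/2 * s ^ (-1 - a) - 1/2 * (Ioi (1:ℝ)).indicator (fun s : ℝ => s ^ (-1 - a)) s)
      ≤ ∫ s in A, s ^ (-1 - a) * q s := by
    apply setIntegral_mono_on ((i1.const_mul _).sub (i3.const_mul _)) i2 hA
    intro s hs
    have hs0 : 0 < s := hη.trans (hAη hs)
    have hs1 : 0 < s ^ (-1 - a) := by positivity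
    simp only [Pi.sub_apply]
    by_cases h3 : 1 < s
    · rw [indicator_of_mem (by exact h3)]
      have := h.pos hp hs0
      have : 0 < s ^ (-1 - a) * q s := by positivity
      linarith
    · rw [indicator_of_notMem (by exact h3)]
      have := h.lower hp hs0
      rw [mm_of_le (not_lt.1 h3)] at this
      nlinarith
  rw [integral_sub (i1.const_mul _) (i3.const_mul _), integral_const_mul, integral_const_mul] at h2
  have : 1 / (2 * a) = 1/2 * (1 / a) := by field_simp
  linarith

lemma expo_diff {a δ ρ η d : ℝ} {q₁ q₂ : ℝ → ℝ} (hp : Par a δ ρ) (h₁ : InS δ ρ q₁)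
    (h₂ : InS δ ρ q₂) (hd : ∀ ξ, 0 < ξ → |q₁ ξ - q₂ ξ| ≤ d * mm δ ξ) (hη : 0 < η)
    {A : Set ℝ} (hA : MeasurableSet A) (hAη : A ⊆ Ioi η) :
    |(∫ s in A, s ^ (-1 - a) * q₁ s) - ∫ s in A, s ^ (-1 - a) * q₂ s|
      ≤ d * mm δ η * (∫ s in A, s ^ (-1 - a)) := by
  have hd0 : 0 ≤ d := by
    have h1 := hd 1 one_pos
    rw [mm_of_le le_rfl, mul_one] at h1
    exact (abs_nonneg _).trans h1
  have i1 : IntegrableOn (fun s : ℝ => s ^ (-1 - a)) A := (pow_int hp.ha hη).mono_set hAη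
  rw [← integral_sub ((h₁.w_int hp hη).mono_set hAη) ((h₂.w_int hp hη).mono_set hAη),
    ← integral_const_mul, ← Real.norm_eq_abs]
  apply norm_integral_le_of_norm_le (i1.const_mul _)
  rw [ae_restrict_iff' hA]
  refine Eventually.of_forall fun s hs => ?_
  have hs0 : 0 < s := hη.trans (hAη hs)
  have hs1 : 0 < s ^ (-1 - a) := by positivity
  rw [← mul_sub, Real.norm_eq_abs, abs_mul, abs_of_pos hs1, mul_comm]
  have := mm_anti hp.hδ.le (le_of_lt (hAη hs))
  gcongr
  exact (hd s hs0).trans (by gcongr)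

lemma exp_diff_aux {x y l : ℝ} (hx : l ≤ x) (hy : l ≤ y) :
    |Real.exp (-x) - Real.exp (-y)| ≤ |x - y| * Real.exp (-l) := by
  wlog hxy : x ≤ y generalizing x y
  · rw [abs_sub_comm, abs_sub_comm x]; exact this hy hx (le_of_not_ge hxy)
  have h1 : Real.exp (-y) ≤ Real.exp (-x) := Real.exp_le_exp.2 (by linarith)
  rw [abs_of_nonneg (by linarith), abs_sub_comm, abs_of_nonneg (by linarith)]
  have h2 : Real.exp (-y) = Real.exp (-x) * Real.exp (-(y - x)) := by
    rw [← Real.exp_add]; congr 1; ring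
  have h3 := Real.add_one_le_exp (-(y - x))
  have h4 : Real.exp (-x) ≤ Real.exp (-l) := Real.exp_le_exp.2 (by linarith)
  have h5 := Real.exp_pos (-x)
  calc Real.exp (-x) - Real.exp (-y) = Real.exp (-x) * (1 - Real.exp (-(y-x))) := by rw [h2]; ring
    _ ≤ Real.exp (-x) * (y - x) := mul_le_mul_of_nonneg_left (by linarith) h5.le
    _ ≤ Real.exp (-l) * (y - x) := by
        apply mul_le_mul_of_nonneg_right h4; linarith
    _ = _ := by ring

/-- constant for exponent estimates -/
noncomputable def CE (a : ℝ) : ℝ := 4 * Real.exp (1 / (2 * a))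

lemma CE_ge {a : ℝ} (ha : 0 < a) : 4 ≤ CE a := by
  unfold CE
  have : 1 ≤ Real.exp (1 / (2*a)) := Real.one_le_exp (by positivity)
  linarith

lemma exp_set_bound {a δ ρ η : ℝ} {q : ℝ → ℝ} (hp : Par a δ ρ) (h : InS δ ρ q) (hη : 0 < η)
    {A : Set ℝ} (hA : MeasurableSet A) (hAη : A ⊆ Ioi η) :
    Real.exp (-(∫ s in A, s ^ (-1 - a) * q s)) ≤
      CE a * Real.exp (-((∫ s in A, s ^ (-1 - a)) / 4)) := by
  have h1 := expo_lower hp h hη hA hAη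
  have h0 : 0 ≤ ∫ s in A, s ^ (-1 - a) := setIntegral_nonneg hA fun s hs => by
    have : 0 < s := hη.trans (hAη hs)
    positivity
  unfold CE
  calc Real.exp (-(∫ s in A, s ^ (-1 - a) * q s))
      ≤ Real.exp (1 / (2*a) + -((∫ s in A, s ^ (-1 - a)) / 4)) := Real.exp_le_exp.2 (by linarith)
    _ = 1 * Real.exp (1 / (2*a)) * Real.exp (-((∫ s in A, s ^ (-1 - a)) / 4)) := by
        rw [Real.exp_add]; ring
    _ ≤ _ := by gcongr; norm_num

lemma exp_set_diff {a δ ρ η d : ℝ} {q₁ q₂ : ℝ → ℝ} (hp : Par a δ ρ) (h₁ : InS δ ρ q₁)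
    (h₂ : InS δ ρ q₂) (hd : ∀ ξ, 0 < ξ → |q₁ ξ - q₂ ξ| ≤ d * mm δ ξ) (hη : 0 < η)
    {A : Set ℝ} (hA : MeasurableSet A) (hAη : A ⊆ Ioi η) :
    |Real.exp (-(∫ s in A, s ^ (-1 - a) * q₁ s)) - Real.exp (-(∫ s in A, s ^ (-1 - a) * q₂ s))|
      ≤ CE a * d * mm δ η * Real.exp (-((∫ s in A, s ^ (-1 - a)) / 4)) := by
  have hd0 : 0 ≤ d := by
    have h1 := hd 1 one_pos
    rw [mm_of_le le_rfl, mul_one] at h1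
    exact (abs_nonneg _).trans h1
  have l1 := expo_lower hp h₁ hη hA hAη
  have l2 := expo_lower hp h₂ hη hA hAη
  have h3 := expo_diff hp h₁ h₂ hd hη hA hAη
  refine (exp_diff_aux l1 l2).trans ?_
  set J := ∫ s in A, s ^ (-1 - a) with hJ
  have e1 : Real.exp (-(1/2 * J - 1/(2*a))) = Real.exp (1/(2*a)) * (Real.exp (-(J/4)) * Real.exp (-(J/4))) := by
    rw [← Real.exp_add, ← Real.exp_add]; congr 1; ring
  have e2 : J * Real.exp (-(J/4)) ≤ 4 := by
    have := Real.add_one_le_exp (J/4)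
    have h5 : Real.exp (J/4) * Real.exp (-(J/4)) = 1 := by rw [← Real.exp_add]; simp
    have h6 := Real.exp_pos (-(J/4))
    nlinarith
  rw [e1]
  have hm := mm_nonneg δ η
  calc _ ≤ d * mm δ η * J * (Real.exp (1/(2*a)) * (Real.exp (-(J/4)) * Real.exp (-(J/4)))) := by
        gcongr
    _ = d * mm δ η * Real.exp (1/(2*a)) * Real.exp (-(J/4)) * (J * Real.exp (-(J/4))) := by ring
    _ ≤ d * mm δ η * Real.exp (1/(2*a)) * Real.exp (-(J/4)) * 4 := by gcongr
    _ = _ := by unfold CE; ring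
end

section
noncomputable def PP (a ρ : ℝ) (q : ℝ → ℝ) (η : ℝ) : ℝ := (1 + ρ)⁻¹ * Real.exp (-II a q η)
noncomputable def RR (a : ℝ) (q : ℝ → ℝ) (η ξ : ℝ) : ℝ :=
  Real.exp (-(∫ s in Ioc η ξ, s ^ (-1 - a) * q s))
noncomputable def uu (a ρ : ℝ) (q : ℝ → ℝ) (η : ℝ) : ℝ := q η * PP a ρ q η

lemma PP_pos {a ρ : ℝ} (hρ : 0 < ρ) (q : ℝ → ℝ) (η : ℝ) : 0 < PP a ρ q η := by
  unfold PP; positivity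

lemma II_sub {a δ ρ η ξ : ℝ} {q : ℝ → ℝ} (hp : Par a δ ρ) (h : InS δ ρ q) (hη : 0 < η)
    (hξ : η ≤ ξ) : II a q η = (∫ s in Ioc η ξ, s ^ (-1 - a) * q s) + II a q ξ := by
  unfold II
  have h1 := h.w_int hp hη
  rw [← Ioc_union_Ioi_eq_Ioi hξ, setIntegral_union (Ioc_disjoint_Ioi le_rfl) measurableSet_Ioi
    (h1.mono_set Ioc_subset_Ioi_self) (h1.mono_set (Ioi_subset_Ioi hξ))]

lemma pow_Ioc {a η ξ : ℝ} (ha : 0 < a) (hη : 0 < η) (hξ : η ≤ ξ) :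
    ∫ s in Ioc η ξ, s ^ (-1 - a) = (η ^ (-a) - ξ ^ (-a)) / a := by
  have h1 := pow_int ha hη
  have h2 : ∫ s in Ioi η, s ^ (-1 - a) = (∫ s in Ioc η ξ, s ^ (-1 - a)) +
      ∫ s in Ioi ξ, s ^ (-1 - a) := by
    rw [← Ioc_union_Ioi_eq_Ioi hξ, setIntegral_union (Ioc_disjoint_Ioi le_rfl) measurableSet_Ioi
      (h1.mono_set Ioc_subset_Ioi_self) (h1.mono_set (Ioi_subset_Ioi hξ))]
  rw [pow_integral ha hη, pow_integral ha (hη.trans_le hξ)] at h2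
  rw [sub_div]; linarith

lemma gg_ratio {a η ξ : ℝ} (ha : 0 < a) (hη : 0 < η) (hξ : η ≤ ξ) :
    Real.exp (-((∫ s in Ioc η ξ, s ^ (-1 - a)) / 4)) = gg a η / gg a ξ := by
  rw [pow_Ioc ha hη hξ]; unfold gg
  rw [← Real.exp_sub]; congr 1; field_simp; ring

lemma PP_RR {a δ ρ η ξ : ℝ} {q : ℝ → ℝ} (hp : Par a δ ρ) (h : InS δ ρ q) (hη : 0 < η)
    (hξ : η ≤ ξ) : PP a ρ q η = RR a q η ξ * PP a ρ q ξ := by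
  unfold PP RR
  rw [II_sub hp h hη hξ, neg_add, Real.exp_add]; ring

lemma RR_pos (a : ℝ) (q : ℝ → ℝ) (η ξ : ℝ) : 0 < RR a q η ξ := Real.exp_pos _

lemma RR_le_one {a δ ρ η ξ : ℝ} {q : ℝ → ℝ} (hp : Par a δ ρ) (h : InS δ ρ q) (hη : 0 < η) :
    RR a q η ξ ≤ 1 := by
  unfold RR
  rw [Real.exp_le_one_iff, neg_nonpos]
  apply setIntegral_nonneg measurableSet_Ioc
  intro s hs
  have : 0 < s := hη.trans hs.1
  have := h.pos hp this
  positivity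

lemma RR_le {a δ ρ η ξ : ℝ} {q : ℝ → ℝ} (hp : Par a δ ρ) (h : InS δ ρ q) (hη : 0 < η)
    (hξ : η ≤ ξ) : RR a q η ξ ≤ CE a * (gg a η / gg a ξ) := by
  rw [← gg_ratio hp.ha hη hξ]
  exact exp_set_bound hp h hη measurableSet_Ioc Ioc_subset_Ioi_self

lemma RR_diff {a δ ρ η ξ d : ℝ} {q₁ q₂ : ℝ → ℝ} (hp : Par a δ ρ) (h₁ : InS δ ρ q₁)
    (h₂ : InS δ ρ q₂) (hd : ∀ ξ, 0 < ξ → |q₁ ξ - q₂ ξ| ≤ d * mm δ ξ) (hη : 0 < η)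
    (hξ : η ≤ ξ) :
    |RR a q₁ η ξ - RR a q₂ η ξ| ≤ CE a * d * mm δ η * (gg a η / gg a ξ) := by
  rw [← gg_ratio hp.ha hη hξ]
  exact exp_set_diff hp h₁ h₂ hd hη measurableSet_Ioc Ioc_subset_Ioi_self

lemma inv_le {ρ : ℝ} (hρ : 0 < ρ) : (1 + ρ)⁻¹ ≤ 1 := inv_le_one_of_one_le₀ (by linarith)

lemma gg_full {a η : ℝ} (ha : 0 < a) (hη : 0 < η) :
    Real.exp (-((∫ s in Ioi η, s ^ (-1 - a)) / 4)) = gg a η := by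
  rw [pow_integral ha hη]; unfold gg
  congr 1; field_simp

lemma PP_le {a δ ρ η : ℝ} {q : ℝ → ℝ} (hp : Par a δ ρ) (h : InS δ ρ q) (hη : 0 < η) :
    PP a ρ q η ≤ CE a * gg a η := by
  have h1 := exp_set_bound hp h hη measurableSet_Ioi Subset.rfl
  rw [gg_full hp.ha hη] at h1
  have h2 := inv_le hp.hρ
  have : 0 < 1 + ρ := by linarith [hp.hρ]
  unfold PP II
  calc _ ≤ 1 * Real.exp (-(∫ s in Ioi η, s ^ (-1 - a) * q s)) := by gcongr
    _ ≤ _ := by rw [one_mul]; exact h1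

lemma PP_le_one {a δ ρ η : ℝ} {q : ℝ → ℝ} (hp : Par a δ ρ) (h : InS δ ρ q) (hη : 0 < η) :
    PP a ρ q η ≤ (1 + ρ)⁻¹ := by
  unfold PP
  have : 0 < 1 + ρ := by linarith [hp.hρ]
  apply mul_le_of_le_one_right (by positivity)
  rw [Real.exp_le_one_iff, neg_nonpos]
  apply setIntegral_nonneg measurableSet_Ioi
  intro s hs
  have : 0 < s := hη.trans hs
  have := h.pos hp this
  positivity

lemma PP_diff {a δ ρ η d : ℝ} {q₁ q₂ : ℝ → ℝ} (hp : Par a δ ρ) (h₁ : InS δ ρ q₁)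
    (h₂ : InS δ ρ q₂) (hd : ∀ ξ, 0 < ξ → |q₁ ξ - q₂ ξ| ≤ d * mm δ ξ) (hη : 0 < η) :
    |PP a ρ q₁ η - PP a ρ q₂ η| ≤ CE a * d * mm δ η * gg a η := by
  have h1 := exp_set_diff hp h₁ h₂ hd hη measurableSet_Ioi Subset.rfl
  rw [gg_full hp.ha hη] at h1
  have h2 := inv_le hp.hρ
  have : 0 < 1 + ρ := by linarith [hp.hρ]
  unfold PP II
  rw [← mul_sub, abs_mul, abs_of_pos (by positivity)]
  calc _ ≤ 1 * |Real.exp (-(∫ s in Ioi η, s ^ (-1 - a) * q₁ s)) - Real.exp (-(∫ s in Ioi η, s ^ (-1 - a) * q₂ s))| := by gcongr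
    _ ≤ _ := by rw [one_mul]; exact h1

lemma d_nonneg {δ d : ℝ} {q₁ q₂ : ℝ → ℝ} (hd : ∀ ξ, 0 < ξ → |q₁ ξ - q₂ ξ| ≤ d * mm δ ξ) : 0 ≤ d := by
  have h1 := hd 1 one_pos
  rw [mm_of_le le_rfl, mul_one] at h1
  exact (abs_nonneg _).trans h1

lemma uu_pos {a δ ρ η : ℝ} {q : ℝ → ℝ} (hp : Par a δ ρ) (h : InS δ ρ q) (hη : 0 < η) :
    0 < uu a ρ q η := mul_pos (h.pos hp hη) (PP_pos hp.hρ q η)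

lemma uu_le {a δ ρ η : ℝ} {q : ℝ → ℝ} (hp : Par a δ ρ) (h : InS δ ρ q) (hη : 0 < η) :
    uu a ρ q η ≤ 2 * CE a * mm ρ η * gg a η := by
  unfold uu
  calc q η * PP a ρ q η ≤ (2 * mm ρ η) * (CE a * gg a η) :=
        mul_le_mul (h.upper hp hη) (PP_le hp h hη) (PP_pos hp.hρ q η).le
          (mul_nonneg two_pos.le (mm_nonneg _ _))
    _ = _ := by ring

lemma uu_le_two {a δ ρ η : ℝ} {q : ℝ → ℝ} (hp : Par a δ ρ) (h : InS δ ρ q) (hη : 0 < η) :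
    uu a ρ q η ≤ 2 * mm ρ η := by
  unfold uu
  calc q η * PP a ρ q η ≤ (2 * mm ρ η) * 1 :=
        mul_le_mul (h.upper hp hη) ((PP_le_one hp h hη).trans (inv_le hp.hρ)) (PP_pos hp.hρ q η).le
          (mul_nonneg two_pos.le (mm_nonneg _ _))
    _ = _ := by ring

lemma prod_diff (x y x' y' : ℝ) : |x * y - x' * y'| ≤ |x - x'| * |y| + |x'| * |y - y'| := by
  have : x * y - x' * y' = (x - x') * y + x' * (y - y') := by ring
  rw [this, ← abs_mul, ← abs_mul]; exact abs_add_le _ _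

lemma uu_diff {a δ ρ η d : ℝ} {q₁ q₂ : ℝ → ℝ} (hp : Par a δ ρ) (h₁ : InS δ ρ q₁)
    (h₂ : InS δ ρ q₂) (hd : ∀ ξ, 0 < ξ → |q₁ ξ - q₂ ξ| ≤ d * mm δ ξ) (hη : 0 < η) :
    |uu a ρ q₁ η - uu a ρ q₂ η| ≤ 3 * CE a * d * mm δ η * gg a η := by
  unfold uu
  refine (prod_diff _ _ _ _).trans ?_
  have hd0 := d_nonneg hd
  have e1 := PP_le hp h₁ hη
  have e2 := PP_diff hp h₁ h₂ hd hη
  have e3 := hd η hη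
  have e4 := h₂.le_two hp hη
  have := CE_ge hp.ha
  have := mm_nonneg δ η
  have := gg_pos a η
  have := (PP_pos (a := a) hp.hρ q₁ η).le
  rw [abs_of_pos (PP_pos hp.hρ q₁ η), abs_of_pos (h₂.pos hp hη)]
  calc _ ≤ (d * mm δ η) * (CE a * gg a η) + 2 * (CE a * d * mm δ η * gg a η) := by
        gcongr
    _ = _ := by ring

/-- uniform algebraic bounds -/
lemma uu_alg {a : ℝ} (ha : 0 < a) : ∃ C : ℝ, 1 ≤ C ∧ ∀ δ ρ q, Par a δ ρ → InS δ ρ q → ∀ η, 0 < η →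
    uu a ρ q η ≤ C * mm ρ η * (η ^ (2 + a) * mm (2 + a) η) := by
  obtain ⟨C, hC, h⟩ := gg_le ha
  have := CE_ge ha
  refine ⟨2 * CE a * C, by nlinarith, fun δ ρ q hp hq η hη => (uu_le hp hq hη).trans ?_⟩
  have := mm_nonneg ρ η
  calc _ ≤ 2 * CE a * mm ρ η * (C * (η ^ (2 + a) * mm (2 + a) η)) := by gcongr; exact h η hη
    _ = _ := by ring

lemma uu_diff_alg {a : ℝ} (ha : 0 < a) : ∃ C : ℝ, 1 ≤ C ∧ ∀ δ ρ q₁ q₂ d, Par a δ ρ → InS δ ρ q₁ →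
    InS δ ρ q₂ → (∀ ξ, 0 < ξ → |q₁ ξ - q₂ ξ| ≤ d * mm δ ξ) → ∀ η, 0 < η →
    |uu a ρ q₁ η - uu a ρ q₂ η| ≤ C * d * mm δ η * (η ^ (2 + a) * mm (2 + a) η) := by
  obtain ⟨C, hC, h⟩ := gg_le ha
  have := CE_ge ha
  refine ⟨3 * CE a * C, by nlinarith, fun δ ρ q₁ q₂ d hp h₁ h₂ hd η hη =>
    (uu_diff hp h₁ h₂ hd hη).trans ?_⟩
  have := mm_nonneg δ η
  have := d_nonneg hd
  calc _ ≤ 3 * CE a * d * mm δ η * (C * (η ^ (2 + a) * mm (2 + a) η)) := by gcongr; exact h η hη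
    _ = _ := by ring

/-! derivatives -/
lemma w_contAt {a x : ℝ} {q : ℝ → ℝ} (hq : ContinuousOn q (Ioi 0)) (hx : 0 < x) :
    ContinuousAt (fun s : ℝ => s ^ (-1 - a) * q s) x :=
  (Real.continuousAt_rpow_const _ _ (Or.inl hx.ne')).mul (hq.continuousAt (Ioi_mem_nhds hx))

/-- generic tail derivative -/
lemma tail_hasDerivAt {f : ℝ → ℝ} (hf : ContinuousOn f (Ioi 0))
    (hi : ∀ x, 0 < x → IntegrableOn f (Ioi x)) {x : ℝ} (hx : 0 < x) :
    HasDerivAt (fun x => ∫ s in Ioi x, f s) (-f x) x := by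
  have h2 : 0 < x / 2 := by linarith
  have hx1 : x / 2 < x := by linarith
  have key : ∀ y, x / 2 < y → ∫ s in Ioi y, f s = (∫ s in Ioi (x / 2), f s) - ∫ s in (x/2)..y, f s := by
    intro y hy
    rw [← intervalIntegral.integral_interval_add_Ioi (hi _ h2) (hi _ (h2.trans hy))]
    ring
  have hI : IntervalIntegrable f volume (x/2) x :=
    (intervalIntegrable_iff_integrableOn_Ioc_of_le hx1.le).2 ((hi _ h2).mono_set Ioc_subset_Ioi_self)
  have hm : StronglyMeasurableAtFilter f (nhds x) volume :=
    hf.stronglyMeasurableAtFilter isOpen_Ioi x hx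
  have h3 := intervalIntegral.integral_hasDerivAt_right hI hm (hf.continuousAt (Ioi_mem_nhds hx))
  have h4 := (h3.const_sub (∫ s in Ioi (x / 2), f s))
  refine h4.congr_of_eventuallyEq ?_
  filter_upwards [Ioi_mem_nhds hx1] with y hy
  exact key y hy

lemma II_hasDerivAt {a δ ρ ξ : ℝ} {q : ℝ → ℝ} (hp : Par a δ ρ) (h : InS δ ρ q) (hξ : 0 < ξ) :
    HasDerivAt (II a q) (-(ξ ^ (-1 - a) * q ξ)) ξ :=
  tail_hasDerivAt (f := fun s => s ^ (-1 - a) * q s)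
    (fun _ hx => (w_contAt h.cont hx).continuousWithinAt) (fun _ hx => h.w_int hp hx) hξ

lemma PP_hasDerivAt {a δ ρ ξ : ℝ} {q : ℝ → ℝ} (hp : Par a δ ρ) (h : InS δ ρ q) (hξ : 0 < ξ) :
    HasDerivAt (PP a ρ q) (ξ ^ (-1 - a) * uu a ρ q ξ) ξ := by
  have h1 := ((II_hasDerivAt hp h hξ).neg.exp).const_mul ((1 + ρ)⁻¹)
  refine HasDerivAt.congr_deriv h1 ?_
  unfold uu PP
  simp only [Pi.neg_apply]; ring

lemma PP_cont {a δ ρ : ℝ} {q : ℝ → ℝ} (hp : Par a δ ρ) (h : InS δ ρ q) :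
    ContinuousOn (PP a ρ q) (Ioi 0) := fun _ hx =>
  (PP_hasDerivAt hp h hx).continuousAt.continuousWithinAt

lemma uu_cont {a δ ρ : ℝ} {q : ℝ → ℝ} (hp : Par a δ ρ) (h : InS δ ρ q) :
    ContinuousOn (uu a ρ q) (Ioi 0) := h.cont.mul (PP_cont hp h)

lemma gg_tendsto {a : ℝ} (ha : 0 < a) : Tendsto (gg a) (nhdsWithin 0 (Ioi 0)) (nhds 0) := by
  unfold gg
  apply Real.tendsto_exp_neg_atTop_nhds_zero.comp
  apply Tendsto.atTop_div_const (by positivity)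
  exact tendsto_rpow_neg_nhdsGT_zero (by linarith)

lemma PP_tendsto_zero {a δ ρ : ℝ} {q : ℝ → ℝ} (hp : Par a δ ρ) (h : InS δ ρ q) :
    Tendsto (PP a ρ q) (nhdsWithin 0 (Ioi 0)) (nhds 0) := by
  have := (gg_tendsto hp.ha).const_mul (CE a)
  rw [mul_zero] at this
  refine squeeze_zero' ?_ ?_ this
  · exact Eventually.of_forall fun x => (PP_pos hp.hρ q x).le
  · filter_upwards [self_mem_nhdsWithin] with x hx
    exact PP_le hp h hx

lemma II_tendsto {a δ ρ : ℝ} {q : ℝ → ℝ} (hp : Par a δ ρ) (h : InS δ ρ q) :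
    Tendsto (II a q) atTop (nhds 0) := by
  have h1 : ∀ᶠ x in (atTop : Filter ℝ), 0 ≤ II a q x := by
    filter_upwards [eventually_gt_atTop 0] with x hx
    apply setIntegral_nonneg measurableSet_Ioi
    intro s hs
    have : 0 < s := hx.trans hs
    have := h.pos hp this
    positivity
  have h2 : ∀ᶠ x in (atTop : Filter ℝ), II a q x ≤ 2 * (x ^ (-a) / a) := by
    filter_upwards [eventually_gt_atTop 0] with x hx
    unfold II
    rw [← pow_integral hp.ha hx, ← integral_const_mul]
    apply setIntegral_mono_on (h.w_int hp hx) ((pow_int hp.ha hx).const_mul _) measurableSet_Ioi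
    intro s hs
    have hs0 : 0 < s := hx.trans hs
    have := h.le_two hp hs0
    have : 0 < s ^ (-1 - a) := by positivity
    nlinarith
  refine squeeze_zero' h1 h2 ?_
  have := ((tendsto_rpow_neg_atTop hp.ha).div_const a).const_mul 2
  simpa using this

lemma PP_tendsto_top {a δ ρ : ℝ} {q : ℝ → ℝ} (hp : Par a δ ρ) (h : InS δ ρ q) :
    Tendsto (PP a ρ q) atTop (nhds (1 + ρ)⁻¹) := by
  have h1 := ((Real.continuous_exp.tendsto _).comp (II_tendsto hp h).neg).const_mul ((1 + ρ)⁻¹)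
  have e : PP a ρ q = fun x => (1 + ρ)⁻¹ * Real.exp (-II a q x) := rfl
  rw [e]
  simpa using h1

/-- FTC on (0,ξ) for a positive-derivative function tending to 0 -/
lemma ftc_zero {f f' : ℝ → ℝ} {ξ : ℝ} (hξ : 0 < ξ) (hd : ∀ x, 0 < x → HasDerivAt f (f' x) x)
    (hpos : ∀ x, 0 < x → 0 ≤ f' x) (h0 : Tendsto f (nhdsWithin 0 (Ioi 0)) (nhds 0)) :
    IntegrableOn f' (Ioo 0 ξ) ∧ ∫ x in Ioo 0 ξ, f' x = f ξ := by
  set g : ℝ → ℝ := fun x => if 0 < x then f x else 0 with hg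
  have hgd : ∀ x, 0 < x → HasDerivAt g (f' x) x := fun x hx => by
    refine (hd x hx).congr_of_eventuallyEq ?_
    filter_upwards [Ioi_mem_nhds hx] with y hy
    simp only [hg]; exact if_pos hy
  have hc : ContinuousOn g (Icc 0 ξ) := by
    intro x hx
    rcases hx.1.eq_or_lt with h | h
    · rw [← h]
      have : Tendsto g (nhdsWithin 0 (Ici 0)) (nhds (g 0)) := by
        rw [← Ioi_insert, nhdsWithin_insert]
        refine Tendsto.sup ?_ ?_
        · exact tendsto_pure_nhds g 0
        · have : g 0 = 0 := by simp [hg]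
          rw [this]
          refine h0.congr' ?_
          filter_upwards [self_mem_nhdsWithin] with y hy
          simp only [hg]; exact (if_pos hy).symm
      exact ContinuousWithinAt.mono this Icc_subset_Ici_self
    · exact (hgd x h).continuousAt.continuousWithinAt
  have hi := intervalIntegral.integrableOn_deriv_of_nonneg hc (fun x hx => hgd x hx.1)
    (fun x hx => hpos x hx.1)
  have h2 := intervalIntegral.integral_eq_sub_of_hasDerivAt_of_le hξ.le hc (fun x hx => hgd x hx.1)
    ((intervalIntegrable_iff_integrableOn_Ioc_of_le hξ.le).2 hi)
  refine ⟨hi.mono_set Ioo_subset_Ioc_self, ?_⟩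
  rw [intervalIntegral.integral_of_le hξ.le, integral_Ioc_eq_integral_Ioo] at h2
  rw [h2]; simp [hg, hξ]

lemma uu_int {a δ ρ ξ : ℝ} {q : ℝ → ℝ} (hp : Par a δ ρ) (h : InS δ ρ q) (hξ : 0 < ξ) :
    IntegrableOn (fun η : ℝ => η ^ (-1 - a) * uu a ρ q η) (Ioo 0 ξ) ∧
    ∫ η in Ioo 0 ξ, η ^ (-1 - a) * uu a ρ q η = PP a ρ q ξ :=
  ftc_zero hξ (fun _ hx => PP_hasDerivAt hp h hx)
    (fun x hx => mul_nonneg (by positivity) (uu_pos hp h hx).le) (PP_tendsto_zero hp h)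

lemma gg_int {a ξ : ℝ} (ha : 0 < a) (hξ : 0 < ξ) :
    IntegrableOn (fun η : ℝ => η ^ (-1 - a) * gg a η) (Ioo 0 ξ) ∧
    ∫ η in Ioo 0 ξ, η ^ (-1 - a) * gg a η = 4 * gg a ξ := by
  have := ftc_zero (f := fun x => 4 * gg a x) (f' := fun η : ℝ => η ^ (-1 - a) * gg a η) hξ
    (fun x hx => by
      have h1 : HasDerivAt (fun x : ℝ => -(x ^ (-a) / (4 * a))) (-((-a) * x ^ (-a - 1) / (4 * a))) x :=
        ((Real.hasDerivAt_rpow_const (Or.inl hx.ne')).div_const _).neg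
      have h2 := h1.exp.const_mul 4
      refine HasDerivAt.congr_deriv h2 ?_
      have : -a - 1 = -1 - a := by ring
      rw [this]
      unfold gg
      field_simp)
    (fun x hx => mul_nonneg (by positivity) (gg_pos _ _).le)
    (by simpa using (gg_tendsto ha).const_mul 4)
  exact this

/-- total moment -/
lemma uu_int_all {a δ ρ : ℝ} {q : ℝ → ℝ} (hp : Par a δ ρ) (h : InS δ ρ q) :
    IntegrableOn (fun η : ℝ => η ^ (-1 - a) * uu a ρ q η) (Ioi 0) ∧
    ∫ η in Ioi 0, η ^ (-1 - a) * uu a ρ q η = (1 + ρ)⁻¹ := by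
  have hd : ∀ x, (1:ℝ) < x → HasDerivAt (PP a ρ q) (x ^ (-1 - a) * uu a ρ q x) x :=
    fun x hx => PP_hasDerivAt hp h (by linarith)
  have hc : ContinuousWithinAt (PP a ρ q) (Ici 1) 1 :=
    (PP_hasDerivAt hp h one_pos).continuousAt.continuousWithinAt
  have hpos : ∀ x ∈ Ioi (1:ℝ), 0 ≤ x ^ (-1 - a) * uu a ρ q x := fun x hx => by
    have hx0 : (0:ℝ) < x := one_pos.trans hx
    exact mul_nonneg (by positivity) (uu_pos hp h hx0).le
  have i1 := integrableOn_Ioi_deriv_of_nonneg hc hd hpos (PP_tendsto_top hp h)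
  have e1 := integral_Ioi_of_hasDerivAt_of_nonneg hc hd hpos (PP_tendsto_top hp h)
  obtain ⟨i2, e2⟩ := uu_int hp h one_pos
  have i3 : IntegrableOn (fun η : ℝ => η ^ (-1 - a) * uu a ρ q η) (Ioc 0 1) :=
    (integrableOn_Ioc_iff_integrableOn_Ioo (by simp)).2 i2
  rw [← Ioc_union_Ioi_eq_Ioi (zero_le_one' ℝ)]
  refine ⟨i3.union i1, ?_⟩
  rw [setIntegral_union (Ioc_disjoint_Ioi le_rfl) measurableSet_Ioi i3 i1, e1,
    integral_Ioc_eq_integral_Ioo, e2]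
  ring
end

section
structure KH (K : ℝ → ℝ → ℝ) (a K0 δ : ℝ) : Prop where
  cont : ContinuousOn (fun p : ℝ × ℝ => K p.1 p.2) (Ioi 0 ×ˢ Ioi 0)
  nonneg : ∀ x y : ℝ, 0 < x → 0 < y → 0 ≤ K x y
  K0pos : 0 < K0
  k1 : ∀ η ζ : ℝ, 0 < η → 0 < ζ → η < 2 * ζ → |K η ζ * η ^ a * ζ⁻¹ - 1| ≤ K0 * (η / ζ) ^ δ
  k2 : ∀ η ζ : ℝ, 0 < η → 0 < ζ → ζ < 2 * η → |K η ζ * η⁻¹ * ζ ^ a - 1| ≤ K0 * (ζ / η) ^ δ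

lemma KH_of {K : ℝ → ℝ → ℝ} {γ a K0 δ : ℝ} (hγ : a = 1 - γ)
  (hc : ContinuousOn (fun p : ℝ × ℝ => K p.1 p.2) (Ioi 0 ×ˢ Ioi 0))
  (hn : ∀ x y : ℝ, 0 < x → 0 < y → 0 ≤ K x y)
  (hs : ∀ x y : ℝ, 0 < x → 0 < y → K x y = K y x)
  (hh : ∀ x y α : ℝ, 0 < x → 0 < y → 0 < α → K (α*x) (α*y) = α ^ γ * K x y)
  (h0 : 0 < K0) (hb : ∀ x ∈ Ioo (0:ℝ) 2, |x ^ a * K x 1 - 1| ≤ K0 * x ^ δ) : KH K a K0 δ := by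
  have k1 : ∀ η ζ : ℝ, 0 < η → 0 < ζ → η < 2 * ζ → |K η ζ * η ^ a * ζ⁻¹ - 1| ≤ K0 * (η / ζ) ^ δ := by
    intro η ζ h1 h2 h3
    have h4 := hb (η / ζ) ⟨by positivity, by rwa [div_lt_iff₀ h2]⟩
    have h5 := hh (η / ζ) 1 ζ (by positivity) one_pos h2
    rw [mul_div_cancel₀ _ h2.ne', mul_one] at h5
    have : K η ζ * η ^ a * ζ⁻¹ = (η / ζ) ^ a * K (η / ζ) 1 := by
      rw [h5, Real.div_rpow h1.le h2.le]
      have : ζ ^ a * ζ ^ γ = ζ := by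
        rw [← Real.rpow_add h2, hγ]; simp
      have h6 : 0 < ζ ^ a := by positivity
      field_simp
      linear_combination (K (η / ζ) 1) * this
    rw [this]; exact h4
  refine ⟨hc, hn, h0, k1, ?_⟩
  intro η ζ h1 h2 h3
  have := k1 ζ η h2 h1 h3
  rw [hs ζ η h2 h1] at this
  rwa [mul_right_comm] 

noncomputable def nn (a ζ : ℝ) : ℝ := ζ ^ (2 + a) * mm (2 + a) ζ

lemma pow_mm_le {r ζ : ℝ} (hr : 0 ≤ r) (h : 0 < ζ) : ζ ^ r * mm r ζ ≤ 1 := by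
  have h1 : ζ ^ r ≤ (max 1 ζ) ^ r := Real.rpow_le_rpow h.le (le_max_right _ _) hr
  have h2 := mx_pos ζ
  unfold mm
  rw [Real.rpow_neg h2.le]
  rw [← div_eq_mul_inv, div_le_one (by positivity)]
  exact h1

lemma nn_nonneg {a ζ : ℝ} (h : 0 < ζ) : 0 ≤ nn a ζ := mul_nonneg (by positivity) (mm_nonneg _ _)

lemma nn_le_one {a ζ : ℝ} (ha : 0 < a) (h : 0 < ζ) : nn a ζ ≤ 1 := pow_mm_le (by linarith) h

lemma nn_pow {a ζ : ℝ} (h : 0 < ζ) : ζ ^ (-2 - a) * nn a ζ = mm (2 + a) ζ := by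
  unfold nn
  rw [← mul_assoc, ← Real.rpow_add h]
  have : -2 - a + (2 + a) = 0 := by ring
  simp [this]

lemma nn_inv {a ζ : ℝ} (ha : 0 < a) (h : 0 < ζ) : ζ⁻¹ * nn a ζ ≤ mm 1 ζ := by
  have e : ζ⁻¹ * nn a ζ = (ζ ^ (1 + a) * mm (1 + a) ζ) * mm 1 ζ := by
    unfold nn
    rw [← Real.rpow_neg_one, ← mul_assoc, ← Real.rpow_add h, mul_assoc, mm_mul]
    congr 2 <;> ring
  rw [e]
  calc _ ≤ 1 * mm 1 ζ := mul_le_mul_of_nonneg_right (pow_mm_le (by linarith) h) (mm_nonneg _ _)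
    _ = _ := one_mul _

structure Vb (a σ B : ℝ) (v : ℝ → ℝ) : Prop where
  cont : ContinuousOn v (Ioi 0)
  bd : ∀ ζ, 0 < ζ → |v ζ| ≤ B * mm σ ζ * nn a ζ
  hσ : 0 < σ
  hB : 0 ≤ B

lemma Vb.bd' {a σ B : ℝ} {v : ℝ → ℝ} (h : Vb a σ B v) {ζ : ℝ} (hζ : 0 < ζ) : |v ζ| ≤ B * nn a ζ := by
  refine (h.bd ζ hζ).trans ?_
  have := mm_le_one h.hσ.le ζ
  have := h.hB
  have := nn_nonneg (a := a) hζ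
  gcongr
  exact mul_le_of_le_one_right h.hB (by assumption)

/-- integrability + norm bound by domination -/
lemma dom {f g : ℝ → ℝ} {s : Set ℝ} (hs : MeasurableSet s) (hf : ContinuousOn f s)
    (hg : IntegrableOn g s) (h : ∀ x ∈ s, |f x| ≤ g x) :
    IntegrableOn f s ∧ |∫ x in s, f x| ≤ ∫ x in s, g x := by
  have h1 : ∀ᵐ x ∂(volume.restrict s), ‖f x‖ ≤ g x := by
    rw [ae_restrict_iff' hs]; exact Eventually.of_forall h
  exact ⟨Integrable.mono' hg (hf.aestronglyMeasurable hs) h1, norm_integral_le_of_norm_le hg h1⟩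

lemma cont_pow {s : Set ℝ} (hs : s ⊆ Ioi 0) (r : ℝ) : ContinuousOn (fun x : ℝ => x ^ r) s :=
  fun _ hx => (Real.continuousAt_rpow_const _ _ (Or.inl (ne_of_gt (hs hx)))).continuousWithinAt

lemma cont_inv {s : Set ℝ} (hs : s ⊆ Ioi 0) : ContinuousOn (fun x : ℝ => x⁻¹) s :=
  fun _ hx => (continuousAt_inv₀ (ne_of_gt (hs hx))).continuousWithinAt

lemma KH.cont2 {K : ℝ → ℝ → ℝ} {a K0 δ : ℝ} (hK : KH K a K0 δ) {η : ℝ} (hη : 0 < η) {s : Set ℝ}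
    (hs : s ⊆ Ioi 0) : ContinuousOn (fun ζ => K η ζ) s :=
  hK.cont.comp (f := fun ζ => (η, ζ)) (by fun_prop) fun _ hx => ⟨hη, hs hx⟩

variable (K : ℝ → ℝ → ℝ) (a : ℝ) (v : ℝ → ℝ) (ξ η : ℝ)
noncomputable def Jf : ℝ := ∫ ζ in Ioi (ξ - η), K η ζ * η⁻¹ * (ζ ^ 2)⁻¹ * v ζ
noncomputable def WW : ℝ := ∫ ζ in Ioi ξ, ζ⁻¹ * v ζ
noncomputable def N1 : ℝ := ∫ ζ in Ioi ξ, ζ⁻¹ * (K η ζ * η ^ a * ζ⁻¹ - 1) * v ζ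
noncomputable def N2 : ℝ := ∫ ζ in Ioc (ξ - η) ξ, ζ⁻¹ * (K η ζ * η ^ a * ζ⁻¹) * v ζ
noncomputable def N3 : ℝ := ∫ ζ in Ioc (ξ - η) ξ, (K η ζ * η⁻¹ * ζ ^ a) * (ζ ^ (-2 - a) * v ζ)
noncomputable def N4 : ℝ := ∫ ζ in Ioc (ξ - η) ξ, ζ ^ (-2 - a) * v ζ

variable {K a v ξ η} {K0 δ σ B : ℝ}

lemma inv_v (ha : 0 < a) (hv : Vb a σ B v) {ζ : ℝ} (h : 0 < ζ) : |ζ⁻¹ * v ζ| ≤ B * mm 1 ζ := by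
  have := hv.hB
  rw [abs_mul, abs_of_pos (by positivity)]
  calc ζ⁻¹ * |v ζ| ≤ ζ⁻¹ * (B * nn a ζ) := by gcongr; exact hv.bd' h
    _ = B * (ζ⁻¹ * nn a ζ) := by ring
    _ ≤ _ := by gcongr; exact nn_inv ha h

lemma pow_v (hv : Vb a σ B v) {ζ : ℝ} (h : 0 < ζ) : |ζ ^ (-2 - a) * v ζ| ≤ B * mm (2 + a) ζ := by
  have := hv.hB
  have h1 : 0 < ζ ^ (-2 - a) := by positivity
  rw [abs_mul, abs_of_pos h1]
  calc ζ ^ (-2 - a) * |v ζ| ≤ ζ ^ (-2 - a) * (B * nn a ζ) := by gcongr; exact hv.bd' h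
    _ = B * (ζ ^ (-2 - a) * nn a ζ) := by ring
    _ = _ := by rw [nn_pow h]

lemma WW_int (ha : 0 < a) (hv : Vb a σ B v) (hξ : 0 ≤ ξ) :
    IntegrableOn (fun ζ => ζ⁻¹ * v ζ) (Ioi ξ) ∧ |WW v ξ| ≤ B * ((1 + σ) / σ) * mm σ ξ := by
  have hs : Ioi ξ ⊆ Ioi (0:ℝ) := Ioi_subset_Ioi hξ
  have hσ := hv.hσ
  have := dom (f := fun ζ => ζ⁻¹ * v ζ) (g := fun ζ => B * mm (1 + σ) ζ) measurableSet_Ioi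
    ((cont_inv hs).mul (hv.cont.mono hs))
    ((mm_int (by linarith) hξ).const_mul B) (by
      intro ζ h
      have h : 0 < ζ := hs h
      have := hv.hB
      rw [abs_mul, abs_of_pos (by positivity)]
      calc ζ⁻¹ * |v ζ| ≤ ζ⁻¹ * (B * mm σ ζ * nn a ζ) := by gcongr; exact hv.bd _ h
        _ = B * ((ζ⁻¹ * nn a ζ) * mm σ ζ) := by ring
        _ ≤ B * (mm 1 ζ * mm σ ζ) := by
            have := mm_nonneg σ ζ
            gcongr; exact nn_inv ha h
        _ = _ := by rw [mm_mul])
  refine ⟨this.1, this.2.trans ?_⟩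
  rw [integral_const_mul, mul_assoc]
  have h2 := mm_integral (s := 1 + σ) (by linarith) hξ
  rw [add_sub_cancel_left] at h2
  exact mul_le_mul_of_nonneg_left h2 hv.hB

lemma rdiv (hδ : 0 ≤ δ) {x y : ℝ} (hx : 0 < x) (h : x ≤ y) : (x / y) ^ δ ≤ 1 :=
  Real.rpow_le_one (div_nonneg hx.le (hx.trans_le h).le) ((div_le_one (hx.trans_le h)).2 h) hδ

lemma N1_int (ha : 0 < a) (hδ : 0 < δ) (hK : KH K a K0 δ) (hv : Vb a σ B v) (hη : 0 < η)
    (hξ : η ≤ ξ) :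
    IntegrableOn (fun ζ => ζ⁻¹ * (K η ζ * η ^ a * ζ⁻¹ - 1) * v ζ) (Ioi ξ) ∧
    |N1 K a v ξ η| ≤ K0 * ((1 + δ) / δ) * B * (mm (-δ) η * mm δ ξ) := by
  have hξ0 := hη.trans_le hξ
  have hs : Ioi ξ ⊆ Ioi (0:ℝ) := Ioi_subset_Ioi hξ0.le
  have hB := hv.hB
  have hK0 := hK.K0pos
  have := dom (f := fun ζ => ζ⁻¹ * (K η ζ * η ^ a * ζ⁻¹ - 1) * v ζ)
    (g := fun ζ => (K0 * B * mm (-δ) η) * mm (1 + δ) ζ) measurableSet_Ioi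
    (((cont_inv hs).mul ((((hK.cont2 hη hs).mul continuousOn_const).mul (cont_inv hs)).sub
      continuousOn_const)).mul (hv.cont.mono hs))
    ((mm_int (by linarith) hξ0.le).const_mul _) (by
      intro ζ h
      have h0 : 0 < ζ := hs h
      have hηζ : η ≤ ζ := hξ.trans (le_of_lt h)
      have h1 := hK.k1 η ζ hη h0 (by linarith)
      have h2 := ratio_le hδ.le hη hηζ
      have h3 := inv_v ha hv h0
      have e : ζ⁻¹ * (K η ζ * η ^ a * ζ⁻¹ - 1) * v ζ = (K η ζ * η ^ a * ζ⁻¹ - 1) * (ζ⁻¹ * v ζ) := by ring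
      rw [e, abs_mul]
      calc _ ≤ (K0 * (mm (-δ) η * mm δ ζ)) * (B * mm 1 ζ) := by
            have := mm_nonneg (-δ) η
            have := mm_nonneg (δ) ζ
            gcongr
            exact h1.trans (by gcongr)
        _ = (K0 * B * mm (-δ) η) * (mm 1 ζ * mm δ ζ) := by ring
        _ = _ := by rw [mm_mul])
  refine ⟨this.1, this.2.trans ?_⟩
  rw [integral_const_mul]
  have h2 := mm_integral (s := 1 + δ) (by linarith) hξ0.le
  rw [add_sub_cancel_left] at h2
  have := mm_nonneg (-δ) η
  calc _ ≤ (K0 * B * mm (-δ) η) * ((1 + δ) / δ * mm δ ξ) := by gcongr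
    _ = _ := by ring

lemma Ioc_sub (h : η < ξ) : Ioc (ξ - η) ξ ⊆ Ioi (0:ℝ) := fun x hx => by
  have := hx.1
  simp only [mem_Ioi]; linarith

lemma vol_Ioc (hη : 0 < η) : ∫ _ζ in Ioc (ξ - η) ξ, (1:ℝ) = η := by
  simp [hη.le]

lemma N2_int (ha : 0 < a) (hδ : 0 < δ) (hδ1 : δ ≤ 1) (hK : KH K a K0 δ) (hv : Vb a σ B v) (hη : 0 < η)
    (hξ : 2 * η ≤ ξ) :
    IntegrableOn (fun ζ => ζ⁻¹ * (K η ζ * η ^ a * ζ⁻¹) * v ζ) (Ioc (ξ - η) ξ) ∧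
    |N2 K a v ξ η| ≤ 2 * (1 + K0) * B * (mm (-δ) η * mm δ ξ) := by
  have hs : Ioc (ξ - η) ξ ⊆ Ioi (0:ℝ) := Ioc_sub (by linarith)
  have hB := hv.hB
  have hK0 := hK.K0pos
  have := dom (f := fun ζ => ζ⁻¹ * (K η ζ * η ^ a * ζ⁻¹) * v ζ)
    (g := fun ζ => ((1 + K0) * B * (2 * mm 1 ξ)) * 1) measurableSet_Ioc
    (((cont_inv hs).mul ((((hK.cont2 hη hs).mul continuousOn_const).mul (cont_inv hs)))).mul (hv.cont.mono hs))
    (integrableOn_const (by simp)) (by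
      intro ζ h
      have h0 : 0 < ζ := hs h
      have hηζ : η ≤ ζ := by linarith [h.1]
      have h1 := hK.k1 η ζ hη h0 (by linarith)
      have h2 := rdiv hδ.le hη hηζ
      have h3 := inv_v ha hv h0
      have h4 := mm_comp (s := 1) (ξ := ξ) (η := ζ) zero_le_one (by linarith [h.1])
      rw [Real.rpow_one] at h4
      have e : ζ⁻¹ * (K η ζ * η ^ a * ζ⁻¹) * v ζ = (K η ζ * η ^ a * ζ⁻¹) * (ζ⁻¹ * v ζ) := by ring
      have h5 : |K η ζ * η ^ a * ζ⁻¹| ≤ 1 + K0 := by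
        have := abs_sub_abs_le_abs_sub (K η ζ * η ^ a * ζ⁻¹) 1
        rw [abs_one] at this
        nlinarith
      rw [e, abs_mul, mul_one]
      calc _ ≤ (1 + K0) * (B * (2 * mm 1 ξ)) := by
            gcongr
            exact h3.trans (by gcongr)
        _ = _ := by ring)
  refine ⟨this.1, this.2.trans ?_⟩
  rw [integral_const_mul, vol_Ioc hη]
  have h6 : mm 1 ξ ≤ ξ⁻¹ := by
    unfold mm
    rw [Real.rpow_neg_one]
    exact inv_anti₀ (by linarith) (le_max_right _ _)
  have h7 := ratio_le1 (ζ := η) (ξ := ξ) hδ.le hδ1 hη (by linarith)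
  calc _ = 2 * (1 + K0) * B * (η * mm 1 ξ) := by ring
    _ ≤ 2 * (1 + K0) * B * (η * ξ⁻¹) := by gcongr
    _ ≤ _ := by
      rw [← div_eq_mul_inv]
      gcongr

lemma two_pow_le (hδ1 : δ ≤ 1) : (2:ℝ) ^ δ ≤ 2 := by
  calc (2:ℝ) ^ δ ≤ 2 ^ (1:ℝ) := Real.rpow_le_rpow_of_exponent_le (by norm_num) hδ1
    _ = 2 := by simp

lemma mm_Ioc {s t r B : ℝ} (hs : 1 < s) (ht : 0 ≤ t) (hB : 0 ≤ B) :
    IntegrableOn (fun ζ => B * mm s ζ) (Ioc t r) ∧ ∫ ζ in Ioc t r, B * mm s ζ ≤ B * (s / (s - 1)) * mm (s - 1) t := by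
  have h1 := mm_int hs ht
  refine ⟨IntegrableOn.mono_set (Integrable.const_mul h1 _) Ioc_subset_Ioi_self, ?_⟩
  rw [integral_const_mul, mul_assoc]
  gcongr
  refine le_trans ?_ (mm_integral hs ht)
  apply setIntegral_mono_set h1
  · exact Eventually.of_forall fun x => mm_nonneg _ _
  · exact Ioc_subset_Ioi_self.eventuallyLE

lemma N4_int (ha : 0 < a) (hv : Vb a σ B v) (hξ : η < ξ) :
    IntegrableOn (fun ζ => ζ ^ (-2 - a) * v ζ) (Ioc (ξ - η) ξ) ∧
    |N4 a v ξ η| ≤ B * ((2 + a) / (1 + a)) * mm (1 + a) (ξ - η) := by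
  have hs : Ioc (ξ - η) ξ ⊆ Ioi (0:ℝ) := Ioc_sub hξ
  obtain ⟨i, b⟩ := mm_Ioc (s := 2 + a) (t := ξ - η) (r := ξ) (by linarith) (by linarith) hv.hB
  have := dom (f := fun ζ => ζ ^ (-2 - a) * v ζ) measurableSet_Ioc
    ((cont_pow hs _).mul (hv.cont.mono hs)) i (fun ζ h => pow_v hv (hs h))
  refine ⟨this.1, this.2.trans ?_⟩
  have e : 2 + a - 1 = 1 + a := by ring
  rw [e] at b; exact b

lemma N3_int (ha : 0 < a) (hδ : 0 < δ) (hδ1 : δ ≤ 1) (hK : KH K a K0 δ) (hv : Vb a σ B v) (hη : 0 < η)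
    (hξ : η < ξ) (hξ2 : ξ < 2 * η) :
    IntegrableOn (fun ζ => (K η ζ * η⁻¹ * ζ ^ a) * (ζ ^ (-2 - a) * v ζ)) (Ioc (ξ - η) ξ) ∧
    |N3 K a v ξ η| ≤ (1 + 2 * K0) * B * ((2 + a) / (1 + a)) * mm (1 + a) (ξ - η) := by
  have hs : Ioc (ξ - η) ξ ⊆ Ioi (0:ℝ) := Ioc_sub hξ
  have hK0 := hK.K0pos
  have hB := hv.hB
  obtain ⟨i, b⟩ := mm_Ioc (s := 2 + a) (t := ξ - η) (r := ξ) (B := (1 + 2 * K0) * B) (by linarith) (by linarith) (by positivity)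
  have := dom (f := fun ζ => (K η ζ * η⁻¹ * ζ ^ a) * (ζ ^ (-2 - a) * v ζ)) measurableSet_Ioc
    ((((hK.cont2 hη hs).mul continuousOn_const).mul (cont_pow hs _)).mul ((cont_pow hs _).mul (hv.cont.mono hs))) i (by
      intro ζ h
      have h0 : 0 < ζ := hs h
      have h1 := hK.k2 η ζ hη h0 (by linarith [h.2])
      have h2 : (ζ / η) ^ δ ≤ 2 := by
        refine le_trans ?_ (two_pow_le hδ1)
        apply Real.rpow_le_rpow (by positivity) _ hδ.le
        rw [div_le_iff₀ hη]; linarith [h.2]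
      have h3 := pow_v hv h0
      have h5 : |K η ζ * η⁻¹ * ζ ^ a| ≤ 1 + 2 * K0 := by
        have := abs_sub_abs_le_abs_sub (K η ζ * η⁻¹ * ζ ^ a) 1
        rw [abs_one] at this
        nlinarith
      rw [abs_mul]
      calc _ ≤ (1 + 2 * K0) * (B * mm (2 + a) ζ) := by gcongr
        _ = _ := by ring)
  refine ⟨this.1, this.2.trans ?_⟩
  have e : 2 + a - 1 = 1 + a := by ring
  rw [e] at b; exact b

lemma N34_int (ha : 0 < a) (hδ : 0 < δ) (hδ1 : δ ≤ 1) (hδa : δ < a) (hK : KH K a K0 δ) (hv : Vb a σ B v) (hη : 0 < η)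
    (hξ : η < ξ) (hξ2 : ξ < 2 * η) :
    |N3 K a v ξ η - N4 a v ξ η| ≤
      2 * K0 * ((2 + a - δ) / (1 + a - δ)) * B * (mm δ ξ * mm (1 + a - δ) (ξ - η)) := by
  have hs : Ioc (ξ - η) ξ ⊆ Ioi (0:ℝ) := Ioc_sub hξ
  have hK0 := hK.K0pos
  have hB := hv.hB
  have hm := mm_nonneg δ ξ
  obtain ⟨i, b⟩ := mm_Ioc (s := 2 + a - δ) (t := ξ - η) (r := ξ) (B := 2 * K0 * B * mm δ ξ) (by linarith) (by linarith) (by positivity)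
  have e0 : N3 K a v ξ η - N4 a v ξ η = ∫ ζ in Ioc (ξ - η) ξ, (K η ζ * η⁻¹ * ζ ^ a - 1) * (ζ ^ (-2 - a) * v ζ) := by
    unfold N3 N4
    rw [← integral_sub (N3_int ha hδ hδ1 hK hv hη hξ hξ2).1 (N4_int ha hv hξ).1]
    congr 1; ext ζ; ring
  rw [e0]
  have := dom (f := fun ζ => (K η ζ * η⁻¹ * ζ ^ a - 1) * (ζ ^ (-2 - a) * v ζ)) measurableSet_Ioc
    (((((hK.cont2 hη hs).mul continuousOn_const).mul (cont_pow hs _)).sub continuousOn_const).mul ((cont_pow hs _).mul (hv.cont.mono hs))) i (by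
      intro ζ h
      have h0 : 0 < ζ := hs h
      have h1 := hK.k2 η ζ hη h0 (by linarith [h.2])
      have h2 : (ζ / η) ^ δ ≤ 2 * (mm (-δ) ζ * mm δ ξ) := by
        have h3 : ζ / η ≤ 2 * (ζ / ξ) := by
          rw [← mul_div_assoc, div_le_div_iff₀ hη (hη.trans hξ)]; nlinarith
        calc (ζ / η) ^ δ ≤ (2 * (ζ / ξ)) ^ δ := Real.rpow_le_rpow (by positivity) h3 hδ.le
          _ = 2 ^ δ * (ζ / ξ) ^ δ := Real.mul_rpow (by norm_num) (div_nonneg h0.le (by linarith))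
          _ ≤ _ := by
            have := two_pow_le hδ1
            have := ratio_le hδ.le h0 h.2
            have hx : 0 ≤ ζ / ξ := div_nonneg h0.le (by linarith)
            gcongr
      have h3 := pow_v hv h0
      rw [abs_mul]
      calc _ ≤ (K0 * (2 * (mm (-δ) ζ * mm δ ξ))) * (B * mm (2 + a) ζ) := by
            have := mm_nonneg (-δ) ζ
            gcongr
            exact h1.trans (by gcongr)
        _ = 2 * K0 * B * mm δ ξ * (mm (2 + a) ζ * mm (-δ) ζ) := by ring
        _ = _ := by rw [mm_mul]; rfl)
  refine this.2.trans (b.trans (le_of_eq ?_))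
  have e : 2 + a - δ - 1 = 1 + a - δ := by ring
  rw [e]; ring

/-- decomposition of the inner integral, small η -/
lemma J_small (ha : 0 < a) (hδ : 0 < δ) (hδ1 : δ ≤ 1) (hK : KH K a K0 δ) (hv : Vb a σ B v) (hη : 0 < η)
    (hξ : 2 * η ≤ ξ) :
    IntegrableOn (fun ζ => K η ζ * η⁻¹ * (ζ ^ 2)⁻¹ * v ζ) (Ioi (ξ - η)) ∧
    Jf K v ξ η = η ^ (-1 - a) * (N1 K a v ξ η + N2 K a v ξ η + WW v ξ) := by
  have i1 := (N1_int ha hδ hK hv hη (ξ := ξ) (by linarith)).1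
  have i2 := (N2_int ha hδ hδ1 hK hv hη hξ).1
  have i3 := (WW_int ha hv (ξ := ξ) (by linarith)).1
  have e : ∀ ζ, K η ζ * η⁻¹ * (ζ ^ 2)⁻¹ * v ζ = η ^ (-1 - a) * (ζ⁻¹ * (K η ζ * η ^ a * ζ⁻¹) * v ζ) := by
    intro ζ
    have : η ^ (-1 - a) * η ^ a = η⁻¹ := by
      rw [← Real.rpow_add hη, ← Real.rpow_neg_one]; congr 1; ring
    rw [← this, pow_two, mul_inv]; ring
  have i4 : IntegrableOn (fun ζ => ζ⁻¹ * (K η ζ * η ^ a * ζ⁻¹) * v ζ) (Ioi ξ) := by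
    refine (i1.add i3).congr_fun (fun ζ _ => ?_) measurableSet_Ioi
    simp only [Pi.add_apply]; ring
  have hle : ξ - η ≤ ξ := by linarith
  have e2 : N1 K a v ξ η + WW v ξ = ∫ ζ in Ioi ξ, ζ⁻¹ * (K η ζ * η ^ a * ζ⁻¹) * v ζ := by
    unfold N1 WW
    rw [← integral_add i1 i3]
    congr 1; ext ζ; ring
  unfold Jf
  simp_rw [e]
  refine ⟨?_, ?_⟩
  · rw [← Ioc_union_Ioi_eq_Ioi hle]
    exact (i2.union i4).const_mul _
  · rw [integral_const_mul, ← Ioc_union_Ioi_eq_Ioi hle, setIntegral_union (Ioc_disjoint_Ioi le_rfl) measurableSet_Ioi i2 i4,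
      ← e2]
    unfold N2; ring

lemma J_large (ha : 0 < a) (hδ : 0 < δ) (hδ1 : δ ≤ 1) (hK : KH K a K0 δ) (hv : Vb a σ B v) (hη : 0 < η)
    (hξ : η < ξ) (hξ2 : ξ < 2 * η) :
    IntegrableOn (fun ζ => K η ζ * η⁻¹ * (ζ ^ 2)⁻¹ * v ζ) (Ioi (ξ - η)) ∧
    Jf K v ξ η = η ^ (-1 - a) * (N1 K a v ξ η + WW v ξ) + N3 K a v ξ η := by
  have i1 := (N1_int ha hδ hK hv hη (ξ := ξ) (by linarith)).1
  have i2 := (N3_int ha hδ hδ1 hK hv hη hξ hξ2).1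
  have i3 := (WW_int ha hv (ξ := ξ) (by linarith)).1
  have e : ∀ ζ, K η ζ * η⁻¹ * (ζ ^ 2)⁻¹ * v ζ = η ^ (-1 - a) * (ζ⁻¹ * (K η ζ * η ^ a * ζ⁻¹) * v ζ) := by
    intro ζ
    have : η ^ (-1 - a) * η ^ a = η⁻¹ := by
      rw [← Real.rpow_add hη, ← Real.rpow_neg_one]; congr 1; ring
    rw [← this, pow_two, mul_inv]; ring
  have i4 : IntegrableOn (fun ζ => ζ⁻¹ * (K η ζ * η ^ a * ζ⁻¹) * v ζ) (Ioi ξ) := by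
    refine (i1.add i3).congr_fun (fun ζ _ => ?_) measurableSet_Ioi
    simp only [Pi.add_apply]; ring
  have hle : ξ - η ≤ ξ := by linarith
  have e2 : N1 K a v ξ η + WW v ξ = ∫ ζ in Ioi ξ, ζ⁻¹ * (K η ζ * η ^ a * ζ⁻¹) * v ζ := by
    unfold N1 WW
    rw [← integral_add i1 i3]
    congr 1; ext ζ; ring
  have e3 : ∀ ζ ∈ Ioc (ξ - η) ξ, K η ζ * η⁻¹ * (ζ ^ 2)⁻¹ * v ζ = (K η ζ * η⁻¹ * ζ ^ a) * (ζ ^ (-2 - a) * v ζ) := by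
    intro ζ h
    have h0 : 0 < ζ := Ioc_sub hξ h
    have : ζ ^ a * ζ ^ (-2 - a) = (ζ ^ 2)⁻¹ := by
      rw [← Real.rpow_add h0, ← Real.rpow_natCast ζ 2, ← Real.rpow_neg h0.le]; congr 1; push_cast; ring
    rw [← this]; ring
  have i5 : IntegrableOn (fun ζ => K η ζ * η⁻¹ * (ζ ^ 2)⁻¹ * v ζ) (Ioc (ξ - η) ξ) :=
    i2.congr_fun (fun ζ h => (e3 ζ h).symm) measurableSet_Ioc
  have i6 : IntegrableOn (fun ζ => K η ζ * η⁻¹ * (ζ ^ 2)⁻¹ * v ζ) (Ioi ξ) := by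
    simp_rw [e]; exact i4.const_mul _
  unfold Jf
  rw [← Ioc_union_Ioi_eq_Ioi hle]
  refine ⟨i5.union i6, ?_⟩
  rw [setIntegral_union (Ioc_disjoint_Ioi le_rfl) measurableSet_Ioi i5 i6,
    setIntegral_congr_fun measurableSet_Ioc e3, e2]
  simp_rw [e]
  rw [integral_const_mul]
  unfold N3; ring
end

section
noncomputable def Maj (a δ ξ η : ℝ) : ℝ :=
  η ^ (-1 - a) * gg a η / gg a ξ + mm (1 + a - δ) η + mm (1 + a - δ) (ξ - η)

lemma Maj_nonneg {a δ ξ η : ℝ} (hη : 0 < η) : 0 ≤ Maj a δ ξ η := by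
  unfold Maj
  have := mm_nonneg (1 + a - δ) η
  have := mm_nonneg (1 + a - δ) (ξ - η)
  have := gg_pos a η
  have := gg_pos a ξ
  positivity

lemma Maj_int {a δ ξ : ℝ} (ha : 0 < a) (hδa : δ < a) (hξ : 0 < ξ) :
    IntegrableOn (Maj a δ ξ) (Ioo 0 ξ) ∧
    ∫ η in Ioo 0 ξ, Maj a δ ξ η ≤ 4 + 2 * ((1 + a - δ) / (a - δ)) := by
  obtain ⟨i1, e1⟩ := gg_int ha hξ
  have hg := gg_pos a ξ
  have i1' := i1.div_const (gg a ξ)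
  have hs : 1 < 1 + a - δ := by linarith
  have i0 := mm_int hs le_rfl
  have i2 : IntegrableOn (mm (1 + a - δ)) (Ioo 0 ξ) := i0.mono_set Ioo_subset_Ioi_self
  have b2 : ∫ η in Ioo 0 ξ, mm (1 + a - δ) η ≤ (1 + a - δ) / (a - δ) := by
    have h1 := mm_integral_all hs le_rfl
    have e : 1 + a - δ - 1 = a - δ := by ring
    rw [e] at h1
    refine le_trans (setIntegral_mono_set i0 ?_ Ioo_subset_Ioi_self.eventuallyLE) h1
    exact Eventually.of_forall fun x => mm_nonneg _ _
  have ii2 : IntervalIntegrable (mm (1 + a - δ)) volume 0 ξ := (mm_cont _).intervalIntegrable _ _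
  have i3 : IntegrableOn (fun η => mm (1 + a - δ) (ξ - η)) (Ioo 0 ξ) := by
    have : Continuous (fun η => mm (1 + a - δ) (ξ - η)) := (mm_cont _).comp (by fun_prop)
    exact (this.integrableOn_Icc).mono_set Ioo_subset_Icc_self
  have e3 : ∫ η in Ioo 0 ξ, mm (1 + a - δ) (ξ - η) = ∫ η in Ioo 0 ξ, mm (1 + a - δ) η := by
    have := intervalIntegral.integral_comp_sub_left (a := 0) (b := ξ) (mm (1 + a - δ)) ξ
    simp only [sub_self, sub_zero] at this
    rw [intervalIntegral.integral_of_le hξ.le, intervalIntegral.integral_of_le hξ.le,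
      integral_Ioc_eq_integral_Ioo, integral_Ioc_eq_integral_Ioo] at this
    exact this
  refine ⟨(i1'.add i2).add i3, ?_⟩
  have : ∫ η in Ioo 0 ξ, Maj a δ ξ η = (∫ η in Ioo 0 ξ, η ^ (-1 - a) * gg a η / gg a ξ) +
      (∫ η in Ioo 0 ξ, mm (1 + a - δ) η) + ∫ η in Ioo 0 ξ, mm (1 + a - δ) (ξ - η) := by
    have i12 : Integrable (fun η => η ^ (-1 - a) * gg a η / gg a ξ + mm (1 + a - δ) η) (volume.restrict (Ioo 0 ξ)) := i1'.add i2
    rw [← integral_add i1' i2, ← integral_add i12 i3]; rfl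
  rw [this, integral_div, e1, e3]
  have : 4 * gg a ξ / gg a ξ = 4 := by field_simp
  linarith

lemma gg_mono {a η ξ : ℝ} (ha : 0 < a) (hη : 0 < η) (h : η ≤ ξ) : gg a η ≤ gg a ξ := by
  unfold gg
  apply Real.exp_le_exp.2
  have := Real.rpow_le_rpow_of_nonpos hη h (by linarith : -a ≤ 0)
  apply neg_le_neg
  gcongr

/-- first type term -/
lemma Maj_one {a δ ξ η : ℝ} (ha : 0 < a) (hη : 0 < η) (h : η ≤ ξ) :
    η ^ (-1 - a) * (gg a η / gg a ξ) * mm (-δ) η ≤ Maj a δ ξ η := by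
  have h1 := mm_nonneg (1 + a - δ) η
  have h2 := mm_nonneg (1 + a - δ) (ξ - η)
  have h3 := gg_pos a η
  have h4 := gg_pos a ξ
  unfold Maj
  rcases le_total η 1 with h5 | h5
  · rw [mm_of_le (s := -δ) h5]
    have : η ^ (-1 - a) * (gg a η / gg a ξ) * 1 = η ^ (-1 - a) * gg a η / gg a ξ := by ring
    linarith
  · have h6 : gg a η / gg a ξ ≤ 1 := (div_le_one h4).2 (gg_mono ha hη h)
    have h7 : η ^ (-1 - a) * mm (-δ) η = mm (1 + a - δ) η := by
      have : η ^ (-1 - a) = mm (1 + a) η := by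
        rw [mm_of_ge h5]; congr 1; ring
      rw [this, mm_mul]; rfl
    have h8 : 0 ≤ η ^ (-1 - a) * gg a η / gg a ξ := by positivity
    calc _ = η ^ (-1 - a) * mm (-δ) η * (gg a η / gg a ξ) := by ring
      _ ≤ mm (1 + a - δ) η * 1 := by rw [h7]; gcongr
      _ ≤ _ := by linarith

noncomputable def Zf (K : ℝ → ℝ → ℝ) (a : ℝ) (v : ℝ → ℝ) (ξ η p c : ℝ) : ℝ :=
  p * Jf K v ξ η - η ^ (-1 - a) * p * WW v ξ - (if ξ < 2 * η then c * N4 a v ξ η else 0)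

lemma Zf_bound {a δ K0 : ℝ} (ha : 0 < a) (hδ : 0 < δ) (hδ1 : δ ≤ 1) (hδa : δ < a) (hK0 : 0 < K0) :
    ∃ C : ℝ, 0 < C ∧ ∀ (K : ℝ → ℝ → ℝ) (v : ℝ → ℝ) (σ B A ξ η p c : ℝ), KH K a K0 δ → Vb a σ B v →
      0 < η → η < ξ → 0 ≤ A → |p| ≤ A * (gg a η / gg a ξ) →
      (ξ < 2 * η → |p - c| ≤ A * (mm (-δ) (ξ - η) * mm δ ξ) ∧ |c| ≤ A) →
      |Zf K a v ξ η p c| ≤ C * A * B * mm δ ξ * Maj a δ ξ η := by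
  set c1 := K0 * ((1 + δ) / δ)
  set c2 := 2 * (1 + K0)
  set c3 := (1 + 2 * K0) * ((2 + a) / (1 + a))
  set c4 := 2 * K0 * ((2 + a - δ) / (1 + a - δ))
  have p1 : 0 < c1 := by positivity
  have p2 : 0 < c2 := by positivity
  have p3 : 0 < c3 := by positivity
  have p4 : 0 < c4 := mul_pos (by positivity) (div_pos (by linarith) (by linarith))
  refine ⟨c1 + c2 + c3 + c4, by positivity, ?_⟩
  intro K v σ B A ξ η p c hK hv hη hξ hA hp hc
  have hB := hv.hB
  have m1 := mm_nonneg δ ξ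
  have m2 := mm_nonneg (-δ) η
  have m3 := Maj_one (δ := δ) ha hη hξ.le
  have m4 := Maj_nonneg (a := a) (δ := δ) (ξ := ξ) hη
  have m5 := gg_pos a η
  have m6 := gg_pos a ξ
  have n1 := (N1_int ha hδ hK hv hη hξ.le).2
  have t1 : |η ^ (-1 - a) * p * N1 K a v ξ η| ≤ c1 * A * B * mm δ ξ * Maj a δ ξ η := by
    have : 0 < η ^ (-1 - a) := by positivity
    rw [abs_mul, abs_mul, abs_of_pos this]
    calc _ ≤ η ^ (-1 - a) * (A * (gg a η / gg a ξ)) * (c1 * B * (mm (-δ) η * mm δ ξ)) := by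
          gcongr
      _ = c1 * A * B * mm δ ξ * (η ^ (-1 - a) * (gg a η / gg a ξ) * mm (-δ) η) := by ring
      _ ≤ _ := by gcongr
  have hpos : 0 ≤ A * B * mm δ ξ * Maj a δ ξ η := by positivity
  by_cases hs : ξ < 2 * η
  · obtain ⟨hc1, hc2⟩ := hc hs
    have n3 := (N3_int ha hδ hδ1 hK hv hη hξ hs).2
    have n34 := N34_int ha hδ hδ1 hδa hK hv hη hξ hs
    have e : Zf K a v ξ η p c = η ^ (-1 - a) * p * N1 K a v ξ η + (p - c) * N3 K a v ξ η +
        c * (N3 K a v ξ η - N4 a v ξ η) := by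
      unfold Zf
      rw [(J_large ha hδ hδ1 hK hv hη hξ hs).2, if_pos hs]; ring
    have hm : mm (1 + a - δ) (ξ - η) ≤ Maj a δ ξ η := by
      unfold Maj
      have := mm_nonneg (1 + a - δ) η
      have : 0 ≤ η ^ (-1 - a) * gg a η / gg a ξ := by positivity
      linarith
    have t2 : |(p - c) * N3 K a v ξ η| ≤ c3 * A * B * mm δ ξ * Maj a δ ξ η := by
      rw [abs_mul]
      have m7 := mm_nonneg (-δ) (ξ - η)
      have m8 := mm_nonneg (1 + a) (ξ - η)
      calc _ ≤ (A * (mm (-δ) (ξ - η) * mm δ ξ)) * ((1 + 2 * K0) * B * ((2 + a) / (1 + a)) * mm (1 + a) (ξ - η)) := by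
            gcongr
        _ = c3 * A * B * mm δ ξ * (mm (1 + a) (ξ - η) * mm (-δ) (ξ - η)) := by
            simp only [c3]; ring
        _ = c3 * A * B * mm δ ξ * mm (1 + a - δ) (ξ - η) := by rw [mm_mul]; rfl
        _ ≤ _ := by gcongr
    have t3 : |c * (N3 K a v ξ η - N4 a v ξ η)| ≤ c4 * A * B * mm δ ξ * Maj a δ ξ η := by
      rw [abs_mul]
      calc _ ≤ A * (c4 * B * (mm δ ξ * mm (1 + a - δ) (ξ - η))) := by gcongr
        _ = c4 * A * B * mm δ ξ * mm (1 + a - δ) (ξ - η) := by ring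
        _ ≤ _ := by gcongr
    rw [e]
    have := abs_add_three (η ^ (-1 - a) * p * N1 K a v ξ η) ((p - c) * N3 K a v ξ η) (c * (N3 K a v ξ η - N4 a v ξ η))
    have : 0 ≤ c2 * (A * B * mm δ ξ * Maj a δ ξ η) := by positivity
    linarith
  · have hs' := not_lt.1 hs
    have n2 := (N2_int ha hδ hδ1 hK hv hη hs').2
    have e : Zf K a v ξ η p c = η ^ (-1 - a) * p * N1 K a v ξ η + η ^ (-1 - a) * p * N2 K a v ξ η := by
      unfold Zf
      rw [(J_small ha hδ hδ1 hK hv hη hs').2, if_neg hs]; ring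
    have t2 : |η ^ (-1 - a) * p * N2 K a v ξ η| ≤ c2 * A * B * mm δ ξ * Maj a δ ξ η := by
      have : 0 < η ^ (-1 - a) := by positivity
      rw [abs_mul, abs_mul, abs_of_pos this]
      calc _ ≤ η ^ (-1 - a) * (A * (gg a η / gg a ξ)) * (c2 * B * (mm (-δ) η * mm δ ξ)) := by
            gcongr
        _ = c2 * A * B * mm δ ξ * (η ^ (-1 - a) * (gg a η / gg a ξ) * mm (-δ) η) := by ring
        _ ≤ _ := by gcongr
    rw [e]
    have := abs_add_le (η ^ (-1 - a) * p * N1 K a v ξ η) (η ^ (-1 - a) * p * N2 K a v ξ η)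
    have : 0 ≤ (c3 + c4) * (A * B * mm δ ξ * Maj a δ ξ η) := by positivity
    linarith

/-- linearity -/
lemma J_int {K : ℝ → ℝ → ℝ} {v : ℝ → ℝ} {a δ K0 σ B η ξ : ℝ} (ha : 0 < a) (hδ : 0 < δ) (hδ1 : δ ≤ 1) (hK : KH K a K0 δ) (hv : Vb a σ B v) (hη : 0 < η)
    (hξ : η < ξ) :
    IntegrableOn (fun ζ => K η ζ * η⁻¹ * (ζ ^ 2)⁻¹ * v ζ) (Ioi (ξ - η)) := by
  by_cases hs : ξ < 2 * η
  · exact (J_large ha hδ hδ1 hK hv hη hξ hs).1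
  · exact (J_small ha hδ hδ1 hK hv hη (not_lt.1 hs)).1

lemma Zf_sub {K : ℝ → ℝ → ℝ} {v₁ v₂ : ℝ → ℝ} {a δ K0 σ₁ B₁ σ₂ B₂ η ξ p₁ p₂ c : ℝ} (ha : 0 < a) (hδ : 0 < δ) (hδ1 : δ ≤ 1) (hK : KH K a K0 δ)
    (hv₁ : Vb a σ₁ B₁ v₁) (hv₂ : Vb a σ₂ B₂ v₂) (hη : 0 < η) (hξ : η < ξ) :
    Zf K a v₁ ξ η p₁ c - Zf K a v₂ ξ η p₂ c =
      Zf K a v₁ ξ η (p₁ - p₂) 0 + Zf K a (fun ζ => v₁ ζ - v₂ ζ) ξ η p₂ c := by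
  have h1 : Jf K (fun ζ => v₁ ζ - v₂ ζ) ξ η = Jf K v₁ ξ η - Jf K v₂ ξ η := by
    unfold Jf
    rw [← integral_sub (J_int ha hδ hδ1 hK hv₁ hη hξ) (J_int ha hδ hδ1 hK hv₂ hη hξ)]
    congr 1; ext ζ; ring
  have h2 : WW (fun ζ => v₁ ζ - v₂ ζ) ξ = WW v₁ ξ - WW v₂ ξ := by
    unfold WW
    rw [← integral_sub (WW_int ha hv₁ (by linarith)).1 (WW_int ha hv₂ (by linarith)).1]
    congr 1; ext ζ; ring
  have h3 : N4 a (fun ζ => v₁ ζ - v₂ ζ) ξ η = N4 a v₁ ξ η - N4 a v₂ ξ η := by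
    unfold N4
    rw [← integral_sub (N4_int ha hv₁ hξ).1 (N4_int ha hv₂ hξ).1]
    congr 1; ext ζ; ring
  unfold Zf
  rw [h1, h2, h3]
  split_ifs <;> ring

/-- crude bound of the inner integral, used for integrability -/
lemma J_bound {K : ℝ → ℝ → ℝ} {v : ℝ → ℝ} {a δ K0 σ B : ℝ} (ha : 0 < a) (hδ : 0 < δ) (hδ1 : δ ≤ 1) (hK : KH K a K0 δ) (hv : Vb a σ B v) :
    ∃ C : ℝ, 0 ≤ C ∧ ∀ η ξ, 0 < η → η < ξ → |Jf K v ξ η| ≤ C * (η ^ (-1 - a) + 1) := by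
  have hB := hv.hB
  have hσ := hv.hσ
  have hK0 := hK.K0pos
  set c1 := K0 * ((1 + δ) / δ) * B
  set c2 := 2 * (1 + K0) * B
  set c3 := (1 + 2 * K0) * B * ((2 + a) / (1 + a))
  set c4 := B * ((1 + σ) / σ)
  have q1 : 0 ≤ c1 := by positivity
  have q2 : 0 ≤ c2 := by positivity
  have q3 : 0 ≤ c3 := by positivity
  have q4 : 0 ≤ c4 := by positivity
  refine ⟨c1 + c2 + c3 + c4, by positivity, ?_⟩
  intro η ξ hη hξ
  have hp : 0 < η ^ (-1 - a) := by positivity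
  have m : mm (-δ) η * mm δ ξ ≤ 1 := by
    have h1 := mm_anti (s := δ) hδ.le hξ.le
    have h2 := mm_nonneg (-δ) η
    calc _ ≤ mm (-δ) η * mm δ η := by gcongr
      _ = 1 := by rw [mm_mul]; simp [mm_zero]
  have n1 : |N1 K a v ξ η| ≤ c1 := (N1_int ha hδ hK hv hη hξ.le).2.trans (mul_le_of_le_one_right q1 m)
  have w : |WW v ξ| ≤ c4 := (WW_int ha hv (by linarith)).2.trans (mul_le_of_le_one_right q4 (mm_le_one hσ.le _))
  by_cases hs : ξ < 2 * η
  · rw [(J_large ha hδ hδ1 hK hv hη hξ hs).2]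
    have n3 : |N3 K a v ξ η| ≤ c3 := (N3_int ha hδ hδ1 hK hv hη hξ hs).2.trans
      (mul_le_of_le_one_right q3 (mm_le_one (by linarith) _))
    calc _ ≤ |η ^ (-1 - a) * (N1 K a v ξ η + WW v ξ)| + |N3 K a v ξ η| := abs_add_le _ _
      _ ≤ η ^ (-1 - a) * (c1 + c4) + c3 := by
          rw [abs_mul, abs_of_pos hp]
          have := abs_add_le (N1 K a v ξ η) (WW v ξ)
          gcongr; linarith
      _ ≤ _ := by nlinarith [mul_nonneg q2 hp.le, mul_nonneg q3 hp.le]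
  · have hs' := not_lt.1 hs
    rw [(J_small ha hδ hδ1 hK hv hη hs').2]
    have n2 : |N2 K a v ξ η| ≤ c2 := (N2_int ha hδ hδ1 hK hv hη hs').2.trans (mul_le_of_le_one_right q2 m)
    calc _ ≤ η ^ (-1 - a) * (c1 + c2 + c4) := by
          rw [abs_mul, abs_of_pos hp]
          have := abs_add_three (N1 K a v ξ η) (N2 K a v ξ η) (WW v ξ)
          gcongr; linarith
      _ ≤ _ := by nlinarith [mul_nonneg q2 hp.le, mul_nonneg q3 hp.le]

/-- measurability of the inner integral -/
lemma J_meas {K : ℝ → ℝ → ℝ} {v : ℝ → ℝ} {a δ K0 : ℝ} (hK : KH K a K0 δ) (hv : ContinuousOn v (Ioi 0)) (ξ : ℝ) :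
    AEStronglyMeasurable (fun η => Jf K v ξ η) (volume.restrict (Ioo 0 ξ)) := by
  set f : ℝ × ℝ → ℝ := fun p => K p.1 p.2 * p.1⁻¹ * (p.2 ^ 2)⁻¹ * v p.2
  have hf : ContinuousOn f (Ioi 0 ×ˢ Ioi 0) := by
    refine ((hK.cont.mul ?_).mul ?_).mul ?_
    · exact ContinuousOn.inv₀ continuousOn_fst fun p hp => ne_of_gt hp.1
    · exact ContinuousOn.inv₀ (continuousOn_snd.pow 2) fun p hp => pow_ne_zero 2 (ne_of_gt hp.2)
    · exact hv.comp continuousOn_snd fun p hp => hp.2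
  have hm : AEStronglyMeasurable f ((volume.restrict (Ioi 0)).prod (volume.restrict (Ioi 0))) := by
    rw [Measure.prod_restrict]
    exact hf.aestronglyMeasurable (measurableSet_Ioi.prod measurableSet_Ioi)
  set S : Set (ℝ × ℝ) := {p | ξ - p.1 < p.2}
  have hS : MeasurableSet S := measurableSet_lt (by fun_prop) (by fun_prop)
  have h1 := (hm.indicator hS).integral_prod_right'
  have h2 : AEStronglyMeasurable (fun η => ∫ ζ in Ioi 0, S.indicator f (η, ζ)) (volume.restrict (Ioo 0 ξ)) :=
    h1.mono_measure (Measure.restrict_mono Ioo_subset_Ioi_self le_rfl)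
  refine h2.congr ?_
  rw [EventuallyEq, ae_restrict_iff' measurableSet_Ioo]
  refine Eventually.of_forall fun η hη => ?_
  unfold Jf
  have e : (fun ζ => S.indicator f (η, ζ)) = (Ioi (ξ - η)).indicator (fun ζ => f (η, ζ)) := by
    ext ζ; rfl
  change ∫ ζ in Ioi 0, S.indicator f (η, ζ) = _
  rw [e, setIntegral_indicator measurableSet_Ioi]
  have : Ioi 0 ∩ Ioi (ξ - η) = Ioi (ξ - η) := by
    rw [inter_eq_right]; exact Ioi_subset_Ioi (by linarith [hη.2])
  rw [this]
end

section
lemma uu_Vb {a : ℝ} (ha : 0 < a) : ∃ C : ℝ, 1 ≤ C ∧ ∀ δ ρ q, Par a δ ρ → InS δ ρ q →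
    Vb a ρ C (uu a ρ q) := by
  obtain ⟨C, hC, h⟩ := uu_alg ha
  refine ⟨C, hC, fun δ ρ q hp hq => ⟨uu_cont hp hq, fun ζ hζ => ?_, hp.hρ, by linarith⟩⟩
  rw [abs_of_pos (uu_pos hp hq hζ)]
  exact h δ ρ q hp hq ζ hζ

lemma du_Vb {a : ℝ} (ha : 0 < a) : ∃ C : ℝ, 1 ≤ C ∧ ∀ δ ρ q₁ q₂ d, Par a δ ρ → InS δ ρ q₁ →
    InS δ ρ q₂ → (∀ ξ, 0 < ξ → |q₁ ξ - q₂ ξ| ≤ d * mm δ ξ) →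
    Vb a δ (C * d) (fun ζ => uu a ρ q₁ ζ - uu a ρ q₂ ζ) := by
  obtain ⟨C, hC, h⟩ := uu_diff_alg ha
  refine ⟨C, hC, fun δ ρ q₁ q₂ d hp h₁ h₂ hd => ⟨(uu_cont hp h₁).sub (uu_cont hp h₂), fun ζ hζ => ?_, hp.hδ,
    mul_nonneg (by linarith) (d_nonneg hd)⟩⟩
  exact h δ ρ q₁ q₂ d hp h₁ h₂ hd ζ hζ

noncomputable def pq (a : ℝ) (q : ℝ → ℝ) (η ξ : ℝ) : ℝ := q η * RR a q η ξ

lemma pq_abs {a δ ρ η ξ : ℝ} {q : ℝ → ℝ} (hp : Par a δ ρ) (h : InS δ ρ q) (hη : 0 < η)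
    (hξ : η ≤ ξ) : |pq a q η ξ| ≤ 2 * CE a * (gg a η / gg a ξ) := by
  unfold pq
  have h1 := h.le_two hp hη
  have h2 := RR_le hp h hη hξ
  rw [abs_mul, abs_of_pos (h.pos hp hη), abs_of_pos (RR_pos _ _ _ _), mul_assoc]
  exact mul_le_mul h1 h2 (RR_pos _ _ _ _).le (by norm_num)

lemma pq_diff {a δ ρ η ξ d : ℝ} {q₁ q₂ : ℝ → ℝ} (hp : Par a δ ρ) (h₁ : InS δ ρ q₁)
    (h₂ : InS δ ρ q₂) (hd : ∀ ξ, 0 < ξ → |q₁ ξ - q₂ ξ| ≤ d * mm δ ξ) (hη : 0 < η)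
    (hξ : η ≤ ξ) :
    |pq a q₁ η ξ - pq a q₂ η ξ| ≤ 3 * CE a * d * mm δ η * (gg a η / gg a ξ) := by
  unfold pq
  refine (prod_diff _ _ _ _).trans ?_
  have hd0 := d_nonneg hd
  have e1 := RR_le hp h₁ hη hξ
  have e2 := RR_diff hp h₁ h₂ hd hη hξ
  have e3 := hd η hη
  have e4 := h₂.le_two hp hη
  have := CE_ge hp.ha
  have := mm_nonneg δ η
  have := gg_pos a η
  have := gg_pos a ξ
  have := (RR_pos a q₁ η ξ).le
  rw [abs_of_pos (RR_pos a q₁ η ξ), abs_of_pos (h₂.pos hp hη)]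
  calc _ ≤ (d * mm δ η) * (CE a * (gg a η / gg a ξ)) + 2 * (CE a * d * mm δ η * (gg a η / gg a ξ)) := by
        gcongr
    _ = _ := by ring

lemma mm_half {δ ξ η : ℝ} (hδ : 0 ≤ δ) (hδ1 : δ ≤ 1) (h : ξ ≤ 2 * η) : mm δ η ≤ 2 * mm δ ξ := by
  refine (mm_comp hδ h).trans ?_
  have := two_pow_le hδ1
  have := mm_nonneg δ ξ
  gcongr

lemma mprod_ge {δ t ξ : ℝ} (hδ : 0 ≤ δ) : mm δ ξ ≤ mm (-δ) t * mm δ ξ :=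
  le_mul_of_one_le_left (mm_nonneg _ _) (one_le_mm (by linarith) _)

lemma mm_rho_diff {δ ρ ξ η : ℝ} (hδ : 0 < δ) (hδ1 : δ ≤ 1) (hρ : 0 < ρ) (hρ1 : ρ ≤ 1) (hη : 0 < η) (hξ : η < ξ) :
    |mm ρ η - mm ρ ξ| ≤ mm (-δ) (ξ - η) * mm δ ξ := by
  have h1 := mm_anti hρ.le hξ.le
  rw [abs_of_nonneg (by linarith)]
  rcases le_total ξ 1 with h | h
  · rw [mm_of_le (s := ρ) h, mm_of_le (s := ρ) (hξ.le.trans h), sub_self]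
    exact mul_nonneg (mm_nonneg _ _) (mm_nonneg _ _)
  · refine le_trans ?_ (ratio_le1 hδ.le hδ1 (sub_pos.2 hξ) (by linarith))
    have hx : 0 < max 1 η := mx_pos η
    have hxξ : max 1 η ≤ ξ := max_le h hξ.le
    have hξ0 : 0 < ξ := by linarith
    have e : mm ρ ξ = mm ρ η * (max 1 η / ξ) ^ ρ := by
      rw [mm_of_ge h]; unfold mm
      rw [Real.div_rpow hx.le hξ0.le, Real.rpow_neg hx.le, Real.rpow_neg hξ0.le]
      have : 0 < (max 1 η) ^ ρ := by positivity
      field_simp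
    have h2 : max 1 η / ξ ≤ (max 1 η / ξ) ^ ρ := by
      conv_lhs => rw [← Real.rpow_one (max 1 η / ξ)]
      exact Real.rpow_le_rpow_of_exponent_ge (by positivity) ((div_le_one hξ0).2 hxξ) hρ1
    have h3 := mm_le_one hρ.le η
    have h4 := mm_nonneg ρ η
    have h5 : η / ξ ≤ max 1 η / ξ := by gcongr; exact le_max_right _ _
    have h6 : (max 1 η / ξ) ^ ρ ≤ 1 := Real.rpow_le_one (by positivity) ((div_le_one hξ0).2 hxξ) hρ.le
    rw [e, sub_div, div_self hξ0.ne']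
    nlinarith

lemma RR_one {a δ ρ η ξ : ℝ} {q : ℝ → ℝ} (hp : Par a δ ρ) (h : InS δ ρ q) (hη : 0 < η)
    (hξ : η < ξ) (hs : ξ < 2 * η) :
    |RR a q η ξ - 1| ≤ 2 * 2 ^ (1 + a) * (mm (-δ) (ξ - η) * mm δ ξ) := by
  have ha := hp.ha
  have h1 := RR_le_one (ξ := ξ) hp h hη
  have h2 := RR_pos a q η ξ
  rw [abs_sub_comm, abs_of_nonneg (by linarith)]
  have h2a : (1:ℝ) ≤ 2 ^ (1 + a) := Real.one_le_rpow (by norm_num) (by linarith)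
  rcases le_total ξ 1 with h3 | h3
  · have := one_le_mm (s := -δ) (by linarith [hp.hδ]) (ξ - η)
    rw [mm_of_le (s := δ) h3, mul_one]
    nlinarith
  · have hξ0 : 0 < ξ := by linarith
    have h4 := ratio_le1 hp.hδ.le hp.hδ1.le (sub_pos.2 hξ) (by linarith : ξ - η ≤ ξ)
    have h5 : 1 - RR a q η ξ ≤ ∫ s in Ioc η ξ, s ^ (-1 - a) * q s := by
      unfold RR
      have := Real.add_one_le_exp (-∫ s in Ioc η ξ, s ^ (-1 - a) * q s)
      linarith
    have hi := (h.w_int hp hη).mono_set (Ioc_subset_Ioi_self : Ioc η ξ ⊆ Ioi η)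
    have h6 : ∫ s in Ioc η ξ, s ^ (-1 - a) * q s ≤ ∫ _s in Ioc η ξ, (2 * 2 ^ (1 + a) * ξ⁻¹) := by
      apply setIntegral_mono_on hi (integrableOn_const (by simp)) measurableSet_Ioc
      intro s hs'
      have hs0 : 0 < s := hη.trans hs'.1
      have h7 : s ^ (-1 - a) ≤ (ξ / 2) ^ (-1 - a) :=
        Real.rpow_le_rpow_of_nonpos (by linarith) (by linarith [hs'.1]) (by linarith)
      have h8 : (ξ / 2) ^ (-1 - a) = 2 ^ (1 + a) * ξ ^ (-1 - a) := by
        rw [Real.div_rpow hξ0.le (by norm_num), div_eq_mul_inv, ← Real.rpow_neg (by norm_num)]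
        rw [mul_comm]; congr 2; ring
      have h9 : ξ ^ (-1 - a) ≤ ξ⁻¹ := by
        rw [← Real.rpow_neg_one]
        exact Real.rpow_le_rpow_of_exponent_le h3 (by linarith)
      have := h.le_two hp hs0
      have := (h.pos hp hs0).le
      have : 0 < s ^ (-1 - a) := by positivity
      calc s ^ (-1 - a) * q s ≤ (2 ^ (1 + a) * ξ⁻¹) * 2 := by
            gcongr
            rw [h8] at h7
            exact h7.trans (by gcongr)
        _ = _ := by ring
    have h7 : ∫ _s in Ioc η ξ, (2 * 2 ^ (1 + a) * ξ⁻¹) = 2 * 2 ^ (1 + a) * ((ξ - η) / ξ) := by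
      simp [hξ.le]; ring
    rw [h7] at h6
    calc _ ≤ 2 * 2 ^ (1 + a) * ((ξ - η) / ξ) := h5.trans h6
      _ ≤ _ := by gcongr

noncomputable def CP (a : ℝ) : ℝ := 4 * 2 ^ (1 + a) + 2 + 6 * CE a

lemma CP_ge {a : ℝ} (ha : 0 < a) : 6 * CE a ≤ CP a ∧ 0 < CE a ∧ 1 ≤ CP a := by
  unfold CP
  have := CE_ge ha
  have : (0:ℝ) < 2 ^ (1 + a) := by positivity
  refine ⟨?_, ?_, ?_⟩ <;> linarith

lemma pq_large {a δ ρ η ξ : ℝ} {q : ℝ → ℝ} (hp : Par a δ ρ) (h : InS δ ρ q) (hη : 0 < η)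
    (hξ : η < ξ) (hs : ξ < 2 * η) :
    |pq a q η ξ - mm ρ ξ| ≤ CP a * (mm (-δ) (ξ - η) * mm δ ξ) := by
  have h1 := RR_one hp h hη hξ hs
  have h2 := h.bd η hη
  have h3 := mm_rho_diff hp.hδ hp.hδ1.le hp.hρ (hp.hρδ.trans hp.hδ1.le) hη hξ
  have h4 := mm_half hp.hδ.le hp.hδ1.le hs.le
  have h5 := mprod_ge (δ := δ) (t := ξ - η) (ξ := ξ) hp.hδ.le
  have h6 := h.le_two hp hη
  have h7 := h.pos hp hη
  have e : pq a q η ξ - mm ρ ξ = q η * (RR a q η ξ - 1) + (q η - mm ρ η) + (mm ρ η - mm ρ ξ) := by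
    unfold pq; ring
  rw [e]
  refine (abs_add_three _ _ _).trans ?_
  rw [abs_mul, abs_of_pos h7]
  have h8 : q η * |RR a q η ξ - 1| ≤ 2 * (2 * 2 ^ (1 + a) * (mm (-δ) (ξ - η) * mm δ ξ)) := by
    gcongr
  have h9 : 0 ≤ mm (-δ) (ξ - η) * mm δ ξ := mul_nonneg (mm_nonneg _ _) (mm_nonneg _ _)
  have h10 : 0 < CE a := (CP_ge hp.ha).2.1
  unfold CP
  nlinarith [mul_nonneg h10.le h9]

/-! V and G -/
noncomputable def VV (a : ℝ) (v : ℝ → ℝ) (t : ℝ) : ℝ := ∫ ζ in Ioi t, ζ ^ (-2 - a) * v ζ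

lemma VV_int {a σ B t : ℝ} {v : ℝ → ℝ} (ha : 0 < a) (hv : Vb a σ B v) (ht : 0 ≤ t) :
    IntegrableOn (fun ζ => ζ ^ (-2 - a) * v ζ) (Ioi t) ∧
    |VV a v t| ≤ B * ((2 + a) / (1 + a)) * mm (1 + a) t := by
  have hs : Ioi t ⊆ Ioi (0:ℝ) := Ioi_subset_Ioi ht
  have hi := mm_int (s := 2 + a) (by linarith) ht
  have := dom (f := fun ζ => ζ ^ (-2 - a) * v ζ) measurableSet_Ioi
    ((cont_pow hs _).mul (hv.cont.mono hs)) (hi.const_mul B) (fun ζ h => pow_v hv (hs h))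
  refine ⟨this.1, this.2.trans ?_⟩
  have b := mm_integral (s := 2 + a) (by linarith) ht
  have e : 2 + a - 1 = 1 + a := by ring
  rw [e] at b
  rw [integral_const_mul, mul_assoc]
  exact mul_le_mul_of_nonneg_left b hv.hB

lemma N4_eq {a σ B ξ η : ℝ} {v : ℝ → ℝ} (ha : 0 < a) (hv : Vb a σ B v) (hη : 0 < η) (hξ : η < ξ) :
    N4 a v ξ η = VV a v (ξ - η) - VV a v ξ := by
  have i := (VV_int ha hv (t := ξ - η) (by linarith)).1
  unfold N4 VV
  have hle : ξ - η ≤ ξ := by linarith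
  rw [← Ioc_union_Ioi_eq_Ioi hle, setIntegral_union (Ioc_disjoint_Ioi le_rfl) measurableSet_Ioi
    (i.mono_set Ioc_subset_Ioi_self) (i.mono_set (Ioi_subset_Ioi hle))]
  ring

lemma VV_deriv {a σ B t : ℝ} {v : ℝ → ℝ} (ha : 0 < a) (hv : Vb a σ B v) (ht : 0 < t) :
    HasDerivAt (VV a v) (-(t ^ (-2 - a) * v t)) t :=
  tail_hasDerivAt (f := fun ζ => ζ ^ (-2 - a) * v ζ) ((cont_pow Subset.rfl _).mul hv.cont)
    (fun _ hx => (VV_int ha hv (le_of_lt hx)).1) ht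

noncomputable def GG (a ρ : ℝ) (q : ℝ → ℝ) (ξ : ℝ) : ℝ :=
  PP a ρ q (ξ / 2) + ξ / 2 * (VV a (uu a ρ q) (ξ / 2) - VV a (uu a ρ q) ξ)

lemma VV_ftc {a δ ρ B x : ℝ} {q : ℝ → ℝ} (hp : Par a δ ρ) (h : InS δ ρ q)
    (hv : Vb a ρ B (uu a ρ q)) (hx : 0 < x) :
    IntegrableOn (VV a (uu a ρ q)) (Ioo 0 x) ∧
    ∫ t in Ioo 0 x, VV a (uu a ρ q) t = PP a ρ q x + x * VV a (uu a ρ q) x := by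
  apply ftc_zero (f := fun x => PP a ρ q x + x * VV a (uu a ρ q) x) hx
  · intro t ht
    have h1 := (PP_hasDerivAt hp h ht).add ((hasDerivAt_id t).mul (VV_deriv hp.ha hv ht))
    refine HasDerivAt.congr_deriv h1 ?_
    have : t * t ^ (-2 - a) = t ^ (-1 - a) := by
      rw [mul_comm, ← Real.rpow_add_one ht.ne']; congr 1; ring
    simp only [id]
    linear_combination (- uu a ρ q t) * this
  · intro t ht
    apply setIntegral_nonneg measurableSet_Ioi
    intro s hs
    have : 0 < s := ht.trans hs
    have := (uu_pos hp h this).le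
    positivity
  · have h1 : Tendsto (fun x => x * VV a (uu a ρ q) x) (nhdsWithin 0 (Ioi 0)) (nhds 0) := by
      have : Tendsto (fun x : ℝ => x * (B * ((2 + a) / (1 + a)))) (nhdsWithin 0 (Ioi 0)) (nhds 0) := by
        have : Tendsto (fun x : ℝ => x * (B * ((2 + a) / (1 + a)))) (nhds 0) (nhds (0 * (B * ((2 + a) / (1 + a))))) :=
          tendsto_id.mul_const _
        rw [zero_mul] at this
        exact this.mono_left nhdsWithin_le_nhds
      refine squeeze_zero_norm' ?_ this
      filter_upwards [self_mem_nhdsWithin] with t ht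
      have ht : 0 < t := ht
      rw [Real.norm_eq_abs, abs_mul, abs_of_pos ht]
      gcongr
      refine (VV_int hp.ha hv ht.le).2.trans (mul_le_of_le_one_right ?_ (mm_le_one (by linarith [hp.ha]) _))
      have := hv.hB
      have := hp.ha
      positivity
    simpa using (PP_tendsto_zero hp h).add h1

lemma G_int {a δ ρ B ξ : ℝ} {q : ℝ → ℝ} (hp : Par a δ ρ) (h : InS δ ρ q)
    (hv : Vb a ρ B (uu a ρ q)) (hξ : 0 < ξ) :
    IntegrableOn (fun η => if ξ < 2 * η then N4 a (uu a ρ q) ξ η else 0) (Ioo 0 ξ) ∧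
    ∫ η in Ioo 0 ξ, (if ξ < 2 * η then N4 a (uu a ρ q) ξ η else 0) = GG a ρ q ξ := by
  obtain ⟨i, e⟩ := VV_ftc hp h hv (x := ξ / 2) (by linarith)
  have hle : ξ / 2 ≤ ξ := by linarith
  have h0 : (0:ℝ) ≤ ξ / 2 := by linarith
  have ii : IntervalIntegrable (VV a (uu a ρ q)) volume 0 (ξ / 2) := by
    rw [intervalIntegrable_iff_integrableOn_Ioo_of_le h0]; exact i
  have ii2 := ii.comp_sub_left ξ
  have e1 : ξ - ξ / 2 = ξ / 2 := by ring
  rw [e1, sub_zero] at ii2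
  have ii3 : IntegrableOn (fun η => VV a (uu a ρ q) (ξ - η)) (Ioo (ξ / 2) ξ) :=
    (intervalIntegrable_iff_integrableOn_Ioo_of_le hle).1 ii2.symm
  have e2 : ∫ η in Ioo (ξ / 2) ξ, VV a (uu a ρ q) (ξ - η) = ∫ t in Ioo 0 (ξ / 2), VV a (uu a ρ q) t := by
    have := intervalIntegral.integral_comp_sub_left (a := ξ / 2) (b := ξ) (VV a (uu a ρ q)) ξ
    rw [e1, sub_self, intervalIntegral.integral_of_le hle, intervalIntegral.integral_of_le h0,
      integral_Ioc_eq_integral_Ioo, integral_Ioc_eq_integral_Ioo] at this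
    exact this
  have ic : IntegrableOn (fun _ : ℝ => VV a (uu a ρ q) ξ) (Ioo (ξ / 2) ξ) := integrableOn_const (by simp)
  have e3 : (fun η => if ξ < 2 * η then N4 a (uu a ρ q) ξ η else 0) =
      (Ioi (ξ / 2)).indicator (fun η => N4 a (uu a ρ q) ξ η) := by
    ext η
    by_cases hc : ξ < 2 * η
    · rw [if_pos hc, indicator_of_mem (by simp only [mem_Ioi]; linarith)]
    · rw [if_neg hc, indicator_of_notMem (by simp only [mem_Ioi]; linarith)]
  have hset : Ioo 0 ξ ∩ Ioi (ξ / 2) = Ioo (ξ / 2) ξ := by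
    ext x; simp only [mem_inter_iff, mem_Ioo, mem_Ioi]
    constructor
    · rintro ⟨⟨_, h2⟩, h3⟩; exact ⟨h3, h2⟩
    · rintro ⟨h3, h2⟩; exact ⟨⟨by linarith, h2⟩, h3⟩
  have i4 : IntegrableOn (fun η => N4 a (uu a ρ q) ξ η) (Ioo (ξ / 2) ξ) := by
    refine IntegrableOn.congr_fun (ii3.sub ic) (fun η hη => ?_) measurableSet_Ioo
    exact (N4_eq hp.ha hv (by linarith [hη.1]) hη.2).symm
  rw [e3]
  constructor
  · rw [IntegrableOn, integrable_indicator_iff measurableSet_Ioi, IntegrableOn, Measure.restrict_restrict measurableSet_Ioi,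
      inter_comm, hset]
    exact i4
  · rw [setIntegral_indicator measurableSet_Ioi, hset,
      setIntegral_congr_fun measurableSet_Ioo (fun η hη => N4_eq hp.ha hv (by linarith [hη.1]) hη.2),
      integral_sub ii3 ic, e2, e]
    unfold GG
    simp [hle]; ring
end

section
lemma II_nonneg {a δ ρ η : ℝ} {q : ℝ → ℝ} (hp : Par a δ ρ) (h : InS δ ρ q) (hη : 0 < η) : 0 ≤ II a q η := by
  apply setIntegral_nonneg measurableSet_Ioi
  intro s hs
  have : 0 < s := hη.trans hs
  have := h.pos hp this
  positivity

lemma II_le {a δ ρ η : ℝ} {q : ℝ → ℝ} (hp : Par a δ ρ) (h : InS δ ρ q) (hη : 0 < η) :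
    II a q η ≤ 2 * (η ^ (-a) / a) := by
  unfold II
  rw [← pow_integral hp.ha hη, ← integral_const_mul]
  apply setIntegral_mono_on (h.w_int hp hη) ((pow_int hp.ha hη).const_mul _) measurableSet_Ioi
  intro s hs
  have hs0 : 0 < s := hη.trans hs
  have := h.le_two hp hs0
  have : 0 < s ^ (-1 - a) := by positivity
  nlinarith

lemma PP_one {a δ ρ η : ℝ} {q : ℝ → ℝ} (hp : Par a δ ρ) (h : InS δ ρ q) (hη : 0 < η) :
    |PP a ρ q η - (1 + ρ)⁻¹| ≤ (1 + 2 / a) * mm δ η := by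
  have ha := hp.ha
  have hρ := hp.hρ
  have h1 := PP_le_one hp h hη
  have h2 := PP_pos (a := a) hp.hρ q η
  have h3 := inv_le hp.hρ
  rw [abs_sub_comm, abs_of_nonneg (by linarith)]
  have h0 : 0 ≤ 2 / a := by positivity
  rcases le_total η 1 with h4 | h4
  · rw [mm_of_le h4]; nlinarith
  · have h5 := II_le hp h hη
    have h6 := Real.add_one_le_exp (-II a q η)
    have h7 : (1 + ρ)⁻¹ - PP a ρ q η ≤ II a q η := by
      unfold PP
      have e : 0 < (1 + ρ)⁻¹ := by positivity
      have := II_nonneg hp h hη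
      nlinarith
    have h8 : η ^ (-a) ≤ mm δ η := by
      rw [mm_of_ge h4]
      exact Real.rpow_le_rpow_of_exponent_le h4 (by linarith [hp.hδa])
    have h9 := mm_nonneg δ η
    calc _ ≤ 2 * (η ^ (-a) / a) := h7.trans h5
      _ = 2 / a * η ^ (-a) := by ring
      _ ≤ 2 / a * mm δ η := by gcongr
      _ ≤ _ := by nlinarith

lemma t_mm {a δ t : ℝ} (hδa : δ ≤ a) (ht : 0 < t) : t * mm (1 + a) t ≤ mm δ t := by
  rw [← mm_mul, ← mul_assoc]
  have h1 := pow_mm_le (r := 1) zero_le_one ht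
  rw [Real.rpow_one] at h1
  have h2 := mm_exp hδa t
  have h3 := mm_nonneg a t
  calc _ ≤ 1 * mm a t := by gcongr
    _ ≤ _ := by linarith

lemma Vpart {a σ B δ ξ : ℝ} {v : ℝ → ℝ} (ha : 0 < a) (hδ : 0 < δ) (hδ1 : δ ≤ 1) (hδa : δ ≤ a) (hv : Vb a σ B v) (hξ : 0 < ξ) :
    |ξ / 2 * (VV a v (ξ / 2) - VV a v ξ)| ≤ 8 * B * mm δ ξ := by
  have hB := hv.hB
  have h1 := (VV_int ha hv (t := ξ / 2) (by linarith)).2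
  have h2 := (VV_int ha hv (t := ξ) (by linarith)).2
  have h3 := mm_anti (s := 1 + a) (by linarith) (by linarith : ξ / 2 ≤ ξ)
  have h4 := t_mm hδa (by linarith : 0 < ξ / 2)
  have h5 := mm_half hδ.le hδ1 (by linarith : ξ ≤ 2 * (ξ / 2))
  have h6 : (2 + a) / (1 + a) ≤ 2 := by rw [div_le_iff₀ (by linarith)]; linarith
  have h7 := mm_nonneg (1 + a) (ξ / 2)
  have h8 := mm_nonneg (1 + a) ξ
  have h9 : |VV a v (ξ / 2)| ≤ B * 2 * mm (1 + a) (ξ / 2) := h1.trans (by gcongr)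
  have h10 : |VV a v ξ| ≤ B * 2 * mm (1 + a) (ξ / 2) := h2.trans (by gcongr)
  have h11 := abs_sub (VV a v (ξ / 2)) (VV a v ξ)
  rw [abs_mul, abs_of_pos (by linarith : 0 < ξ / 2)]
  calc _ ≤ ξ / 2 * (B * 4 * mm (1 + a) (ξ / 2)) := by gcongr; linarith
    _ = 4 * B * (ξ / 2 * mm (1 + a) (ξ / 2)) := by ring
    _ ≤ 4 * B * (2 * mm δ ξ) := mul_le_mul_of_nonneg_left (h4.trans h5) (by positivity)
    _ = _ := by ring

lemma G_bound {a δ ρ B ξ : ℝ} {q : ℝ → ℝ} (hp : Par a δ ρ) (h : InS δ ρ q)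
    (hv : Vb a ρ B (uu a ρ q)) (hξ : 0 < ξ) :
    |GG a ρ q ξ - (1 + ρ)⁻¹| ≤ (2 * (1 + 2 / a) + 8 * B) * mm δ ξ := by
  have h1 := PP_one hp h (by linarith : 0 < ξ / 2)
  have h2 := Vpart hp.ha hp.hδ hp.hδ1.le hp.hδa.le hv hξ
  have h5 := mm_half hp.hδ.le hp.hδ1.le (by linarith : ξ ≤ 2 * (ξ / 2))
  have ha := hp.ha
  have e : GG a ρ q ξ - (1 + ρ)⁻¹ = (PP a ρ q (ξ / 2) - (1 + ρ)⁻¹) + ξ / 2 * (VV a (uu a ρ q) (ξ / 2) - VV a (uu a ρ q) ξ) := by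
    unfold GG; ring
  rw [e]
  have h6 : (1 + 2 / a) * mm δ (ξ / 2) ≤ (1 + 2 / a) * (2 * mm δ ξ) := by gcongr
  have := abs_add_le (PP a ρ q (ξ / 2) - (1 + ρ)⁻¹) (ξ / 2 * (VV a (uu a ρ q) (ξ / 2) - VV a (uu a ρ q) ξ))
  linarith

lemma VV_sub {a σ₁ B₁ σ₂ B₂ t : ℝ} {v₁ v₂ : ℝ → ℝ} (ha : 0 < a) (hv₁ : Vb a σ₁ B₁ v₁) (hv₂ : Vb a σ₂ B₂ v₂) (ht : 0 ≤ t) :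
    VV a (fun ζ => v₁ ζ - v₂ ζ) t = VV a v₁ t - VV a v₂ t := by
  unfold VV
  rw [← integral_sub (VV_int ha hv₁ ht).1 (VV_int ha hv₂ ht).1]
  congr 1; ext ζ; ring

lemma G_diff {a δ ρ B B' ξ d : ℝ} {q₁ q₂ : ℝ → ℝ} (hp : Par a δ ρ) (h₁ : InS δ ρ q₁)
    (h₂ : InS δ ρ q₂) (hd : ∀ ξ, 0 < ξ → |q₁ ξ - q₂ ξ| ≤ d * mm δ ξ)
    (hv₁ : Vb a ρ B (uu a ρ q₁)) (hv₂ : Vb a ρ B (uu a ρ q₂))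
    (hv : Vb a δ (B' * d) (fun ζ => uu a ρ q₁ ζ - uu a ρ q₂ ζ)) (hξ : 0 < ξ) :
    |GG a ρ q₁ ξ - GG a ρ q₂ ξ| ≤ (2 * CE a + 8 * B') * d * mm δ ξ := by
  have hd0 := d_nonneg hd
  have h1 := PP_diff hp h₁ h₂ hd (by linarith : 0 < ξ / 2)
  have h2 := Vpart hp.ha hp.hδ hp.hδ1.le hp.hδa.le hv hξ
  rw [VV_sub hp.ha hv₁ hv₂ (by linarith), VV_sub hp.ha hv₁ hv₂ (by linarith)] at h2
  have h5 := mm_half hp.hδ.le hp.hδ1.le (by linarith : ξ ≤ 2 * (ξ / 2))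
  have hg := gg_le_one hp.ha (by linarith : 0 < ξ / 2)
  have hg0 := gg_pos a (ξ / 2)
  have hC := (CP_ge hp.ha).2.1
  have hm := mm_nonneg δ (ξ / 2)
  have hm' := mm_nonneg δ ξ
  have h6 : CE a * d * mm δ (ξ / 2) * gg a (ξ / 2) ≤ CE a * d * (2 * mm δ ξ) * 1 := by gcongr
  have e : GG a ρ q₁ ξ - GG a ρ q₂ ξ = (PP a ρ q₁ (ξ / 2) - PP a ρ q₂ (ξ / 2)) + ξ / 2 * (VV a (uu a ρ q₁) (ξ / 2) - VV a (uu a ρ q₂) (ξ / 2) -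
    (VV a (uu a ρ q₁) ξ - VV a (uu a ρ q₂) ξ)) := by
    unfold GG; ring
  rw [e]
  refine (abs_add_le _ _).trans ?_
  linarith

/-! W -/
lemma mm_rep {ρ ξ : ℝ} (hρ : 0 < ρ) (hξ : 0 ≤ ξ) :
    IntegrableOn ((Ioi (1:ℝ)).indicator (fun ζ : ℝ => ζ ^ (-1 - ρ))) (Ioi ξ) ∧
    ρ * ∫ ζ in Ioi ξ, (Ioi (1:ℝ)).indicator (fun ζ : ℝ => ζ ^ (-1 - ρ)) ζ = mm ρ ξ := by
  have hx := mx_pos ξ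
  have e : Ioi ξ ∩ Ioi 1 = Ioi (max 1 ξ) := by
    rw [Ioi_inter_Ioi, max_comm]
  constructor
  · rw [IntegrableOn, integrable_indicator_iff measurableSet_Ioi, IntegrableOn, Measure.restrict_restrict measurableSet_Ioi,
      inter_comm, e]
    exact pow_int hρ hx
  · rw [setIntegral_indicator measurableSet_Ioi, e, pow_integral hρ hx]
    unfold mm; field_simp

lemma W_bound {a δ ρ B ξ : ℝ} {q : ℝ → ℝ} (hp : Par a δ ρ) (h : InS δ ρ q)
    (hv : Vb a ρ B (uu a ρ q)) (hξ : 0 ≤ ξ) :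
    |ρ * WW (uu a ρ q) ξ - mm ρ ξ * (1 + ρ)⁻¹| ≤ (B + 2 + 2 / a) * ((1 + δ) / δ) * ρ * mm δ ξ := by
  have ha := hp.ha
  have hρ := hp.hρ
  have hδ := hp.hδ
  have hB := hv.hB
  obtain ⟨i, e⟩ := mm_rep (ξ := ξ) hρ hξ
  have iw := (WW_int ha hv hξ).1
  set C := B + 2 + 2 / a with hC
  have hs : Ioi ξ ⊆ Ioi (0:ℝ) := Ioi_subset_Ioi hξ
  have key : |∫ ζ in Ioi ξ, (ζ⁻¹ * uu a ρ q ζ - (1 + ρ)⁻¹ * (Ioi (1:ℝ)).indicator (fun ζ : ℝ => ζ ^ (-1 - ρ)) ζ)|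
      ≤ ∫ ζ in Ioi ξ, C * mm (1 + δ) ζ := by
    rw [← Real.norm_eq_abs]
    apply norm_integral_le_of_norm_le ((mm_int (s := 1 + δ) (by linarith) hξ).const_mul C)
    rw [ae_restrict_iff' measurableSet_Ioi]
    refine Eventually.of_forall fun ζ hζ => ?_
    have h0 : 0 < ζ := hs hζ
    rw [Real.norm_eq_abs]
    by_cases h1 : 1 < ζ
    · rw [indicator_of_mem (by exact h1)]
      have e1 : ζ ^ (-1 - ρ) = ζ⁻¹ * mm ρ ζ := by
        rw [mm_of_ge h1.le, ← Real.rpow_neg_one, ← Real.rpow_add h0]; rfl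
      have e2 : ζ⁻¹ * uu a ρ q ζ - (1 + ρ)⁻¹ * ζ ^ (-1 - ρ) = ζ⁻¹ * ((q ζ - mm ρ ζ) * PP a ρ q ζ + mm ρ ζ * (PP a ρ q ζ - (1 + ρ)⁻¹)) := by
        rw [e1]; unfold uu; ring
      have e3 : mm (1 + δ) ζ = ζ⁻¹ * mm δ ζ := by
        rw [← mm_mul, mm_of_ge (s := 1) h1.le, Real.rpow_neg_one]
      rw [e2, e3, abs_mul, abs_of_pos (by positivity : 0 < ζ⁻¹), mul_left_comm]
      gcongr
      refine (abs_add_le _ _).trans ?_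
      rw [abs_mul, abs_mul, abs_of_pos (PP_pos hρ q ζ), abs_of_pos (mm_pos ρ ζ)]
      have b1 := h.bd ζ h0
      have b2 := PP_one hp h h0
      have b3 := (PP_le_one hp h h0).trans (inv_le hρ)
      have b4 := mm_le_one hρ.le ζ
      have b5 := PP_pos (a := a) hρ q ζ
      have b6 := mm_nonneg ρ ζ
      have b7 := mm_nonneg δ ζ
      calc _ ≤ (1 / 2 * mm δ ζ) * 1 + 1 * ((1 + 2 / a) * mm δ ζ) := by gcongr
        _ ≤ C * mm δ ζ := by rw [hC]; nlinarith [mul_nonneg hB b7]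
    · rw [indicator_of_notMem (by exact h1), mul_zero, sub_zero]
      refine (inv_v ha hv h0).trans ?_
      rw [mm_of_le (not_lt.1 h1), mm_of_le (not_lt.1 h1)]
      have : 0 ≤ 2 / a := by positivity
      linarith
  rw [integral_sub iw (i.const_mul _), integral_const_mul, integral_const_mul] at key
  have h2 := mm_integral (s := 1 + δ) (by linarith) hξ
  rw [add_sub_cancel_left] at h2
  have hC0 : 0 ≤ C := by have : 0 ≤ 2 / a := by positivity
                         linarith
  have e5 : ρ * WW (uu a ρ q) ξ - mm ρ ξ * (1 + ρ)⁻¹ = ρ * ((∫ ζ in Ioi ξ, ζ⁻¹ * uu a ρ q ζ) -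
      (1 + ρ)⁻¹ * ∫ ζ in Ioi ξ, (Ioi (1:ℝ)).indicator (fun ζ : ℝ => ζ ^ (-1 - ρ)) ζ) := by
    rw [← e]; unfold WW; ring
  rw [e5, abs_mul, abs_of_pos hρ]
  calc _ ≤ ρ * (C * ((1 + δ) / δ * mm δ ξ)) := by
        gcongr
        exact key.trans (by gcongr)
    _ = _ := by ring

/-! the map F -/
noncomputable def TT (K : ℝ → ℝ → ℝ) (ρ : ℝ) (u : ℝ → ℝ) (ξ : ℝ) : ℝ :=
  ρ * ∫ η in Ioo 0 ξ, u η * Jf K u ξ η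

noncomputable def FF (K : ℝ → ℝ → ℝ) (a ρ : ℝ) (q : ℝ → ℝ) (ξ : ℝ) : ℝ :=
  TT K ρ (uu a ρ q) ξ / PP a ρ q ξ

lemma uJ_int {K : ℝ → ℝ → ℝ} {a δ ρ K0 B ξ : ℝ} {q : ℝ → ℝ} (hp : Par a δ ρ) (hK : KH K a K0 δ) (h : InS δ ρ q)
    (hv : Vb a ρ B (uu a ρ q)) (hξ : 0 < ξ) :
    IntegrableOn (fun η => uu a ρ q η * Jf K (uu a ρ q) ξ η) (Ioo 0 ξ) := by
  obtain ⟨C, hC, hb⟩ := J_bound hp.ha hp.hδ hp.hδ1.le hK hv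
  have i1 := (uu_int hp h hξ).1
  have i2 : IntegrableOn (fun _ : ℝ => (2:ℝ)) (Ioo 0 ξ) := integrableOn_const (by simp)
  refine Integrable.mono' ((Integrable.add i1 i2).const_mul C) ?_ ?_
  · exact (((uu_cont hp h).mono Ioo_subset_Ioi_self).aestronglyMeasurable measurableSet_Ioo).mul
      (J_meas hK (uu_cont hp h) ξ)
  · rw [ae_restrict_iff' measurableSet_Ioo]
    refine Eventually.of_forall fun η hη => ?_
    have h1 := hb η ξ hη.1 hη.2
    have h2 := uu_pos hp h hη.1
    have h3 : uu a ρ q η ≤ 2 := by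
      have := uu_le_two hp h hη.1
      have := mm_le_one hp.hρ.le η
      linarith
    rw [Real.norm_eq_abs, abs_mul, abs_of_pos h2]
    simp only [Pi.add_apply]
    calc _ ≤ uu a ρ q η * (C * (η ^ (-1 - a) + 1)) := by gcongr
      _ = C * (η ^ (-1 - a) * uu a ρ q η + uu a ρ q η) := by ring
      _ ≤ _ := by gcongr

lemma pq_eq {a δ ρ η ξ : ℝ} {q : ℝ → ℝ} (hp : Par a δ ρ) (h : InS δ ρ q) (hη : 0 < η) (hξ : η ≤ ξ) :
    pq a q η ξ = uu a ρ q η / PP a ρ q ξ := by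
  have := PP_pos (a := a) hp.hρ q ξ
  unfold pq uu
  rw [PP_RR hp h hη hξ]; field_simp

lemma F_decomp {K : ℝ → ℝ → ℝ} {a δ ρ K0 B ξ : ℝ} {q : ℝ → ℝ} (hp : Par a δ ρ) (hK : KH K a K0 δ) (h : InS δ ρ q)
    (hv : Vb a ρ B (uu a ρ q)) (hξ : 0 < ξ) :
    IntegrableOn (fun η => Zf K a (uu a ρ q) ξ η (pq a q η ξ) (mm ρ ξ)) (Ioo 0 ξ) ∧
    FF K a ρ q ξ = ρ * WW (uu a ρ q) ξ + ρ * mm ρ ξ * GG a ρ q ξ +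
      ρ * ∫ η in Ioo 0 ξ, Zf K a (uu a ρ q) ξ η (pq a q η ξ) (mm ρ ξ) := by
  have i1 := (uJ_int hp hK h hv hξ).div_const (PP a ρ q ξ)
  obtain ⟨i2, e2⟩ := uu_int hp h hξ
  have i2' := (i2.div_const (PP a ρ q ξ)).mul_const (WW (uu a ρ q) ξ)
  obtain ⟨i3, e3⟩ := G_int hp h hv hξ
  have i3' := i3.const_mul (mm ρ ξ)
  have hP := PP_pos (a := a) hp.hρ q ξ
  have eZ : ∀ η ∈ Ioo 0 ξ, uu a ρ q η * Jf K (uu a ρ q) ξ η / PP a ρ q ξ -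
      η ^ (-1 - a) * uu a ρ q η / PP a ρ q ξ * WW (uu a ρ q) ξ -
      mm ρ ξ * (if ξ < 2 * η then N4 a (uu a ρ q) ξ η else 0) = Zf K a (uu a ρ q) ξ η (pq a q η ξ) (mm ρ ξ) := by
    intro η hη
    unfold Zf
    rw [pq_eq hp h hη.1 hη.2.le]
    split_ifs <;> ring
  have i12 : Integrable (fun η => uu a ρ q η * Jf K (uu a ρ q) ξ η / PP a ρ q ξ -
      η ^ (-1 - a) * uu a ρ q η / PP a ρ q ξ * WW (uu a ρ q) ξ) (volume.restrict (Ioo 0 ξ)) := i1.sub i2'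
  refine ⟨IntegrableOn.congr_fun (i12.sub i3') eZ measurableSet_Ioo, ?_⟩
  rw [← setIntegral_congr_fun measurableSet_Ioo eZ, integral_sub i12 i3', integral_sub i1 i2',
    integral_const_mul, integral_mul_const, integral_div, integral_div, e2, e3, div_self hP.ne']
  unfold FF TT
  ring
end

section
lemma Z_bound {a δ K0 : ℝ} (ha : 0 < a) (hδ : 0 < δ) (hδ1 : δ < 1) (hδa : δ < a) (hK0 : 0 < K0) :
    ∃ C : ℝ, 0 < C ∧ ∀ (K : ℝ → ℝ → ℝ) (v q : ℝ → ℝ) (ρ σ B ξ η : ℝ), KH K a K0 δ → Par a δ ρ → InS δ ρ q →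
      Vb a σ B v → 0 < η → η < ξ →
      |Zf K a v ξ η (pq a q η ξ) (mm ρ ξ)| ≤ C * B * mm δ ξ * Maj a δ ξ η := by
  obtain ⟨C, hC, hb⟩ := Zf_bound ha hδ hδ1.le hδa hK0
  obtain ⟨c1, c2, c3⟩ := CP_ge ha
  refine ⟨C * CP a, by positivity, fun K v q ρ σ B ξ η hK hp h hv hη hξ => ?_⟩
  refine hb K v σ B (CP a) ξ η _ _ hK hv hη hξ (by linarith) ?_ fun hs => ⟨pq_large hp h hη hξ hs, ?_⟩
  · have := gg_pos a η
    have := gg_pos a ξ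
    refine (pq_abs hp h hη hξ.le).trans ?_
    gcongr; linarith
  · rw [abs_of_pos (mm_pos _ _)]
    exact (mm_le_one hp.hρ.le ξ).trans c3

lemma dZ_bound {a δ K0 : ℝ} (ha : 0 < a) (hδ : 0 < δ) (hδ1 : δ < 1) (hδa : δ < a) (hK0 : 0 < K0) :
    ∃ C : ℝ, 0 < C ∧ ∀ (K : ℝ → ℝ → ℝ) (v q₁ q₂ : ℝ → ℝ) (d ρ σ B ξ η : ℝ), KH K a K0 δ → Par a δ ρ → InS δ ρ q₁ →
      InS δ ρ q₂ → (∀ ξ, 0 < ξ → |q₁ ξ - q₂ ξ| ≤ d * mm δ ξ) →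
      Vb a σ B v → 0 < η → η < ξ →
      |Zf K a v ξ η (pq a q₁ η ξ - pq a q₂ η ξ) 0| ≤ C * B * d * mm δ ξ * Maj a δ ξ η := by
  obtain ⟨C, hC, hb⟩ := Zf_bound ha hδ hδ1.le hδa hK0
  obtain ⟨c1, c2, c3⟩ := CP_ge ha
  refine ⟨C * CP a, by positivity, fun K v q₁ q₂ d ρ σ B ξ η hK hp h₁ h₂ hd hv hη hξ => ?_⟩
  have hd0 := d_nonneg hd
  have h1 := pq_diff hp h₁ h₂ hd hη hξ.le
  have g1 := gg_pos a η
  have g2 := gg_pos a ξ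
  have g3 : gg a η / gg a ξ ≤ 1 := (div_le_one g2).2 (gg_mono ha hη hξ.le)
  have m0 := mm_nonneg δ ξ
  have m1 := mm_nonneg δ η
  have := hb K v σ B (CP a * d) ξ η (pq a q₁ η ξ - pq a q₂ η ξ) 0 hK hv hη hξ (by positivity) ?_ fun hs => ⟨?_, ?_⟩
  · refine this.trans (le_of_eq ?_); ring
  · refine h1.trans ?_
    have := mm_le_one hδ.le η
    calc _ ≤ 3 * CE a * d * 1 * (gg a η / gg a ξ) := by gcongr
      _ ≤ CP a * d * (gg a η / gg a ξ) := by rw [mul_one]; gcongr; linarith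
  · rw [sub_zero]
    refine h1.trans ?_
    have e1 := mm_half hδ.le hδ1.le hs.le
    have e2 := mprod_ge (t := ξ - η) (ξ := ξ) hδ.le
    calc _ ≤ 3 * CE a * d * (2 * mm δ ξ) * 1 := by gcongr
      _ = 6 * CE a * d * mm δ ξ := by ring
      _ ≤ CP a * d * (mm (-δ) (ξ - η) * mm δ ξ) := by gcongr
  · rw [abs_zero]; positivity

lemma FF_one {a δ K0 : ℝ} (ha : 0 < a) (hδ : 0 < δ) (hδ1 : δ < 1) (hδa : δ < a) (hK0 : 0 < K0) :
    ∃ C : ℝ, 0 < C ∧ ∀ (K : ℝ → ℝ → ℝ) (q : ℝ → ℝ) (ρ : ℝ), KH K a K0 δ → Par a δ ρ → InS δ ρ q →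
      ∀ ξ, 0 < ξ → |FF K a ρ q ξ - mm ρ ξ| ≤ C * ρ * mm δ ξ := by
  obtain ⟨Z, hZ, hz⟩ := Z_bound ha hδ hδ1 hδa hK0
  obtain ⟨B, hB, hb⟩ := uu_Vb ha
  set L := 4 + 2 * ((1 + a - δ) / (a - δ)) with hL
  have hL0 : 0 < L := by
    have : 0 < (1 + a - δ) / (a - δ) := div_pos (by linarith) (by linarith)
    positivity
  refine ⟨(B + 2 + 2 / a) * ((1 + δ) / δ) + (2 * (1 + 2 / a) + 8 * B) + Z * B * L, by positivity,
    fun K q ρ hK hp h ξ hξ => ?_⟩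
  have hv := hb δ ρ q hp h
  have hρ := hp.hρ
  obtain ⟨i, e⟩ := F_decomp hp hK h hv hξ
  have w := W_bound hp h hv hξ.le
  have g := G_bound hp h hv hξ
  have m0 := mm_nonneg δ ξ
  have m1 := mm_nonneg ρ ξ
  have m2 := mm_le_one hρ.le ξ
  obtain ⟨mi, mb⟩ := Maj_int ha hδa hξ
  have z : |∫ η in Ioo 0 ξ, Zf K a (uu a ρ q) ξ η (pq a q η ξ) (mm ρ ξ)| ≤ Z * B * mm δ ξ * L := by
    rw [← Real.norm_eq_abs]
    refine (norm_integral_le_of_norm_le (mi.const_mul (Z * B * mm δ ξ)) ?_).trans ?_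
    · rw [ae_restrict_iff' measurableSet_Ioo]
      exact Eventually.of_forall fun η hη => hz K _ q ρ ρ B ξ η hK hp h hv hη.1 hη.2
    · rw [integral_const_mul]; gcongr
  rw [e]
  set z0 := ∫ η in Ioo 0 ξ, Zf K a (uu a ρ q) ξ η (pq a q η ξ) (mm ρ ξ)
  have e2 : ρ * WW (uu a ρ q) ξ + ρ * mm ρ ξ * GG a ρ q ξ + ρ * z0 - mm ρ ξ =
      (ρ * WW (uu a ρ q) ξ - mm ρ ξ * (1 + ρ)⁻¹) + ρ * mm ρ ξ * (GG a ρ q ξ - (1 + ρ)⁻¹) + ρ * z0 := by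
    field_simp; ring
  rw [e2]
  refine (abs_add_three _ _ _).trans ?_
  have t2 : |ρ * mm ρ ξ * (GG a ρ q ξ - (1 + ρ)⁻¹)| ≤ ρ * 1 * ((2 * (1 + 2 / a) + 8 * B) * mm δ ξ) := by
    rw [abs_mul, abs_of_nonneg (by positivity : 0 ≤ ρ * mm ρ ξ)]; gcongr
  have t3 : |ρ * z0| ≤ ρ * (Z * B * mm δ ξ * L) := by
    rw [abs_mul, abs_of_nonneg hρ.le]; gcongr
  calc _ ≤ _ := add_le_add_three w t2 t3
    _ = _ := by ring

lemma FF_diff {a δ K0 : ℝ} (ha : 0 < a) (hδ : 0 < δ) (hδ1 : δ < 1) (hδa : δ < a) (hK0 : 0 < K0) :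
    ∃ C : ℝ, 0 < C ∧ ∀ (K : ℝ → ℝ → ℝ) (q₁ q₂ : ℝ → ℝ) (ρ d : ℝ), KH K a K0 δ → Par a δ ρ → InS δ ρ q₁ →
      InS δ ρ q₂ → (∀ ξ, 0 < ξ → |q₁ ξ - q₂ ξ| ≤ d * mm δ ξ) →
      ∀ ξ, 0 < ξ → |FF K a ρ q₁ ξ - FF K a ρ q₂ ξ| ≤ C * ρ * d * mm δ ξ := by
  obtain ⟨Z, hZ, hz⟩ := Z_bound ha hδ hδ1 hδa hK0
  obtain ⟨Y, hY, hy⟩ := dZ_bound ha hδ hδ1 hδa hK0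
  obtain ⟨B, hB, hb⟩ := uu_Vb ha
  obtain ⟨B', hB', hb'⟩ := du_Vb ha
  obtain ⟨c1, c2, c3⟩ := CP_ge ha
  set L := 4 + 2 * ((1 + a - δ) / (a - δ)) with hL
  have hL0 : 0 < L := by
    have : 0 < (1 + a - δ) / (a - δ) := div_pos (by linarith) (by linarith)
    positivity
  refine ⟨B' * ((1 + δ) / δ) + (2 * CE a + 8 * B') + (Y * B + Z * B') * L, by positivity,
    fun K q₁ q₂ ρ d hK hp h₁ h₂ hd ξ hξ => ?_⟩
  have hv₁ := hb δ ρ q₁ hp h₁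
  have hv₂ := hb δ ρ q₂ hp h₂
  have hv := hb' δ ρ q₁ q₂ d hp h₁ h₂ hd
  have hρ := hp.hρ
  have hd0 := d_nonneg hd
  obtain ⟨i₁, e₁⟩ := F_decomp hp hK h₁ hv₁ hξ
  obtain ⟨i₂, e₂⟩ := F_decomp hp hK h₂ hv₂ hξ
  have w := (WW_int ha hv hξ.le).2
  have hw : WW (fun ζ => uu a ρ q₁ ζ - uu a ρ q₂ ζ) ξ = WW (uu a ρ q₁) ξ - WW (uu a ρ q₂) ξ := by
    unfold WW
    rw [← integral_sub (WW_int ha hv₁ hξ.le).1 (WW_int ha hv₂ hξ.le).1]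
    congr 1; ext ζ; ring
  rw [hw] at w
  have g := G_diff hp h₁ h₂ hd hv₁ hv₂ hv hξ
  have m0 := mm_nonneg δ ξ
  have m1 := mm_nonneg ρ ξ
  have m2 := mm_le_one hρ.le ξ
  obtain ⟨mi, mb⟩ := Maj_int ha hδa hξ
  have z : |(∫ η in Ioo 0 ξ, Zf K a (uu a ρ q₁) ξ η (pq a q₁ η ξ) (mm ρ ξ)) -
      ∫ η in Ioo 0 ξ, Zf K a (uu a ρ q₂) ξ η (pq a q₂ η ξ) (mm ρ ξ)| ≤ ((Y * B + Z * B') * d * mm δ ξ) * L := by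
    rw [← integral_sub i₁ i₂, ← Real.norm_eq_abs]
    refine (norm_integral_le_of_norm_le (mi.const_mul ((Y * B + Z * B') * d * mm δ ξ)) ?_).trans ?_
    · rw [ae_restrict_iff' measurableSet_Ioo]
      refine Eventually.of_forall fun η hη => ?_
      rw [Zf_sub ha hδ hδ1.le hK hv₁ hv₂ hη.1 hη.2]
      have t1 := hy K _ q₁ q₂ d ρ ρ B ξ η hK hp h₁ h₂ hd hv₁ hη.1 hη.2
      have t2 := hz K _ q₂ ρ δ (B' * d) ξ η hK hp h₂ hv hη.1 hη.2
      refine (norm_add_le _ _).trans ((add_le_add t1 t2).trans (le_of_eq ?_))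
      ring
    · rw [integral_const_mul]; gcongr
  rw [e₁, e₂]
  set z1 := ∫ η in Ioo 0 ξ, Zf K a (uu a ρ q₁) ξ η (pq a q₁ η ξ) (mm ρ ξ)
  set z2 := ∫ η in Ioo 0 ξ, Zf K a (uu a ρ q₂) ξ η (pq a q₂ η ξ) (mm ρ ξ)
  have e2 : ρ * WW (uu a ρ q₁) ξ + ρ * mm ρ ξ * GG a ρ q₁ ξ + ρ * z1 -
      (ρ * WW (uu a ρ q₂) ξ + ρ * mm ρ ξ * GG a ρ q₂ ξ + ρ * z2) =
      ρ * (WW (uu a ρ q₁) ξ - WW (uu a ρ q₂) ξ) + ρ * mm ρ ξ * (GG a ρ q₁ ξ - GG a ρ q₂ ξ) + ρ * (z1 - z2) := by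
    ring
  rw [e2]
  refine (abs_add_three _ _ _).trans ?_
  have t1 : |ρ * (WW (uu a ρ q₁) ξ - WW (uu a ρ q₂) ξ)| ≤ ρ * (B' * d * ((1 + δ) / δ) * mm δ ξ) := by
    rw [abs_mul, abs_of_nonneg hρ.le]; gcongr
  have t2 : |ρ * mm ρ ξ * (GG a ρ q₁ ξ - GG a ρ q₂ ξ)| ≤ ρ * 1 * ((2 * CE a + 8 * B') * d * mm δ ξ) := by
    rw [abs_mul, abs_of_nonneg (by positivity : 0 ≤ ρ * mm ρ ξ)]
    have : 0 ≤ (2 * CE a + 8 * B') * d * mm δ ξ := by positivity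
    gcongr
  have t3 : |ρ * (z1 - z2)| ≤ ρ * (((Y * B + Z * B') * d * mm δ ξ) * L) := by
    rw [abs_mul, abs_of_nonneg hρ.le]; gcongr
  calc _ ≤ _ := add_le_add_three t1 t2 t3
    _ = _ := by ring
end

section
lemma J_contAt {K : ℝ → ℝ → ℝ} {v : ℝ → ℝ} {a δ K0 σ B η ξ : ℝ} (ha : 0 < a) (hδ : 0 < δ) (hδ1 : δ ≤ 1) (hK : KH K a K0 δ) (hv : Vb a σ B v) (hη : 0 < η)
    (hξ : η < ξ) : ContinuousAt (fun x => Jf K v x η) ξ := by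
  have hf : ContinuousOn (fun ζ => K η ζ * η⁻¹ * (ζ ^ 2)⁻¹ * v ζ) (Ioi 0) := by
    refine ((ContinuousOn.mul ?_ continuousOn_const).mul ?_).mul hv.cont
    · exact hK.cont.comp (f := fun ζ : ℝ => (η, ζ)) (by fun_prop) fun ζ hζ => ⟨hη, hζ⟩
    · exact ContinuousOn.inv₀ (by fun_prop) fun p hp => pow_ne_zero 2 (ne_of_gt hp)
  have hi : ∀ x, 0 < x → IntegrableOn (fun ζ => K η ζ * η⁻¹ * (ζ ^ 2)⁻¹ * v ζ) (Ioi x) := by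
    intro x hx
    have := J_int (ξ := η + x) ha hδ hδ1 hK hv hη (by linarith)
    rwa [add_sub_cancel_left] at this
  have h1 := (tail_hasDerivAt hf hi (x := ξ - η) (by linarith)).continuousAt
  exact ContinuousAt.comp (f := fun x => x - η) (x := ξ) h1 (by fun_prop)

lemma TT_contAt {K : ℝ → ℝ → ℝ} {a δ ρ K0 B ξ : ℝ} {q : ℝ → ℝ} (hp : Par a δ ρ) (hK : KH K a K0 δ) (h : InS δ ρ q)
    (hv : Vb a ρ B (uu a ρ q)) (hξ : 0 < ξ) : ContinuousAt (TT K ρ (uu a ρ q)) ξ := by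
  obtain ⟨C, hC, hb⟩ := J_bound hp.ha hp.hδ hp.hδ1.le hK hv
  set u := uu a ρ q with hu
  have e : TT K ρ u = fun x => ρ * ∫ η, (Ioo 0 x).indicator (fun η => u η * Jf K u x η) η := by
    ext x; unfold TT; rw [integral_indicator measurableSet_Ioo]
  rw [e]
  refine ContinuousAt.mul continuousAt_const ?_
  have i1 := (uu_int hp h (by linarith : 0 < ξ + 1)).1
  have i2 : IntegrableOn (fun _ : ℝ => (2:ℝ)) (Ioo 0 (ξ + 1)) := integrableOn_const (by simp)
  have i3 := (Integrable.add i1 i2).const_mul C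
  have n1 : ∀ᶠ x in nhds ξ, x ∈ Ioo 0 (ξ + 1) := Ioo_mem_nhds hξ (by linarith)
  refine continuousAt_of_dominated (bound := (Ioo 0 (ξ + 1)).indicator
    (fun η => C * (η ^ (-1 - a) * uu a ρ q η + 2))) ?_ ?_ ?_ ?_
  · filter_upwards [n1] with x hx
    rw [aestronglyMeasurable_indicator_iff measurableSet_Ioo]
    exact (uJ_int hp hK h hv hx.1).aestronglyMeasurable
  · filter_upwards [n1] with x hx
    refine Eventually.of_forall fun η => ?_
    by_cases hη : η ∈ Ioo 0 x
    · rw [indicator_of_mem hη, indicator_of_mem (show η ∈ Ioo 0 (ξ + 1) from ⟨hη.1, hη.2.trans hx.2⟩)]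
      have h1 := hb η x hη.1 hη.2
      have h2 := uu_pos hp h hη.1
      have h3 : uu a ρ q η ≤ 2 := by
        have := uu_le_two hp h hη.1
        have := mm_le_one hp.hρ.le η
        linarith
      rw [Real.norm_eq_abs, abs_mul, abs_of_pos h2]
      calc _ ≤ uu a ρ q η * (C * (η ^ (-1 - a) + 1)) := by gcongr
        _ = C * (η ^ (-1 - a) * uu a ρ q η + uu a ρ q η) := by ring
        _ ≤ _ := by gcongr
    · rw [indicator_of_notMem hη, norm_zero]
      refine indicator_nonneg (fun η hη => ?_) _
      have h2 := uu_pos hp h hη.1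
      have := Real.rpow_pos_of_pos hη.1 (-1 - a)
      positivity
  · rw [integrable_indicator_iff measurableSet_Ioo]
    exact i3
  · have : ∀ᵐ η : ℝ, η ≠ ξ := by simp [ae_iff]
    filter_upwards [this] with η hη
    rcases le_or_gt η 0 with h0 | h0
    · have : (fun x => (Ioo 0 x).indicator (fun η => u η * Jf K u x η) η) = fun _ => 0 := by
        ext x; exact indicator_of_notMem (fun hh => absurd hh.1 (not_lt.2 h0)) _
      rw [this]; exact continuousAt_const
    rcases lt_or_gt_of_ne hη with h1 | h1
    · have : (fun x => (Ioo 0 x).indicator (fun η => u η * Jf K u x η) η) =ᶠ[nhds ξ] fun x => u η * Jf K u x η := by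
        filter_upwards [lt_mem_nhds h1] with x hx
        exact indicator_of_mem (show η ∈ Ioo 0 x from ⟨h0, hx⟩) _
      refine ContinuousAt.congr ?_ this.symm
      exact continuousAt_const.mul (J_contAt hp.ha hp.hδ hp.hδ1.le hK hv h0 h1)
    · have : (fun x => (Ioo 0 x).indicator (fun η => u η * Jf K u x η) η) =ᶠ[nhds ξ] fun x => 0 := by
        filter_upwards [gt_mem_nhds h1] with x hx
        exact indicator_of_notMem (fun hh => absurd hh.2 (not_lt.2 hx.le)) _
      exact ContinuousAt.congr continuousAt_const this.symm

lemma FF_cont {K : ℝ → ℝ → ℝ} {a δ ρ K0 B : ℝ} {q : ℝ → ℝ} (hp : Par a δ ρ) (hK : KH K a K0 δ) (h : InS δ ρ q)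
    (hv : Vb a ρ B (uu a ρ q)) : ContinuousOn (FF K a ρ q) (Ioi 0) := by
  unfold FF
  refine ContinuousOn.div (fun ξ hξ => (TT_contAt hp hK h hv hξ).continuousWithinAt) (PP_cont hp h) ?_
  intro x _
  exact (PP_pos hp.hρ q x).ne'

lemma mm_InS {δ ρ : ℝ} : InS δ ρ (mm ρ) :=
  ⟨(mm_cont ρ).continuousOn, fun ξ _ => by
    rw [sub_self, abs_zero]; have := mm_nonneg δ ξ; positivity⟩

lemma fixed_point {K : ℝ → ℝ → ℝ} {a δ K0 C1 C2 ρ : ℝ} (hp : Par a δ ρ) (hK : KH K a K0 δ)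
    (hC1 : ∀ q, InS δ ρ q → ∀ ξ, 0 < ξ → |FF K a ρ q ξ - mm ρ ξ| ≤ C1 * ρ * mm δ ξ)
    (hC2 : ∀ q₁ q₂ d, InS δ ρ q₁ → InS δ ρ q₂ → (∀ ξ, 0 < ξ → |q₁ ξ - q₂ ξ| ≤ d * mm δ ξ) →
      ∀ ξ, 0 < ξ → |FF K a ρ q₁ ξ - FF K a ρ q₂ ξ| ≤ C2 * ρ * d * mm δ ξ)
    (h1 : C1 * ρ ≤ 1 / 2) (h2 : C2 * ρ ≤ 1 / 2) :
    ∃ q, InS δ ρ q ∧ (∀ ξ, 0 < ξ → FF K a ρ q ξ = q ξ) ∧ ∀ ξ, 0 < ξ → |q ξ - mm ρ ξ| ≤ C1 * ρ * mm δ ξ := by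
  obtain ⟨B, hB, hb⟩ := uu_Vb hp.ha
  set s : ℕ → ℝ → ℝ := fun n => (FF K a ρ)^[n] (mm ρ) with hs
  have sS : ∀ n, s (n + 1) = FF K a ρ (s n) := fun n => Function.iterate_succ_apply' _ _ _
  have Fmap : ∀ q, InS δ ρ q → InS δ ρ (FF K a ρ q) := fun q hq =>
    ⟨FF_cont hp hK hq (hb δ ρ q hp hq), fun ξ hξ => (hC1 q hq ξ hξ).trans (by
      have := mm_nonneg δ ξ; gcongr)⟩
  have sI : ∀ n, InS δ ρ (s n) := by
    intro n
    induction n with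
    | zero => exact mm_InS
    | succ n ih => rw [sS]; exact Fmap _ ih
  have sd : ∀ n ξ, 0 < ξ → |s (n + 1) ξ - s n ξ| ≤ (1 / 2) ^ n * mm δ ξ := by
    intro n
    induction n with
    | zero =>
      intro ξ hξ
      have := (hC1 _ mm_InS ξ hξ)
      rw [sS]
      have m := mm_nonneg δ ξ
      refine this.trans ?_
      rw [pow_zero]; gcongr; linarith
    | succ n ih =>
      intro ξ hξ
      have := hC2 _ _ _ (sI (n + 1)) (sI n) ih ξ hξ
      rw [sS (n + 1), sS n]
      rw [sS n] at this
      refine this.trans ?_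
      have m := mm_nonneg δ ξ
      rw [pow_succ']
      gcongr
  have sd' : ∀ n ξ, 0 < ξ → dist (s n ξ) (s (n + 1) ξ) ≤ 1 * (1 / 2) ^ n := by
    intro n ξ hξ
    rw [dist_comm, Real.dist_eq, one_mul]
    refine (sd n ξ hξ).trans ?_
    have := mm_le_one hp.hδ.le ξ
    exact mul_le_of_le_one_right (by positivity) this
  have ex : ∀ ξ, ∃ y, 0 < ξ → Tendsto (fun n => s n ξ) atTop (nhds y) := by
    intro ξ
    by_cases hξ : 0 < ξ
    · have := cauchySeq_of_le_geometric (1 / 2) 1 (by norm_num) (fun n => sd' n ξ hξ)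
      obtain ⟨y, hy⟩ := cauchySeq_tendsto_of_complete this
      exact ⟨y, fun _ => hy⟩
    · exact ⟨0, fun h => absurd h hξ⟩
  choose q hq using ex
  have sq : ∀ n ξ, 0 < ξ → dist (s n ξ) (q ξ) ≤ 1 * (1 / 2) ^ n / (1 - 1 / 2) := fun n ξ hξ =>
    dist_le_of_le_geometric_of_tendsto (1 / 2) 1 (by norm_num) (fun n => sd' n ξ hξ) (hq ξ hξ) n
  have sq' : ∀ n ξ, 0 < ξ → |s n ξ - q ξ| ≤ 2 * (1 / 2) ^ n * mm δ ξ := by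
    intro n ξ hξ
    have := dist_le_of_le_geometric_of_tendsto (1 / 2) (mm δ ξ) (by norm_num) (fun n => by
      rw [dist_comm, Real.dist_eq, mul_comm]; exact sd n ξ hξ) (hq ξ hξ) n
    rw [Real.dist_eq] at this
    refine this.trans (le_of_eq ?_)
    ring
  have unif : TendstoUniformlyOn s q atTop (Ioi 0) := by
    rw [Metric.tendstoUniformlyOn_iff]
    intro ε hε
    have t : Tendsto (fun n : ℕ => 1 * (1 / 2 : ℝ) ^ n / (1 - 1 / 2)) atTop (nhds 0) := by
      have := ((tendsto_pow_atTop_nhds_zero_of_lt_one (r := (1 / 2 : ℝ)) (by norm_num) (by norm_num)).const_mul 1).div_const (1 - 1 / 2)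
      simpa using this
    filter_upwards [t.eventually (gt_mem_nhds hε)] with n hn ξ hξ
    rw [dist_comm]
    exact (sq n ξ hξ).trans_lt hn
  have qc : ContinuousOn q (Ioi 0) := unif.continuousOn (Eventually.of_forall fun n => (sI n).cont).frequently
  have qb : ∀ ξ, 0 < ξ → |q ξ - mm ρ ξ| ≤ C1 * ρ * mm δ ξ := by
    intro ξ hξ
    refine le_of_tendsto (((hq ξ hξ).sub_const (mm ρ ξ)).abs) ?_
    filter_upwards [eventually_ge_atTop 1] with n hn
    obtain ⟨m, rfl⟩ := Nat.exists_eq_add_of_le' hn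
    rw [sS]
    exact hC1 _ (sI m) ξ hξ
  have qI : InS δ ρ q := ⟨qc, fun ξ hξ => (qb ξ hξ).trans (by have := mm_nonneg δ ξ; gcongr)⟩
  refine ⟨q, qI, fun ξ hξ => ?_, qb⟩
  have l1 : Tendsto (fun n => s (n + 1) ξ) atTop (nhds (q ξ)) := (hq ξ hξ).comp (tendsto_add_atTop_nat 1)
  have l2 : Tendsto (fun n => s (n + 1) ξ) atTop (nhds (FF K a ρ q ξ)) := by
    rw [tendsto_iff_dist_tendsto_zero]
    have t : Tendsto (fun n : ℕ => C2 * ρ * (2 * (1 / 2 : ℝ) ^ n) * mm δ ξ) atTop (nhds 0) := by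
      have := (((tendsto_pow_atTop_nhds_zero_of_lt_one (r := (1 / 2 : ℝ)) (by norm_num) (by norm_num)).const_mul 2).const_mul (C2 * ρ)).mul_const (mm δ ξ)
      simpa using this
    refine squeeze_zero (fun n => dist_nonneg) (fun n => ?_) t
    rw [sS, Real.dist_eq]
    exact hC2 _ _ _ (sI n) qI (sq' n) ξ hξ
  exact tendsto_nhds_unique l2 l1
end

section
lemma scale_Ioo (g : ℝ → ℝ) {l ξ : ℝ} (hl : 0 < l) (hξ : 0 < ξ) :
    ∫ η in Ioo 0 ξ, g (l * η) = l⁻¹ * ∫ η in Ioo 0 (l * ξ), g η := by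
  have h := intervalIntegral.integral_comp_mul_left (a := 0) (b := ξ) g hl.ne'
  rw [mul_zero, intervalIntegral.integral_of_le hξ.le, intervalIntegral.integral_of_le (by positivity),
    integral_Ioc_eq_integral_Ioo, integral_Ioc_eq_integral_Ioo, smul_eq_mul] at h
  exact h

noncomputable def Ph (M l ρ : ℝ) (u : ℝ → ℝ) (ξ : ℝ) : ℝ := M⁻¹ * ρ * (ξ ^ 2)⁻¹ * u (l * ξ)

lemma Ph_eq {K : ℝ → ℝ → ℝ} {γ M l ρ ξ : ℝ} {u : ℝ → ℝ} 
    (hh : ∀ x y α : ℝ, 0 < x → 0 < y → 0 < α → K (α*x) (α*y) = α ^ γ * K x y)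
    (hl : 0 < l) (hM : 0 < M) (hlM : l ^ γ = l / M) (hu : ∀ ξ, 0 < ξ → TT K ρ u ξ = u ξ) (hξ : 0 < ξ) :
    ξ ^ 2 * Ph M l ρ u ξ = ∫ η in Ioo 0 ξ, ∫ ζ in Ioi (ξ - η), K η ζ * η * Ph M l ρ u η * Ph M l ρ u ζ := by
  have h1 : ∀ η ∈ Ioo 0 ξ, (∫ ζ in Ioi (ξ - η), K η ζ * η * Ph M l ρ u η * Ph M l ρ u ζ) =
      M⁻¹ * ρ ^ 2 * l * (u (l * η) * Jf K u (l * ξ) (l * η)) := by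
    intro η hη
    have hη0 : 0 < η := hη.1
    have h2 := integral_comp_mul_left_Ioi (fun ζ => K (l * η) ζ * (l * η)⁻¹ * (ζ ^ 2)⁻¹ * u ζ) (ξ - η) hl
    rw [mul_sub, smul_eq_mul] at h2
    have e : ∀ ζ ∈ Ioi (ξ - η), K η ζ * η * Ph M l ρ u η * Ph M l ρ u ζ =
        M⁻¹ * ρ ^ 2 * l ^ 2 * u (l * η) * (K (l * η) (l * ζ) * (l * η)⁻¹ * ((l * ζ) ^ 2)⁻¹ * u (l * ζ)) := by
      intro ζ hζ
      have hζ0 : 0 < ζ := lt_trans (by linarith [hη.2]) (mem_Ioi.1 hζ)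
      rw [hh η ζ l hη0 hζ0 hl, hlM]
      unfold Ph
      field_simp
    rw [setIntegral_congr_fun measurableSet_Ioi e, integral_const_mul, h2]
    unfold Jf
    field_simp
  rw [setIntegral_congr_fun measurableSet_Ioo h1, integral_const_mul,
    scale_Ioo (fun η => u η * Jf K u (l * ξ) η) hl hξ]
  have h3 := hu (l * ξ) (by positivity)
  unfold TT at h3
  unfold Ph
  rw [← h3]
  field_simp

lemma Ph_mass {M l ρ : ℝ} {u : ℝ → ℝ} (hl : 0 < l) (hM : 0 < M) (hW : ρ * WW u 0 = M) :
    ∫ ξ in Ioi 0, ξ * Ph M l ρ u ξ = 1 := by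
  have h2 := integral_comp_mul_left_Ioi (fun ζ => ζ⁻¹ * u ζ) 0 hl
  rw [mul_zero, smul_eq_mul] at h2
  have e : ∀ ξ ∈ Ioi (0:ℝ), ξ * Ph M l ρ u ξ = M⁻¹ * ρ * l * ((l * ξ)⁻¹ * u (l * ξ)) := by
    intro ξ hξ
    have : 0 < ξ := hξ
    unfold Ph; field_simp
  rw [setIntegral_congr_fun measurableSet_Ioi e, integral_const_mul, h2]
  unfold WW at hW
  have e3 : M⁻¹ * ρ * l * (l⁻¹ * ∫ x in Ioi 0, x⁻¹ * u x) = M⁻¹ * (l * l⁻¹) * (ρ * ∫ x in Ioi 0, x⁻¹ * u x) := by ring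
  rw [e3, hW, mul_inv_cancel₀ hl.ne', mul_one, inv_mul_cancel₀ hM.ne']

lemma Ph_mg {M l ρ γ a : ℝ} {u : ℝ → ℝ} (hγ : a = 1 - γ) (hl : 0 < l) (hM : 0 < M) (hla : l ^ a = M)
    (hu : ∫ η in Ioi 0, η ^ (-1 - a) * u η = (1 + ρ)⁻¹) :
    ∫ ξ in Ioi 0, ξ ^ γ * Ph M l ρ u ξ = ρ / (1 + ρ) := by
  have h2 := integral_comp_mul_left_Ioi (fun η => η ^ (-1 - a) * u η) 0 hl
  rw [mul_zero, smul_eq_mul, hu] at h2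
  have e : ∀ ξ ∈ Ioi (0:ℝ), ξ ^ γ * Ph M l ρ u ξ = ρ * l * ((l * ξ) ^ (-1 - a) * u (l * ξ)) := by
    intro ξ hξ
    have hξ0 : 0 < ξ := hξ
    have e1 : ξ ^ (-1 - a) = ξ ^ γ * (ξ ^ 2)⁻¹ := by
      have : -1 - a = γ - 2 := by rw [hγ]; ring
      rw [this, Real.rpow_sub hξ0, Real.rpow_two]; rfl
    have e2 : l ^ (-1 - a) = l⁻¹ * M⁻¹ := by
      rw [Real.rpow_sub hl, Real.rpow_neg_one, hla]; rfl
    rw [Real.mul_rpow hl.le hξ0.le, e1, e2]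
    unfold Ph; field_simp
  rw [setIntegral_congr_fun measurableSet_Ioi e, integral_const_mul, h2]
  field_simp

lemma II_up {a δ ρ η : ℝ} {q : ℝ → ℝ} (hp : Par a δ ρ) (h : InS δ ρ q)
    (hb : ∀ ξ, 0 < ξ → |q ξ - mm ρ ξ| ≤ 1 / 4 * mm δ ξ) (hη : 0 < η) :
    II a q η ≤ 5 / 4 * (η ^ (-a) / a) := by
  unfold II
  rw [← pow_integral hp.ha hη, ← integral_const_mul]
  apply setIntegral_mono_on (h.w_int hp hη) ((pow_int hp.ha hη).const_mul _) measurableSet_Ioi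
  intro s hs
  have hs0 : 0 < s := hη.trans hs
  have h1 := (abs_le.1 (hb s hs0)).2
  have h2 := mm_le_one hp.hδ.le s
  have h3 := mm_le_one hp.hρ.le s
  have : 0 < s ^ (-1 - a) := by positivity
  nlinarith

lemma II_low {a δ ρ η : ℝ} {q : ℝ → ℝ} (hp : Par a δ ρ) (h : InS δ ρ q)
    (hb : ∀ ξ, 0 < ξ → |q ξ - mm ρ ξ| ≤ 1 / 4 * mm δ ξ) (hη : 0 < η) (hη1 : η ≤ 1) :
    3 / 4 * ((η ^ (-a) - 1) / a) ≤ II a q η := by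
  have h1 := pow_Ioc hp.ha hη hη1
  rw [Real.one_rpow] at h1
  rw [II_sub hp h hη hη1, ← h1, ← integral_const_mul]
  have h2 := II_nonneg hp h one_pos
  have : ∫ s in Ioc η 1, 3 / 4 * s ^ (-1 - a) ≤ ∫ s in Ioc η 1, s ^ (-1 - a) * q s := by
    apply setIntegral_mono_on (((pow_int hp.ha hη).mono_set Ioc_subset_Ioi_self).const_mul _)
      ((h.w_int hp hη).mono_set Ioc_subset_Ioi_self) measurableSet_Ioc
    intro s hs
    have hs0 : 0 < s := hη.trans hs.1
    have h1 := (abs_le.1 (hb s hs0)).1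
    rw [mm_of_le hs.2, mm_of_le hs.2] at h1
    have : 0 < s ^ (-1 - a) := by positivity
    nlinarith
  linarith

lemma Ph_bounds {a δ ρ M l : ℝ} {q : ℝ → ℝ} (hp : Par a δ ρ) (h : InS δ ρ q)
    (hb : ∀ ξ, 0 < ξ → |q ξ - mm ρ ξ| ≤ 1 / 4 * mm δ ξ) (hl : 0 < l) (hla : l ^ a = M)
    (hM1 : 3 / 4 ≤ M) (hM2 : M ≤ 3 / 2) :
    ∃ c1 c2 ξ0 : ℝ, 0 < c1 ∧ 0 < c2 ∧ ξ0 ∈ Ioo (0:ℝ) 1 ∧ ∀ ξ ∈ Ioo 0 ξ0,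
      c1 * ρ * ξ ^ (-2:ℝ) * Real.exp (-(2 / a) * ξ ^ (-a)) ≤ Ph M l ρ (uu a ρ q) ξ ∧
      Ph M l ρ (uu a ρ q) ξ ≤ c2 * ρ * ξ ^ (-2:ℝ) * Real.exp (-(1 / (2 * a)) * ξ ^ (-a)) := by
  have ha := hp.ha
  have hρ := hp.hρ
  have hM : 0 < M := by linarith
  refine ⟨M⁻¹ * (3 / 4) * (1 + ρ)⁻¹, M⁻¹ * (5 / 4) * (1 + ρ)⁻¹ * Real.exp (3 / (4 * a)), min (1 / 2) l⁻¹, by positivity, by positivity,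
    ⟨by positivity, (min_le_left _ _).trans_lt (by norm_num)⟩, fun ξ hξ => ?_⟩
  have hξ0 : 0 < ξ := hξ.1
  have hy0 : 0 < l * ξ := by positivity
  have hy1 : l * ξ ≤ 1 := by
    have : ξ < l⁻¹ := hξ.2.trans_le (min_le_right _ _)
    have := mul_lt_mul_of_pos_left this hl
    rw [mul_inv_cancel₀ hl.ne'] at this
    exact this.le
  have e1 : ξ ^ (-2:ℝ) = (ξ ^ 2)⁻¹ := by rw [Real.rpow_neg hξ0.le, Real.rpow_two]
  have e2 : (l * ξ) ^ (-a) = M⁻¹ * ξ ^ (-a) := by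
    rw [Real.mul_rpow hl.le hξ0.le, Real.rpow_neg hl.le, hla]
  have u := II_up hp h hb hy0
  have w := II_low hp h hb hy0 hy1
  rw [e2] at u w
  have X : 0 < ξ ^ (-a) := by positivity
  set x := ξ ^ (-a)
  have b := abs_le.1 (hb _ hy0)
  rw [mm_of_le hy1, mm_of_le hy1] at b
  have i1 : M⁻¹ ≤ 4 / 3 := by
    rw [inv_le_comm₀ hM (by norm_num)]; linarith
  have i2 : 2 / 3 ≤ M⁻¹ := by
    rw [le_inv_comm₀ (by norm_num) hM]; linarith
  have u' : II a q (l * ξ) ≤ 2 / a * x := by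
    refine u.trans ?_
    rw [← mul_div_assoc, div_mul_eq_mul_div 2 a x]
    apply div_le_div_of_nonneg_right _ ha.le
    nlinarith
  have w' : 1 / (2 * a) * x - 3 / (4 * a) ≤ II a q (l * ξ) := by
    refine le_trans ?_ w
    have : 1 / (2 * a) * x - 3 / (4 * a) = (1 / 2 * x - 3 / 4) / a := by field_simp
    rw [this, ← mul_div_assoc]
    apply div_le_div_of_nonneg_right _ ha.le
    nlinarith
  unfold Ph uu PP
  rw [e1]
  constructor
  · have : Real.exp (-(2 / a) * x) ≤ Real.exp (-II a q (l * ξ)) := Real.exp_le_exp.2 (by linarith)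
    calc _ = M⁻¹ * ρ * (ξ ^ 2)⁻¹ * (3 / 4 * ((1 + ρ)⁻¹ * Real.exp (-(2 / a) * x))) := by ring
      _ ≤ _ := by
        have : 3 / 4 ≤ q (l * ξ) := by linarith
        gcongr
  · have : Real.exp (-II a q (l * ξ)) ≤ Real.exp (3 / (4 * a)) * Real.exp (-(1 / (2 * a)) * x) := by
      rw [← Real.exp_add]; exact Real.exp_le_exp.2 (by linarith)
    calc _ ≤ M⁻¹ * ρ * (ξ ^ 2)⁻¹ * (5 / 4 * ((1 + ρ)⁻¹ * (Real.exp (3 / (4 * a)) * Real.exp (-(1 / (2 * a)) * x)))) := by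
          have : q (l * ξ) ≤ 5 / 4 := by linarith
          gcongr
      _ = _ := by ring

lemma Ph_tail {a δ ρ M l : ℝ} {q : ℝ → ℝ} (hp : Par a δ ρ) (hρδ : ρ < δ) (h : InS δ ρ q)
    (hl : 0 < l) :
    Tendsto (fun ξ => ξ ^ (2 + ρ) * Ph M l ρ (uu a ρ q) ξ) atTop (nhds (M⁻¹ * l ^ (-ρ) * (1 + ρ)⁻¹ * ρ)) := by
  have t1 : Tendsto (fun y : ℝ => y ^ ρ * q y) atTop (nhds 1) := by
    have t : Tendsto (fun y : ℝ => 1 / 2 * y ^ (-(δ - ρ))) atTop (nhds 0) := by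
      have := (tendsto_rpow_neg_atTop (by linarith : 0 < δ - ρ)).const_mul (1 / 2 : ℝ)
      rwa [mul_zero] at this
    rw [tendsto_iff_dist_tendsto_zero]
    refine squeeze_zero' (Eventually.of_forall fun _ => dist_nonneg) ?_ t
    filter_upwards [eventually_ge_atTop 1] with y hy
    have hy0 : 0 < y := by linarith
    have b := h.bd y hy0
    rw [mm_of_ge hy, mm_of_ge hy] at b
    have e : y ^ ρ * q y - 1 = y ^ ρ * (q y - y ^ (-ρ)) := by
      rw [mul_sub, ← Real.rpow_add hy0]; simp
    rw [Real.dist_eq, e, abs_mul, abs_of_pos (by positivity : 0 < y ^ ρ)]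
    calc _ ≤ y ^ ρ * (1 / 2 * y ^ (-δ)) := by gcongr
      _ = 1 / 2 * (y ^ ρ * y ^ (-δ)) := by ring
      _ = _ := by rw [← Real.rpow_add hy0]; congr 2; ring
  have t2 := t1.mul (PP_tendsto_top hp h)
  have t3 := (t2.comp (tendsto_id.const_mul_atTop hl)).const_mul (M⁻¹ * ρ * l ^ (-ρ))
  have e : M⁻¹ * ρ * l ^ (-ρ) * (1 * (1 + ρ)⁻¹) = M⁻¹ * l ^ (-ρ) * (1 + ρ)⁻¹ * ρ := by ring
  rw [e] at t3
  refine t3.congr' ?_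
  filter_upwards [eventually_gt_atTop 0] with ξ hξ
  have e1 : l ^ (-ρ) * (l * ξ) ^ ρ = ξ ^ ρ := by
    rw [Real.mul_rpow hl.le hξ.le, ← mul_assoc, ← Real.rpow_add hl]; simp
  simp only [Function.comp, id]
  unfold Ph uu
  rw [Real.rpow_add hξ, Real.rpow_two, ← e1]
  field_simp

lemma exist_all {K : ℝ → ℝ → ℝ} {γ a K0 δ : ℝ} (hγ : a = 1 - γ) (hδ : 0 < δ) (hδ1 : δ < 1) (hδa : δ < a)
    (hh : ∀ x y α : ℝ, 0 < x → 0 < y → 0 < α → K (α*x) (α*y) = α ^ γ * K x y) (hK : KH K a K0 δ) :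
    ∃ ρs C : ℝ, 0 < ρs ∧ ∀ ρ, ρ ∈ Ioo 0 ρs → ∃ M : ℝ, 0 < M ∧ |M - 1| ≤ C * ρ ∧
      ∃ Φ : ℝ → ℝ, ContinuousOn Φ (Ioi 0) ∧ (∀ ξ, 0 < ξ → 0 < Φ ξ) ∧
        (∀ ξ, 0 < ξ → ξ ^ 2 * Φ ξ = ∫ η in Ioo 0 ξ, ∫ ζ in Ioi (ξ - η), K η ζ * η * Φ η * Φ ζ) ∧
        (∫ ξ in Ioi 0, ξ * Φ ξ) = 1 ∧ (∫ ξ in Ioi 0, ξ ^ γ * Φ ξ) = ρ / (1 + ρ) ∧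
        (∃ c1 c2 ξ0 : ℝ, 0 < c1 ∧ 0 < c2 ∧ ξ0 ∈ Ioo (0:ℝ) 1 ∧ ∀ ξ ∈ Ioo 0 ξ0,
          c1 * ρ * ξ ^ (-2:ℝ) * Real.exp (-(2 / a) * ξ ^ (-a)) ≤ Φ ξ ∧
          Φ ξ ≤ c2 * ρ * ξ ^ (-2:ℝ) * Real.exp (-(1 / (2 * a)) * ξ ^ (-a))) ∧
        Tendsto (fun ξ => ξ ^ (2 + ρ) * Φ ξ) atTop (nhds (M⁻¹ * M ^ (-ρ / a) * (1 + ρ)⁻¹ * ρ)) := by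
  have ha : 0 < a := hδ.trans hδa
  obtain ⟨C1, hC1, h1⟩ := FF_one ha hδ hδ1 hδa hK.K0pos
  obtain ⟨C2, hC2, h2⟩ := FF_diff ha hδ hδ1 hδa hK.K0pos
  obtain ⟨B, hB, hb⟩ := uu_Vb ha
  set C3 := (B + 2 + 2 / a) * ((1 + δ) / δ) + 1 with hC3
  have hC3' : 0 < C3 := by positivity
  refine ⟨min (min (1 / 4 / C1) (1 / 2 / C2)) (min (1 / 4 / C3) δ), C3, by positivity, fun ρ hρ' => ?_⟩
  obtain ⟨hρ, hρ2⟩ := hρ'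
  rw [lt_min_iff, lt_min_iff, lt_min_iff, lt_div_iff₀ hC1, lt_div_iff₀ hC2, lt_div_iff₀ hC3'] at hρ2
  obtain ⟨⟨r1, r2⟩, r3, r4⟩ := hρ2
  have hp : Par a δ ρ := ⟨ha, hδ, hδ1, hδa, hρ, r4.le⟩
  obtain ⟨q, qI, qf, qb⟩ := fixed_point hp hK (fun q hq => h1 K q ρ hK hp hq)
    (fun q₁ q₂ d hq₁ hq₂ hd => h2 K q₁ q₂ ρ d hK hp hq₁ hq₂ hd) (by linarith) (by linarith)
  have qb' : ∀ ξ, 0 < ξ → |q ξ - mm ρ ξ| ≤ 1 / 4 * mm δ ξ := fun ξ hξ => (qb ξ hξ).trans (by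
    have := mm_nonneg δ ξ; gcongr; linarith)
  have hv := hb δ ρ q hp qI
  have w := W_bound hp qI hv le_rfl
  rw [mm_of_le zero_le_one, mm_of_le zero_le_one, one_mul, mul_one] at w
  set M := ρ * WW (uu a ρ q) 0 with hM
  have i1 : |(1 + ρ)⁻¹ - 1| ≤ ρ := by
    have e : (1 + ρ)⁻¹ - 1 = -(ρ / (1 + ρ)) := by field_simp; ring
    rw [e, abs_neg, abs_of_pos (by positivity)]
    exact div_le_self hρ.le (by linarith)
  have w2 : |M - 1| ≤ C3 * ρ := by
    have := abs_sub_le M (1 + ρ)⁻¹ 1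
    rw [hC3, add_mul]; linarith
  have w3 := abs_le.1 w2
  have hM0 : 0 < M := by linarith
  set l := M ^ (1 / a) with hl
  have hl0 : 0 < l := by positivity
  have hla : l ^ a = M := by rw [hl, ← Real.rpow_mul hM0.le, one_div_mul_cancel ha.ne', Real.rpow_one]
  have hlr : l ^ (-ρ) = M ^ (-ρ / a) := by rw [hl, ← Real.rpow_mul hM0.le]; congr 1; ring
  have hlg : l ^ γ = l / M := by
    have : γ = 1 - a := by linarith
    rw [this, Real.rpow_sub hl0, Real.rpow_one, hla]
  have hu : ∀ ξ, 0 < ξ → TT K ρ (uu a ρ q) ξ = uu a ρ q ξ := by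
    intro ξ hξ
    have := qf ξ hξ
    unfold FF at this
    rw [div_eq_iff (PP_pos hρ q ξ).ne'] at this
    exact this
  refine ⟨M, hM0, w2, Ph M l ρ (uu a ρ q), ?_, ?_, fun ξ hξ => Ph_eq hh hl0 hM0 hlg hu hξ, Ph_mass hl0 hM0 hM.symm,
    Ph_mg hγ hl0 hM0 hla (uu_int_all hp qI).2, Ph_bounds hp qI qb' hl0 hla (by linarith) (by linarith), ?_⟩
  · unfold Ph
    refine (continuousOn_const.mul ?_).mul ?_
    · exact ContinuousOn.inv₀ (by fun_prop) fun p hp => pow_ne_zero 2 (ne_of_gt hp)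
    · exact (uu_cont hp qI).comp (by fun_prop) fun x hx => mul_pos hl0 hx
  · intro ξ hξ
    have := uu_pos hp qI (mul_pos hl0 hξ)
    unfold Ph; positivity
  · rw [← hlr]; exact Ph_tail hp r4 qI hl0
end

/-- existence of the one-parameter family of self-similar profiles
(Theorem 1.1 of the paper). -/
theorem existence_of_selfsimilar_profiles
    (K : ℝ → ℝ → ℝ) (γ a K0 δ : ℝ) (hK : KernelHyp K γ a K0 δ) :
    ∃ ρstar : ℝ, 0 < ρstar ∧ ∃ kfun : ℝ → ℝ,
      (∀ ρ ∈ Ioo (0:ℝ) ρstar, 0 < kfun ρ ∧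
        ∃ Φ : ℝ → ℝ, ContinuousOn Φ (Ioi 0) ∧ (∀ ξ : ℝ, 0 < ξ → 0 < Φ ξ) ∧
          (∀ ξ : ℝ, 0 < ξ →
            ξ^2 * Φ ξ = ∫ η in Ioo 0 ξ, ∫ ζ in Ioi (ξ - η), K η ζ * η * Φ η * Φ ζ) ∧
          (∫ ξ in Ioi (0:ℝ), ξ * Φ ξ) = 1 ∧
          (∫ ξ in Ioi (0:ℝ), ξ ^ γ * Φ ξ) = ρ/(1+ρ) ∧
          (∃ c1 c2 ξ0 : ℝ, 0 < c1 ∧ 0 < c2 ∧ ξ0 ∈ Ioo (0:ℝ) 1 ∧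
            ∀ ξ ∈ Ioo (0:ℝ) ξ0,
              c1 * ρ * ξ ^ (-2 : ℝ) * Real.exp (-(2/a) * ξ ^ (-a)) ≤ Φ ξ ∧
              Φ ξ ≤ c2 * ρ * ξ ^ (-2 : ℝ) * Real.exp (-(1/(2*a)) * ξ ^ (-a))) ∧
          Tendsto (fun ξ : ℝ => ξ ^ (2+ρ) * Φ ξ) atTop (nhds (kfun ρ * ρ))) ∧
      Tendsto kfun (nhdsWithin 0 (Ioi 0)) (nhds 1) := by
  obtain ⟨hγ1, hγ, hc, hn, hs, hh, h0, hδ, hb⟩ := hK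
  have hK := KH_of hγ hc hn hs hh h0 hb
  obtain ⟨ρs, C, hρs, H⟩ := exist_all hγ hδ.1 (hδ.2.trans_le (min_le_left _ _))
    (hδ.2.trans_le (min_le_right _ _)) hh hK
  have ha : 0 < a := by linarith
  choose! M hM0 hM1 hΦ using H
  refine ⟨ρs, hρs, fun ρ => (M ρ)⁻¹ * (M ρ) ^ (-ρ / a) * (1 + ρ)⁻¹, fun ρ hρ => ⟨?_, hΦ ρ hρ⟩, ?_⟩
  · have h1 := hM0 ρ hρ
    have h2 : 0 < 1 + ρ := by linarith [hρ.1]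
    positivity
  · have tid : Tendsto (fun ρ : ℝ => ρ) (nhdsWithin 0 (Ioi 0)) (nhds 0) :=
      tendsto_id.mono_left nhdsWithin_le_nhds
    have tM : Tendsto M (nhdsWithin 0 (Ioi 0)) (nhds 1) := by
      rw [tendsto_iff_dist_tendsto_zero]
      have t : Tendsto (fun ρ : ℝ => C * ρ) (nhdsWithin 0 (Ioi 0)) (nhds 0) := by
        have := tid.const_mul C
        rwa [mul_zero] at this
      refine squeeze_zero' (Eventually.of_forall fun _ => dist_nonneg) ?_ t
      filter_upwards [Ioo_mem_nhdsGT hρs] with ρ hρ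
      rw [Real.dist_eq]; exact hM1 ρ hρ
    have t1 : Tendsto (fun ρ : ℝ => -ρ / a) (nhdsWithin 0 (Ioi 0)) (nhds 0) := by
      have := tid.neg.div_const a
      rwa [neg_zero, zero_div] at this
    have t2 := tM.rpow t1 (Or.inl one_ne_zero)
    have t3 : Tendsto (fun ρ : ℝ => (1 + ρ)⁻¹) (nhdsWithin 0 (Ioi 0)) (nhds 1) := by
      have := (tid.const_add 1).inv₀ (by norm_num)
      simpa using this
    have t4 := ((tM.inv₀ one_ne_zero).mul t2).mul t3
    simpa using t4
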